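/- arXiv:1609.01446 — 2 statements merged into one kernel-verified Lean document; each statement's English description precedes it below -/
import Mathlib

section
/- Let W(n) be the restricted Jacobson-Witt algebra and suppose W(n) is a p-subalgebra of a finite-dimensional restricted Lie algebra (g,[p]) over k with dim_k g − dim_k W(n) < p^n − 1. Then W(n) is an ideal of g and g decomposes as the direct sum g = C_g(W(n)) ⊕ W(n), where C_g(W(n)) is the centralizer of W(n) in g. -/
/-!
Preliminary definitions: restricted Lie algebras (following Strade–Farnsteiner),
tori, the invariants `μ` and `rk`.
-/

open scoped TensorProduct

section Defs

variable (p : ℕ) (k : Type*) [Field k] {L : Type*} [LieRing L] [LieAlgebra k L]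

/-- Jacobson's formula for a `p`-operation `op` on a Lie algebra `L`:
`(x+y)^{[p]} = x^{[p]} + y^{[p]} + ∑_{i=1}^{p-1} sᵢ(x,y)`, where the `sᵢ(x,y)` are
determined by `∑ i·sᵢ(x,y)·tⁱ⁻¹ = ad(t•x + y)^{p-1}(x)` in `L ⊗ k[t]`. -/
def JacobsonFormula (op : L → L) : Prop :=
  ∀ x y : L, ∃ s : ℕ → L,
    ((LieAlgebra.ad (Polynomial k) (Polynomial k ⊗[k] L)
        (Polynomial.X ⊗ₜ[k] x + (1 : Polynomial k) ⊗ₜ[k] y)) ^ (p - 1))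
        ((1 : Polynomial k) ⊗ₜ[k] x)
      = ∑ i ∈ Finset.range (p - 1), (Polynomial.X ^ i : Polynomial k) ⊗ₜ[k] (((i + 1) • s (i + 1) : L)) ∧
    op (x + y) = op x + op y + ∑ i ∈ Finset.range (p - 1), s (i + 1)

/-- `op` is a `p`-map (restricted structure) on the Lie algebra `L`. -/
structure IsPMap (op : L → L) : Prop where
  ad_op : ∀ x : L, LieAlgebra.ad k L (op x) = (LieAlgebra.ad k L x) ^ p
  op_smul : ∀ (c : k) (x : L), op (c • x) = c ^ p • op x
  jacobson : JacobsonFormula p k op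

variable {p}

/-- An element of a restricted Lie algebra is semisimple if it lies in the span of its
iterated `p`-th powers. -/
def IsSemisimpleElt (op : L → L) (x : L) : Prop :=
  x ∈ Submodule.span k {y : L | ∃ m : ℕ, 1 ≤ m ∧ y = op^[m] x}

/-- An element is `p`-nilpotent if some iterate of the `p`-map kills it. -/
def IsPNilpotentElt (op : L → L) (x : L) : Prop :=
  ∃ m : ℕ, op^[m] x = 0

/-- A torus of a restricted Lie algebra: a `p`-subalgebra consisting of semisimple
elements. -/
def IsTorus (op : L → L) (t : LieSubalgebra k L) : Prop :=
  (∀ x ∈ t, op x ∈ t) ∧ ∀ x ∈ t, IsSemisimpleElt k op x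

/-- `μ(L)`: the maximal dimension of a torus of the restricted Lie algebra `(L, op)`. -/
noncomputable def mu (op : L → L) : ℕ :=
  sSup {d : ℕ | ∃ t : LieSubalgebra k L, IsTorus k op t ∧ Module.finrank k t = d}

/-- The restriction of the `p`-map to a `p`-subalgebra. -/
def subOp (op : L → L) (K : LieSubalgebra k L) (h : ∀ x ∈ K, op x ∈ K) : K → K :=
  fun x => ⟨op x, h x x.2⟩

end Defs

/-- The rank of a (restricted) Lie algebra: the minimal dimension of a Cartan
subalgebra. By Premet's theorem this agrees with `dim C_L(t)` for any torus of maximal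
dimension. -/
noncomputable def lieRank (k L : Type*) [Field k] [LieRing L] [LieAlgebra k L] : ℕ :=
  sInf {d : ℕ | ∃ H : LieSubalgebra k L, H.IsCartanSubalgebra ∧ Module.finrank k H = d}

/-- The canonical projection onto the quotient by a Lie ideal, as a morphism of Lie
algebras. -/
def quotMk {k L : Type*} [Field k] [LieRing L] [LieAlgebra k L] (I : LieIdeal k L) :
    L →ₗ⁅k⁆ L ⧸ I :=
  { I.toSubmodule.mkQ with map_lie' := rfl }

/-!
The truncated polynomial ring `A(n) = k[X₁,…,Xₙ]/(X₁^p,…,Xₙ^p)`, its partial derivatives,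
the Jacobson–Witt algebra `W(n) = Der(A(n))`, and related Lie algebras of Cartan type.
-/

set_option synthInstance.maxHeartbeats 1000000
set_option maxHeartbeats 1600000

section Trunc

variable (p : ℕ) (k : Type*) [Field k] (n : ℕ)

/-- The defining ideal `(X₁^p, …, Xₙ^p)`. -/
noncomputable abbrev truncIdeal : Ideal (MvPolynomial (Fin n) k) :=
  Ideal.span {f | ∃ i : Fin n, f = MvPolynomial.X i ^ p}

/-- The truncated polynomial ring `A(n) := k[X₁,…,Xₙ]/(X₁^p,…,Xₙ^p)`. -/
noncomputable abbrev TruncPoly := MvPolynomial (Fin n) k ⧸ truncIdeal p k n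

variable [CharP k p]

theorem pderiv_mem_truncIdeal (i : Fin n) {f : MvPolynomial (Fin n) k}
    (hf : f ∈ truncIdeal p k n) : MvPolynomial.pderiv i f ∈ truncIdeal p k n := by
  induction hf using Submodule.span_induction with
  | mem x hx =>
    obtain ⟨j, rfl⟩ := hx
    have h0 : (p : MvPolynomial (Fin n) k) = 0 := CharP.cast_eq_zero _ p
    rw [Derivation.leibniz_pow]
    rw [nsmul_eq_mul, h0, zero_mul]
    exact Ideal.zero_mem _
  | zero => simp only [map_zero]; exact Ideal.zero_mem _
  | add x y _ _ hx hy => rw [map_add]; exact Ideal.add_mem _ hx hy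
  | smul a x hxmem hx =>
    rw [smul_eq_mul, Derivation.leibniz, smul_eq_mul, smul_eq_mul]
    exact Ideal.add_mem _ (Ideal.mul_mem_left _ _ hx) (Ideal.mul_mem_right _ _ hxmem)

/-- The partial derivative `∂/∂Xᵢ` on the truncated polynomial ring, as a derivation. -/
noncomputable def truncPD (i : Fin n) :
    Derivation k (TruncPoly p k n) (TruncPoly p k n) where
  toFun := fun a => Quotient.liftOn' a
    (fun f => Ideal.Quotient.mk (truncIdeal p k n) (MvPolynomial.pderiv i f))
    (by
      intro f g hfg
      rw [Submodule.quotientRel_def] at hfg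
      rw [Ideal.Quotient.eq]
      rw [← map_sub]
      exact pderiv_mem_truncIdeal p k n i hfg)
  map_add' := by
    rintro ⟨f⟩ ⟨g⟩
    show Ideal.Quotient.mk _ (MvPolynomial.pderiv i (f + g)) =
      Ideal.Quotient.mk _ (MvPolynomial.pderiv i f) +
        Ideal.Quotient.mk _ (MvPolynomial.pderiv i g)
    rw [map_add, map_add]
  map_smul' := by
    rintro c ⟨f⟩
    show Ideal.Quotient.mkₐ k (truncIdeal p k n) (MvPolynomial.pderiv i (c • f)) =
      c • Ideal.Quotient.mkₐ k (truncIdeal p k n) (MvPolynomial.pderiv i f)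
    rw [Derivation.map_smul, map_smul]
  map_one_eq_zero' := by
    show Ideal.Quotient.mk (truncIdeal p k n) (MvPolynomial.pderiv i 1) = 0
    simp only [Derivation.map_one_eq_zero, map_zero]
  leibniz' := by
    rintro ⟨f⟩ ⟨g⟩
    show Ideal.Quotient.mk (truncIdeal p k n) (MvPolynomial.pderiv i (f * g)) =
      (Ideal.Quotient.mk (truncIdeal p k n) f) *
          (Ideal.Quotient.mk (truncIdeal p k n) (MvPolynomial.pderiv i g)) +
        (Ideal.Quotient.mk (truncIdeal p k n) g) *
          (Ideal.Quotient.mk (truncIdeal p k n) (MvPolynomial.pderiv i f))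
    rw [Derivation.leibniz, smul_eq_mul, smul_eq_mul, map_add, map_mul, map_mul]

/-- The image of the variable `Xᵢ` in the truncated polynomial ring. -/
noncomputable def truncX (i : Fin n) : TruncPoly p k n :=
  Ideal.Quotient.mk (truncIdeal p k n) (MvPolynomial.X i)

end Trunc
section CartanAlgebras

variable (p : ℕ) (k : Type*) [Field k] [CharP k p]

/-- The restricted Jacobson–Witt algebra `W(n) := Der(A(n))`. -/
noncomputable abbrev WittAlg (n : ℕ) :=
  Derivation k (TruncPoly p k n) (TruncPoly p k n)

end CartanAlgebras

/-- The centralizer `C_L(W)` of a Lie subalgebra `W` in `L`. -/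
def lieCentralizer (k : Type*) {L : Type*} [Field k] [LieRing L] [LieAlgebra k L]
    (W : LieSubalgebra k L) : Submodule k L where
  carrier := {x | ∀ y ∈ W, ⁅x, y⁆ = 0}
  add_mem' := by
    intro a b ha hb y hy
    rw [add_lie, ha y hy, hb y hy, add_zero]
  zero_mem' := by
    intro y hy
    rw [zero_lie]
  smul_mem' := by
    intro c a ha y hy
    rw [smul_lie, ha y hy, smul_zero]



namespace WProof

/-- Generators and partial derivatives of a truncated polynomial ring. -/
structure WData (p : ℕ) (k A : Type*) [Field k] [CommRing A] [Algebra k A] (n : ℕ) where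
  y : Fin n → A
  pd : Fin n → Derivation k A A
  pd_y : ∀ i j, pd i (y j) = if i = j then 1 else 0
  y_pow : ∀ i, y i ^ p = 1
  gen : Algebra.adjoin k (Set.range y) = ⊤

namespace WData

variable {p : ℕ} {k A : Type*} [Field k] [CommRing A] [Algebra k A] {n : ℕ}

/-- monomials -/
def mon (S : WData p k A n) (β : Fin n → ℕ) : A := ∏ i, S.y i ^ β i

/-- basis of the torus -/
def t (S : WData p k A n) (i : Fin n) : Derivation k A A := S.y i • S.pd i

variable (S : WData p k A n)

theorem t_apply (i : Fin n) (a : A) : S.t i a = S.y i * S.pd i a := rfl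

theorem t_y (i j : Fin n) : S.t i (S.y j) = if i = j then S.y j else 0 := by
  rw [t_apply, pd_y]; split_ifs with h
  · rw [h, mul_one]
  · rw [mul_zero]

theorem y_cancel (hp : p ≠ 0) (i : Fin n) {a b : A} (h : S.y i * a = S.y i * b) : a = b := by
  have h2 : S.y i ^ (p - 1) * S.y i = 1 := by
    rw [← pow_succ, Nat.sub_add_cancel (Nat.pos_of_ne_zero hp), S.y_pow]
  calc a = S.y i ^ (p - 1) * S.y i * a := by rw [h2, one_mul]
    _ = S.y i ^ (p - 1) * S.y i * b := by rw [mul_assoc, h, mul_assoc]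
    _ = b := by rw [h2, one_mul]

theorem mon_add (β γ : Fin n → ℕ) : S.mon (β + γ) = S.mon β * S.mon γ := by
  simp only [mon, Pi.add_apply, pow_add, Finset.prod_mul_distrib]

theorem mon_single (i : Fin n) : S.mon (Pi.single i 1) = S.y i := by
  rw [mon, Finset.prod_eq_single i]
  · simp
  · intro j _ hj; simp [hj]
  · simp

theorem mon_congr {β γ : Fin n → ℕ} (h : ∀ i, β i ≡ γ i [MOD p]) : S.mon β = S.mon γ := by
  refine Finset.prod_congr rfl fun i _ => ?_
  rw [← pow_mod_natCard_aux (S.y i) (S.y_pow i) (β i), ← pow_mod_natCard_aux (S.y i) (S.y_pow i) (γ i), h i]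
where
  pow_mod_natCard_aux (a : A) (ha : a ^ p = 1) (m : ℕ) : a ^ (m % p) = a ^ m := by
    conv_rhs => rw [← Nat.mod_add_div m p, pow_add, pow_mul, ha, one_pow, mul_one]

theorem mon_zero : S.mon 0 = 1 := by simp [mon]

theorem mon_pow (β : Fin n → ℕ) : S.mon β ^ p = 1 := by
  rw [mon, ← Finset.prod_pow]
  refine Finset.prod_eq_one fun i _ => ?_
  rw [← pow_mul, mul_comm, pow_mul, S.y_pow, one_pow]

theorem t_mon (i : Fin n) (β : Fin n → ℕ) : S.t i (S.mon β) = (β i : A) * S.mon β := by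
  have key : ∀ s : Finset (Fin n), S.t i (∏ j ∈ s, S.y j ^ β j)
      = (if i ∈ s then (β i : A) else 0) * ∏ j ∈ s, S.y j ^ β j := by
    intro s
    induction s using Finset.induction_on with
    | empty => simp
    | insert a s ha ih =>
      rw [Finset.prod_insert ha, Derivation.leibniz, ih, Derivation.leibniz_pow, t_y]
      by_cases h : i = a
      · subst h
        rcases Nat.eq_zero_or_pos (β i) with h0 | h0
        · simp [ha, h0]
        · obtain ⟨m, hm⟩ := Nat.exists_eq_add_of_lt h0
          simp only [zero_add] at hm
          simp [ha, hm, pow_succ]; ring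
      · simp [h]; ring
  have := key Finset.univ
  simpa [mon] using this

theorem mon_span : Submodule.span k (Set.range S.mon) = ⊤ := by
  have h1 : Subalgebra.toSubmodule (Algebra.adjoin k (Set.range S.y)) = ⊤ := by
    rw [S.gen]; rfl
  rw [Algebra.adjoin_eq_span] at h1
  rw [eq_top_iff, ← h1]
  refine Submodule.span_mono ?_
  intro a ha
  induction ha using Submonoid.closure_induction with
  | mem x hx => obtain ⟨i, rfl⟩ := hx; exact ⟨_, S.mon_single i⟩
  | one => exact ⟨0, S.mon_zero⟩
  | mul x y _ _ hx hy =>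
    obtain ⟨a, rfl⟩ := hx; obtain ⟨b, rfl⟩ := hy
    exact ⟨a + b, S.mon_add a b⟩

theorem der_ext {D E : Derivation k A A} (h : ∀ i, D (S.y i) = E (S.y i)) : D = E := by
  refine Derivation.ext_of_adjoin_eq_top _ S.gen ?_
  rintro _ ⟨i, rfl⟩; exact h i

theorem sum_apply (s : Finset (Fin n)) (f : Fin n → Derivation k A A) (a : A) :
    (∑ i ∈ s, f i) a = ∑ i ∈ s, f i a := by
  induction s using Finset.induction_on with
  | empty => simp
  | insert i s hi ih => rw [Finset.sum_insert hi, Finset.sum_insert hi, Derivation.add_apply, ih]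

theorem der_eq (D : Derivation k A A) : D = ∑ i, D (S.y i) • S.pd i := by
  refine S.der_ext fun j => ?_
  rw [sum_apply]
  simp [pd_y]

/-- induction principle: additive predicates -/
theorem der_mem (N : Submodule k (Derivation k A A)) (h : ∀ β l, S.mon β • S.pd l ∈ N)
    (D : Derivation k A A) : D ∈ N := by
  rw [S.der_eq D]
  refine Submodule.sum_mem _ fun i _ => ?_
  have : D (S.y i) ∈ Submodule.span k (Set.range S.mon) := by rw [S.mon_span]; trivial
  generalize D (S.y i) = c at this
  induction this using Submodule.span_induction with
  | mem x hx => obtain ⟨β, rfl⟩ := hx; exact h β i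
  | zero => rw [zero_smul]; exact N.zero_mem
  | add x y _ _ hx hy => rw [add_smul]; exact N.add_mem hx hy
  | smul a x _ hx => rw [smul_assoc]; exact N.smul_mem _ hx

theorem lie_smul_smul (f g : A) (D E : Derivation k A A) :
    ⁅f • D, g • E⁆ = (f * D g) • E - (g * E f) • D + (f * g) • ⁅D, E⁆ := by
  ext a
  simp only [Derivation.commutator_apply, Derivation.smul_apply, Derivation.sub_apply,
    Derivation.add_apply, smul_eq_mul, Derivation.leibniz]
  ring

theorem lie_pd (i j : Fin n) : ⁅S.pd i, S.pd j⁆ = 0 := by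
  refine S.der_ext fun l => ?_
  rw [Derivation.commutator_apply, pd_y, pd_y]
  split_ifs <;> simp

theorem lie_t_smul_pd (i l : Fin n) (β : Fin n → ℕ) :
    ⁅S.t i, S.mon β • S.pd l⁆ = ((β i : k) - if i = l then 1 else 0) • S.mon β • S.pd l := by
  have h := S.t_mon i β
  rw [t_apply] at h
  rw [t, lie_smul_smul, lie_pd, h, pd_y]
  ext a
  by_cases hil : i = l
  · subst hil
    simp [Algebra.smul_def, sub_mul]; ring
  · have : ¬ l = i := fun h => hil h.symm
    simp [Algebra.smul_def, hil, this]; ring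

theorem lie_t_t (i j : Fin n) : ⁅S.t i, S.t j⁆ = 0 := by
  refine S.der_ext fun l => ?_
  rw [Derivation.commutator_apply, t_y, t_y]
  split_ifs <;> simp_all [t_y]

theorem lie_t_pd (i l : Fin n) : ⁅S.t i, S.pd l⁆ = -((if i = l then (1 : k) else 0) • S.pd l) := by
  have := S.lie_t_smul_pd i l 0
  rw [mon_zero, one_smul] at this
  rw [this, ← neg_smul]; simp

/-- no center -/
theorem center_eq_zero (S : WData p k A n) {w : Derivation k A A} (h : ∀ v : Derivation k A A, ⁅w, v⁆ = 0) : w = 0 := by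
  refine S.der_ext fun j => ?_
  have h1 : S.pd j (w (S.y j)) = 0 := by
    have := congrArg (fun D => D (S.y j)) (h (S.pd j))
    simpa [Derivation.commutator_apply, pd_y] using this
  have := congrArg (fun D => D (S.y j)) (h (S.t j))
  simp only [Derivation.commutator_apply] at this
  rw [t_y, if_pos rfl, t_apply, h1, mul_zero, sub_zero] at this
  exact this

/-- element of the torus with integer coordinates -/
def dd (S : WData p k A n) (lam : Fin n → ℕ) : Derivation k A A := ∑ i, (lam i : k) • S.t i

theorem dd_mon (lam β : Fin n → ℕ) :
    S.dd lam (S.mon β) = ((∑ i, lam i * β i : ℕ) : k) • S.mon β := by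
  rw [dd, sum_apply]
  simp only [Derivation.smul_apply, t_mon, Nat.cast_sum, Nat.cast_mul, Finset.sum_smul]
  refine Finset.sum_congr rfl fun i _ => ?_
  simp [Algebra.smul_def, mul_assoc]

theorem end_ext {f g : Module.End k A} (h : ∀ β, f (S.mon β) = g (S.mon β)) : f = g := by
  refine LinearMap.ext_on S.mon_span ?_
  rintro _ ⟨β, rfl⟩; exact h β

theorem dd_pow (hp : p.Prime) [CharP k p] (lam : Fin n → ℕ) :
    ((S.dd lam : Derivation k A A) : A →ₗ[k] A) ^ p = ((S.dd lam : A →ₗ[k] A) : Module.End k A) := by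
  have : Fact p.Prime := ⟨hp⟩
  refine S.end_ext fun β => ?_
  have : ∀ m : ℕ, (((S.dd lam : A →ₗ[k] A) : Module.End k A) ^ m) (S.mon β)
      = ((∑ i, lam i * β i : ℕ) : k) ^ m • S.mon β := by
    intro m
    induction m with
    | zero => simp
    | succ m ih =>
      rw [pow_succ', Module.End.mul_apply, ih, map_smul]
      erw [S.dd_mon]
      rw [smul_smul, pow_succ]
  rw [this]
  have h2 : ((∑ i, lam i * β i : ℕ) : k) ^ p = ((∑ i, lam i * β i : ℕ) : k) := by
    have := map_natCast (frobenius k p) (∑ i, lam i * β i)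
    rwa [frobenius_def] at this
  rw [h2]
  exact (S.dd_mon _ _).symm

theorem smul_pow_end (D : Derivation k A A) (f : A) (h : D f = 0) (m : ℕ) (a : A) :
    ((((f • D : Derivation k A A) : A →ₗ[k] A) : Module.End k A) ^ m) a
      = f ^ m * (((D : A →ₗ[k] A) : Module.End k A) ^ m) a := by
  have hf : ∀ m, D (f ^ m) = 0 := fun m => by rw [Derivation.leibniz_pow, h]; simp
  induction m with
  | zero => simp
  | succ m ih =>
    rw [pow_succ', Module.End.mul_apply, ih, pow_succ' _ m, pow_succ' _ m, Module.End.mul_apply]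
    change f * D _ = _ * D _
    rw [Derivation.leibniz, hf]
    simp; ring

theorem mon_dd_pow (hp : p.Prime) [CharP k p] (α lam : Fin n → ℕ) (h : p ∣ ∑ i, lam i * α i) :
    (((S.mon α • S.dd lam : Derivation k A A) : A →ₗ[k] A) : Module.End k A) ^ p
      = ((S.dd lam : A →ₗ[k] A) : Module.End k A) := by
  ext a
  rw [smul_pow_end, mon_pow, one_mul, S.dd_pow hp]
  rw [dd_mon, (CharP.cast_eq_zero_iff k p _).2 h, zero_smul]

theorem pd_mon (hp : p ≠ 0) (i : Fin n) (β : Fin n → ℕ) :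
    S.pd i (S.mon β) = (β i : A) * S.mon (β - Pi.single i 1) := by
  refine S.y_cancel hp i ?_
  rw [← t_apply, t_mon]
  rcases Nat.eq_zero_or_pos (β i) with h0 | h0
  · simp [h0]
  · have : β = (β - Pi.single i 1) + Pi.single i 1 := by
      ext j
      by_cases hj : j = i
      · subst hj; simp; omega
      · simp [hj]
    conv_lhs => rw [this, mon_add, mon_single]
    have h3 : ((β - Pi.single i 1 + Pi.single i 1 : Fin n → ℕ) i) = β i := by rw [← this]
    rw [h3]
    ring

theorem pd_pow (hp : p.Prime) [CharP k p] (i : Fin n) :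
    ((S.pd i : A →ₗ[k] A) : Module.End k A) ^ p = 0 := by
  refine S.end_ext fun β => ?_
  have : ∀ m : ℕ, (((S.pd i : A →ₗ[k] A) : Module.End k A) ^ m) (S.mon β)
      = ((β i).descFactorial m : k) • S.mon (β - Pi.single i m) := by
    intro m
    induction m with
    | zero => simp
    | succ m ih =>
      rw [pow_succ', Module.End.mul_apply, ih, map_smul]
      change _ • S.pd i _ = _
      rw [S.pd_mon hp.ne_zero]
      have h3 : β - Pi.single i m - Pi.single i 1 = β - Pi.single i (m + 1) := by
        ext j
        by_cases hj : j = i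
        · subst hj; simp; omega
        · simp [hj]
      rw [h3, Nat.descFactorial_succ]
      simp [Algebra.smul_def]; ring
  rw [this, LinearMap.zero_apply]
  have : p ∣ (β i).descFactorial p :=
    (hp.dvd_factorial.2 le_rfl).trans (Nat.factorial_dvd_descFactorial _ _)
  rw [(CharP.cast_eq_zero_iff k p _).2 this, zero_smul]

end WData

section RingPart

variable {p : ℕ} {k R : Type*} [Field k] [CharP k p] [Ring R] [Algebra k R]

theorem comm_e0 {D e0 : R} (h0 : e0 * D = D * e0 - D) (m : ℕ) :
    e0 * D ^ m = D ^ m * e0 - (m : k) • D ^ m := by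
  induction m with
  | zero => simp
  | succ m ih =>
    rw [pow_succ, ← mul_assoc, ih, sub_mul, mul_assoc, h0, smul_mul_assoc, mul_sub]
    push_cast
    rw [add_smul, one_smul, ← mul_assoc, ← pow_succ]
    abel

theorem comm_e1 {D e0 e1 : R} (h0 : e0 * D = D * e0 - D) (h1 : e1 * D = D * e1 - (2 : k) • e0)
    (m : ℕ) :
    e1 * D ^ (m + 1) = D ^ (m + 1) * e1 - (2 * (m + 1) : k) • (D ^ m * e0)
      + ((m + 1) * m : k) • D ^ m := by
  induction m with
  | zero => simp [h1]
  | succ m ih =>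
    rw [pow_succ, ← mul_assoc, ih, add_mul, sub_mul, mul_assoc, h1, smul_mul_assoc, mul_assoc,
      h0, smul_mul_assoc, mul_sub, mul_sub, ← mul_assoc, ← mul_assoc, ← pow_succ, ← pow_succ,
      mul_smul_comm]
    push_cast
    module

theorem comm_e2 {D e0 e1 e2 : R} (h0 : e0 * D = D * e0 - D)
    (h1 : e1 * D = D * e1 - (2 : k) • e0) (h2 : e2 * D = D * e2 - (3 : k) • e1) (m : ℕ) :
    e2 * D ^ (m + 2) = D ^ (m + 2) * e2 - (3 * (m + 2) : k) • (D ^ (m + 1) * e1)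
      + (3 * (m + 2) * (m + 1) : k) • (D ^ m * e0)
      - ((m + 2) * (m + 1) * m : k) • D ^ m := by
  induction m with
  | zero =>
    rw [pow_succ, ← mul_assoc, zero_add, pow_one, h2, sub_mul, mul_assoc, h2, smul_mul_assoc, h1]
    simp only [mul_sub, ← mul_assoc, mul_smul_comm, pow_zero, one_mul, Nat.cast_zero]
    module
  | succ m ih =>
    rw [pow_succ, ← mul_assoc, ih, sub_mul, add_mul, sub_mul, mul_assoc, h2, smul_mul_assoc,
      mul_assoc, h1, smul_mul_assoc, mul_assoc (D ^ m) e0 D,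
      h0, smul_mul_assoc]
    simp only [mul_sub, ← mul_assoc, mul_smul_comm, ← pow_succ]
    push_cast
    module

theorem witt1_D_zero (hp : p.Prime) {D e0 e1 e2 : R} (h0 : e0 * D = D * e0 - D)
    (h1 : e1 * D = D * e1 - (2 : k) • e0) (h2 : e2 * D = D * e2 - (3 : k) • e1)
    (j : ℕ) (hj : j + 2 ≤ p) (hD : D ^ j = 0) (hj1 : 1 ≤ j) : D = 0 := by
  induction j with
  | zero => omega
  | succ j ih =>
    rcases j with _ | m
    · simpa using hD
    · refine ih (by omega) ?_ (by omega)
      have c1 : e1 * D ^ (m + 2) = _ := comm_e1 h0 h1 (m + 1)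
      have c2 := comm_e2 h0 h1 h2 m
      have hD' : D ^ (m + 2) = 0 := hD
      have ne : ∀ q : ℕ, 0 < q → q < p → (q : k) ≠ 0 := fun q h h' e =>
        absurd (Nat.le_of_dvd h ((CharP.cast_eq_zero_iff k p q).1 e)) (by omega)
      have n2 := ne 2 (by omega) (by omega)
      have n3 := ne 3 (by omega) (by omega)
      have nm1 := ne (m + 1) (by omega) (by omega)
      have nm2 := ne (m + 2) (by omega) (by omega)
      have nm3 := ne (m + 3) (by omega) (by omega)
      push_cast at nm1 nm2 nm3 c1
      rw [hD'] at c1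
      rw [hD'] at c2
      have a1 : D * (D ^ (m + 1) * e1) = 0 := by rw [← mul_assoc, ← pow_succ', hD, zero_mul]
      have a2 : D * (D ^ m * e0) = D ^ (m + 1) * e0 := by rw [← mul_assoc, ← pow_succ']
      have a3 : D * D ^ m = D ^ (m + 1) := by rw [← pow_succ']
      have c3 := congrArg (fun z => D * z) c2
      beta_reduce at c3
      rw [mul_zero, mul_zero, zero_mul, zero_sub, mul_sub, mul_add, mul_neg, mul_smul_comm, a1,
        mul_smul_comm, a2, mul_smul_comm, a3, smul_zero, neg_zero, zero_add] at c3
      simp only [mul_zero, zero_mul, zero_sub] at c1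
      have c4 : (((m + 1) * (m + 2) * (m + 3) : k)) • D ^ (m + 1) = 0 := by
        have e : (((m + 1) * (m + 2) * (m + 3) : k)) • D ^ (m + 1)
          = (2 : k) • ((3 * (m + 2) * (m + 1) : k) • (D ^ (m + 1) * e0)
            - ((m + 2) * (m + 1) * m : k) • D ^ (m + 1)) + (3 * (m + 1) : k) •
            (-((2 * (m + 1 + 1) : k) • (D ^ (m + 1) * e0))
              + ((m + 1 + 1) * (m + 1) : k) • D ^ (m + 1)) := by module
        rw [e, ← c3, ← c1]; simp
      exact (smul_eq_zero.1 c4).resolve_left (mul_ne_zero (mul_ne_zero nm1 nm2) nm3)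

end RingPart

section Rep

variable {p : ℕ} {k A : Type*} [Field k] [CommRing A] [Algebra k A] {n : ℕ}
  (S : WData p k A n) {V : Type*} [AddCommGroup V] [Module k V]
  (ρ : Derivation k A A →ₗ[k] Module.End k V)

theorem rep_zero_of_t [CharP k p]
    (hρ : ∀ a b, ρ ⁅a, b⁆ = ρ a * ρ b - ρ b * ρ a)
    (ht : ∀ i, ρ (S.t i) = 0) : ρ = 0 := by
  have key : ∀ D, D ∈ LinearMap.ker ρ := by
    refine S.der_mem _ fun β l => ?_
    rw [LinearMap.mem_ker]
    by_cases h : ∃ i, ((β i : k) - if i = l then 1 else 0) ≠ 0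
    · obtain ⟨i, hi⟩ := h
      have := hρ (S.t i) (S.mon β • S.pd l)
      rw [S.lie_t_smul_pd, map_smul, ht, zero_mul, mul_zero, sub_zero] at this
      exact (smul_eq_zero.1 this).resolve_left hi
    · push Not at h
      have : S.mon β = S.mon (Pi.single l 1) := by
        refine S.mon_congr fun i => ?_
        rw [← CharP.cast_eq_iff_mod_eq_aux k p]
        rw [sub_eq_zero.1 (h i)]
        by_cases hil : i = l
        · subst hil; simp
        · simp [hil]
      rw [this, S.mon_single]
      exact ht l
  exact LinearMap.ext fun D => key D
where
  CharP.cast_eq_iff_mod_eq_aux (k : Type _) [Field k] (p : ℕ) [CharP k p] {a b : ℕ} :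
      (a : k) = (b : k) ↔ a ≡ b [MOD p] := CharP.natCast_eq_natCast k p

theorem dd_single (i : Fin n) : S.dd (Pi.single i 1) = S.t i := by
  rw [WData.dd, Finset.sum_eq_single i]
  · simp
  · intro j _ hj; simp [hj]
  · simp

theorem lie_t_mon_dd (i : Fin n) (α lam : Fin n → ℕ) :
    ⁅S.t i, S.mon α • S.dd lam⁆ = (α i : k) • S.mon α • S.dd lam := by
  have h : ⁅S.t i, S.dd lam⁆ = 0 := by
    rw [WData.dd, lie_sum]
    refine Finset.sum_eq_zero fun j _ => ?_
    have := S.lie_t_t i j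
    refine (lie_smul (lam j : k) (S.t i) (S.t j)).trans ?_
    rw [this, smul_zero]
  have := WData.lie_smul_smul (1 : A) (S.mon α) (S.t i) (S.dd lam)
  rw [one_smul, h, S.t_mon] at this
  rw [this]
  ext a
  simp [Algebra.smul_def, mul_assoc]

theorem rep_n_one (hp : p.Prime) (hp3 : 3 ≤ p) [CharP k p] [FiniteDimensional k V]
    (S : WData p k A 1) (hρ : ∀ a b, ρ ⁅a, b⁆ = ρ a * ρ b - ρ b * ρ a)
    (hpd : ∀ i, ρ (S.pd i) ^ p = 0) (hdim : Module.finrank k V < p - 1) : ρ = 0 := by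
  have hn : ρ (S.pd 0) ^ (Module.finrank k V) = 0 := by
    have : IsNilpotent (ρ (S.pd 0)) := ⟨p, hpd 0⟩
    have h2 := LinearMap.aeval_self_charpoly (ρ (S.pd 0))
    rw [IsNilpotent.charpoly_eq_X_pow_finrank this] at h2
    simpa using h2
  have hn' : ρ (S.pd 0) ^ (p - 2) = 0 := pow_eq_zero_of_le (by omega) hn
  have br : ∀ m : ℕ, ρ (S.y 0 ^ m • S.pd 0) * ρ (S.pd 0) = ρ (S.pd 0) * ρ (S.y 0 ^ m • S.pd 0)
      - (m : k) • ρ (S.y 0 ^ (m - 1) • S.pd 0) := by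
    intro m
    have h1 := hρ (S.pd 0) (S.y 0 ^ m • S.pd 0)
    have h2 : ⁅S.pd 0, S.y 0 ^ m • S.pd 0⁆ = (m : k) • (S.y 0 ^ (m - 1) • S.pd 0) := by
      have := WData.lie_smul_smul (1 : A) (S.y 0 ^ m) (S.pd 0) (S.pd 0)
      rw [one_smul, S.lie_pd, Derivation.leibniz_pow, S.pd_y] at this
      rw [this]
      ext a
      simp [Algebra.smul_def]; ring
    rw [h2, map_smul] at h1
    rw [h1]; abel
  have b1 := br 1
  have b2 := br 2
  have b3 := br 3
  simp only [Nat.sub_self, pow_zero, one_smul, Nat.cast_one] at b1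
  simp only [Nat.cast_ofNat] at b2 b3
  have e2 : (2 - 1 : ℕ) = 1 := rfl
  have e3 : (3 - 1 : ℕ) = 2 := rfl
  rw [e2] at b2
  rw [e3] at b3
  have hD : ρ (S.pd 0) = 0 := witt1_D_zero hp b1 b2 b3 (p - 2) (by omega) hn' (by omega)
  have h2 : (2 : k) ≠ 0 := by
    intro e
    have := Nat.le_of_dvd (by norm_num) ((CharP.cast_eq_zero_iff k p 2).1 (by exact_mod_cast e))
    omega
  refine rep_zero_of_t S ρ hρ fun i => ?_
  obtain rfl : i = 0 := Subsingleton.elim _ _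
  rw [hD, mul_zero, zero_mul, zero_sub, eq_comm, neg_eq_zero, pow_one] at b2
  exact (smul_eq_zero.1 b2).resolve_left h2

end Rep

section Rep2

open Module

variable {p : ℕ} {k A : Type*} [Field k] [CharP k p] [CommRing A] [Algebra k A] {n : ℕ}
  (S : WData p k A n) {V : Type*} [AddCommGroup V] [Module k V]
  (ρ : Derivation k A A →ₗ[k] Module.End k V)

/-- weight spaces -/
def wt (χ : Fin n → ZMod p) : Submodule k V :=
  ⨅ i, (ρ (S.t i)).eigenspace (ZMod.castHom (dvd_refl p) k (χ i))

theorem mem_wt (χ : Fin n → ZMod p) (v : V) :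
    v ∈ wt S ρ χ ↔ ∀ i, ρ (S.t i) v = ZMod.castHom (dvd_refl p) k (χ i) • v := by
  rw [wt, Submodule.mem_iInf]
  simp only [Module.End.mem_eigenspace_iff]

theorem wt_move (hp : p.Prime)
    (hρ : ∀ a b, ρ ⁅a, b⁆ = ρ a * ρ b - ρ b * ρ a)
    (hmon : ∀ α lam : Fin n → ℕ, p ∣ ∑ i, lam i * α i →
      ρ (S.mon α • S.dd lam) ^ p = ρ (S.dd lam))
    (χ δ : Fin n → ZMod p) (h : χ ∉ Submodule.span (ZMod p) {δ - χ})
    (hχ : wt S ρ χ ≠ ⊥) : wt S ρ δ ≠ ⊥ := by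
  have : Fact p.Prime := ⟨hp⟩
  obtain ⟨f, hf, hf2⟩ := Submodule.exists_dual_map_eq_bot_of_notMem h inferInstance
  have hf3 : f (δ - χ) = 0 := by
    have : f (δ - χ) ∈ (Submodule.span (ZMod p) {δ - χ}).map f :=
      Submodule.mem_map_of_mem (Submodule.mem_span_singleton_self _)
    rwa [hf2, Submodule.mem_bot] at this
  have fe : ∀ v, f v = ∑ i, v i * f (Pi.single i 1) := by
    intro v
    rw [LinearMap.pi_apply_eq_sum_univ f v]
    refine Finset.sum_congr rfl fun i _ => ?_
    rw [smul_eq_mul]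
    congr 2
    ext j; simp [Pi.single_apply, eq_comm]
  set lam : Fin n → ℕ := fun i => (f (Pi.single i 1)).val with hlam
  set α : Fin n → ℕ := fun i => ((δ - χ) i).val with hα
  have hdvd : p ∣ ∑ i, lam i * α i := by
    rw [← ZMod.natCast_eq_zero_iff]
    push_cast
    rw [← hf3, fe]
    refine Finset.sum_congr rfl fun i _ => ?_
    simp [hlam, hα, mul_comm]
  obtain ⟨v, hv, hv0⟩ := Submodule.exists_mem_ne_zero_of_ne_bot hχ
  rw [mem_wt] at hv
  have hE := hmon α lam hdvd
  have hd : ρ (S.dd lam) v = ZMod.castHom (dvd_refl p) k (f χ) • v := by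
    rw [WData.dd, map_sum, fe, map_sum, LinearMap.sum_apply, Finset.sum_smul]
    refine Finset.sum_congr rfl fun i _ => ?_
    rw [map_smul, LinearMap.smul_apply, hv i, smul_smul, mul_comm, map_mul]
    congr 2
    simp [hlam]
  have hEv : ρ (S.mon α • S.dd lam) v ≠ 0 := by
    intro h0
    have h1 : (ρ (S.mon α • S.dd lam) ^ p) v = 0 := by
      obtain ⟨q, hq⟩ : ∃ q, p = q + 1 := Nat.exists_eq_succ_of_ne_zero hp.ne_zero
      have h5 : ∀ g : Module.End k V, g v = 0 → (g ^ p) v = 0 := by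
        intro g hg
        have h6 : g ^ p = g ^ (q + 1) := congrArg (fun r => g ^ r) hq
        rw [h6, pow_succ, Module.End.mul_apply, hg, map_zero]
      exact h5 _ h0
    rw [hE, hd] at h1
    rcases smul_eq_zero.1 h1 with h2 | h2
    · exact hf ((map_eq_zero _).1 h2)
    · exact hv0 h2
  intro hbot
  apply hEv
  rw [← Submodule.mem_bot (R := k), ← hbot, mem_wt]
  intro i
  have h1 := hρ (S.t i) (S.mon α • S.dd lam)
  rw [lie_t_mon_dd, map_smul] at h1
  have h2 := congrArg (fun g => g v) h1
  simp only [LinearMap.smul_apply, LinearMap.sub_apply, Module.End.mul_apply] at h2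
  rw [hv i, LinearMap.map_smul (ρ (S.mon α • S.dd lam))] at h2
  rw [eq_sub_iff_add_eq, ← add_smul] at h2
  rw [← h2]
  congr 1
  have : (α i : k) = ZMod.castHom (dvd_refl p) k ((δ - χ) i) := by
    simp [hα]
  rw [this, ← map_add]; simp

theorem wt_all (hp : p.Prime) (hn : 2 ≤ n)
    (hρ : ∀ a b, ρ ⁅a, b⁆ = ρ a * ρ b - ρ b * ρ a)
    (hmon : ∀ α lam : Fin n → ℕ, p ∣ ∑ i, lam i * α i →
      ρ (S.mon α • S.dd lam) ^ p = ρ (S.dd lam))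
    (χ δ : Fin n → ZMod p) (h0 : χ ≠ 0) (h1 : δ ≠ 0)
    (hχ : wt S ρ χ ≠ ⊥) : wt S ρ δ ≠ ⊥ := by
  have : Fact p.Prime := ⟨hp⟩
  have step : ∀ χ δ : Fin n → ZMod p, χ ≠ 0 → δ ∉ Submodule.span (ZMod p) {χ} →
      wt S ρ χ ≠ ⊥ → wt S ρ δ ≠ ⊥ := by
    intro χ δ h0 h hχ
    refine wt_move S ρ hp hρ hmon χ δ (fun hm => h ?_) hχ
    obtain ⟨c, hc⟩ := Submodule.mem_span_singleton.1 hm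
    have hc0 : c ≠ 0 := by rintro rfl; rw [zero_smul] at hc; exact h0 hc.symm
    refine Submodule.mem_span_singleton.2 ⟨c⁻¹ + 1, ?_⟩
    have h7 : c⁻¹ • χ = c⁻¹ • (c • (δ - χ)) := by rw [hc]
    rw [smul_smul, inv_mul_cancel₀ hc0, one_smul] at h7
    rw [add_smul, one_smul, h7, sub_add_cancel]
  by_cases h : δ ∈ Submodule.span (ZMod p) {χ}
  · obtain ⟨ε, hε⟩ : ∃ ε, ε ∉ Submodule.span (ZMod p) {χ} := by
      by_contra hcon
      push Not at hcon
      have htop : Submodule.span (ZMod p) {χ} = ⊤ := eq_top_iff.2 fun x _ => hcon x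
      have h3 := finrank_span_singleton (K := ZMod p) h0
      rw [htop, finrank_top, Module.finrank_fin_fun] at h3
      omega
    have hε0 : ε ≠ 0 := by rintro rfl; exact hε (Submodule.zero_mem _)
    refine step ε δ hε0 (fun hm => hε ?_) (step χ ε h0 hε hχ)
    obtain ⟨c, hc⟩ := Submodule.mem_span_singleton.1 hm
    have hc0 : c ≠ 0 := by rintro rfl; rw [zero_smul] at hc; exact h1 hc.symm
    have : ε = c⁻¹ • δ := by rw [← hc, smul_smul, inv_mul_cancel₀ hc0, one_smul]
    rw [this]
    exact Submodule.smul_mem _ _ h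
  · exact step χ δ h0 h hχ

theorem rep_n_two (hp : p.Prime) (hn : 2 ≤ n) [IsAlgClosed k] [FiniteDimensional k V]
    (hρ : ∀ a b, ρ ⁅a, b⁆ = ρ a * ρ b - ρ b * ρ a)
    (hmon : ∀ α lam : Fin n → ℕ, p ∣ ∑ i, lam i * α i →
      ρ (S.mon α • S.dd lam) ^ p = ρ (S.dd lam))
    (hdim : Module.finrank k V < p ^ n - 1) : ρ = 0 := by
  have : Fact p.Prime := ⟨hp⟩
  classical
  have htp : ∀ i, ρ (S.t i) ^ p = ρ (S.t i) := by
    intro i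
    have := hmon 0 (Pi.single i 1) (by simp)
    rwa [S.mon_zero, one_smul, dd_single] at this
  have hcomm : ∀ i j, Commute (ρ (S.t i)) (ρ (S.t j)) := by
    intro i j
    have := hρ (S.t i) (S.t j)
    rw [S.lie_t_t, map_zero] at this
    exact (sub_eq_zero.1 this.symm)
  have hss : ∀ i μ, (ρ (S.t i)).maxGenEigenspace μ = (ρ (S.t i)).eigenspace μ := by
    intro i μ
    refine IsFinitelySemisimple_aux (ρ (S.t i)) ?_ μ
    refine Module.End.isSemisimple_of_squarefree_aeval_eq_zero
      (galois_poly_separable p p dvd_rfl : (Polynomial.X ^ p - Polynomial.X : Polynomial k).Separable).squarefree ?_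
    simp [htp]
  have hmaps : ∀ i j φ, Set.MapsTo (ρ (S.t i)) ((ρ (S.t j)).maxGenEigenspace φ)
      ((ρ (S.t j)).maxGenEigenspace φ) := fun i j φ =>
    Module.End.mapsTo_maxGenEigenspace_of_comm (hcomm j i) φ
  have hinj : Function.Injective (fun (χ : Fin n → ZMod p) (i : Fin n) =>
      ZMod.castHom (dvd_refl p) k (χ i)) := by
    intro a b h
    funext i
    exact (ZMod.castHom (dvd_refl p) k).injective (congrFun h i)
  have hind : iSupIndep (wt S ρ) := by
    have := (Module.End.independent_iInf_maxGenEigenspace_of_forall_mapsTo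
      (fun i => ρ (S.t i)) hmaps).comp hinj
    simp only [hss] at this
    exact this
  have hbot : ∀ χ : Fin n → ZMod p, χ ≠ 0 → wt S ρ χ = ⊥ := by
    intro χ h0
    by_contra hχ
    have hall : ∀ δ : Fin n → ZMod p, δ ≠ 0 → wt S ρ δ ≠ ⊥ := fun δ hδ =>
      wt_all S ρ hp hn hρ hmon χ δ h0 hδ hχ
    have h1 := hind.subtype_ne_bot_le_finrank
    have h2 : Fintype.card {δ : Fin n → ZMod p // δ ≠ 0} ≤
        Fintype.card {δ : Fin n → ZMod p // wt S ρ δ ≠ ⊥} :=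
      Fintype.card_subtype_mono _ _ hall
    have h3 : Fintype.card {δ : Fin n → ZMod p // δ ≠ 0} = p ^ n - 1 := by
      rw [Fintype.card_subtype_compl, Fintype.card_subtype_eq]
      simp [ZMod.card]
    omega
  have htop := Module.End.iSup_iInf_maxGenEigenspace_eq_top_of_forall_mapsTo
    (fun i => ρ (S.t i)) hmaps (fun i => Module.End.iSup_maxGenEigenspace_eq_top _)
  simp only [hss] at htop
  refine rep_zero_of_t S ρ hρ fun i => ?_
  rw [← LinearMap.ker_eq_top, eq_top_iff, ← htop]
  refine iSup_le fun χ => ?_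
  intro v hv
  rw [LinearMap.mem_ker]
  rw [Submodule.mem_iInf] at hv
  simp only [Module.End.mem_eigenspace_iff] at hv
  by_cases hv0 : v = 0
  · rw [hv0, map_zero]
  have hpw : ∀ j, χ j ^ p = χ j := by
    intro j
    have h1 : ∀ m : ℕ, (ρ (S.t j) ^ m) v = χ j ^ m • v := by
      intro m
      induction m with
      | zero => simp
      | succ m ih => rw [pow_succ', Module.End.mul_apply, ih, map_smul, hv j, smul_smul, pow_succ]
    have h2 := h1 p
    rw [htp, hv j] at h2
    exact (smul_left_injective k hv0 h2).symm
  have hz : ∀ j, ∃ c : ZMod p, ZMod.castHom (dvd_refl p) k c = χ j := by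
    intro j
    have h1 := (Subfield.mem_bot_iff_pow_eq_self k p).2 (hpw j)
    rw [← ZMod.fieldRange_castHom_eq_bot p] at h1
    exact h1
  choose c hc using hz
  by_cases hc0 : c = 0
  · rw [hv i, ← hc i, hc0]; simp
  · exfalso
    apply hv0
    rw [← Submodule.mem_bot (R := k), ← hbot c hc0, mem_wt]
    intro j
    rw [hc j, hv j]
where
  IsFinitelySemisimple_aux {V : Type _} [AddCommGroup V] [Module k V] [FiniteDimensional k V]
      (f : Module.End k V) (hf : f.IsSemisimple) (μ : k) :
      f.maxGenEigenspace μ = f.eigenspace μ :=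
    hf.isFinitelySemisimple.maxGenEigenspace_eq_eigenspace μ

theorem rep_trivial (hp : p.Prime) (hp3 : 3 ≤ p) [IsAlgClosed k] [FiniteDimensional k V]
    (hρ : ∀ a b, ρ ⁅a, b⁆ = ρ a * ρ b - ρ b * ρ a)
    (hpd : ∀ i, ρ (S.pd i) ^ p = 0)
    (hmon : ∀ α lam : Fin n → ℕ, p ∣ ∑ i, lam i * α i →
      ρ (S.mon α • S.dd lam) ^ p = ρ (S.dd lam))
    (hdim : Module.finrank k V < p ^ n - 1) : ρ = 0 := by
  match n, S, hpd, hmon, hdim with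
  | 0, S, hpd, hmon, hdim => simp at hdim
  | 1, S, hpd, hmon, hdim => exact rep_n_one ρ hp hp3 S hρ hpd (by simpa using hdim)
  | n + 2, S, hpd, hmon, hdim => exact rep_n_two S ρ hp (by omega) hρ hmon hdim

end Rep2

section Main

variable {p : ℕ} {k A : Type*} [Field k] [CharP k p] [CommRing A] [Algebra k A] {n : ℕ}
  (S : WData p k A n) {L : Type*} [LieRing L] [LieAlgebra k L]
  (ι : Derivation k A A →ₗ⁅k⁆ L)

theorem ad_pow_coe (hp : p.Prime) [Nontrivial A] (e d v : Derivation k A A)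
    (h : ((e : A →ₗ[k] A) : Module.End k A) ^ p = ((d : A →ₗ[k] A) : Module.End k A)) :
    ((LieAlgebra.ad k (Derivation k A A) e) ^ p) v = ⁅d, v⁆ := by
  have : Fact p.Prime := ⟨hp⟩
  let E : Module.End k A := (e : A →ₗ[k] A)
  have h1 : ∀ m : ℕ, ((((LieAlgebra.ad k (Derivation k A A) e) ^ m) v : A →ₗ[k] A) : Module.End k A)
      = ((LinearMap.mulLeft k E - LinearMap.mulRight k E) ^ m) (v : A →ₗ[k] A) := by
    intro m
    induction m with
    | zero => simp
    | succ m ih =>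
      rw [pow_succ', pow_succ', Module.End.mul_apply, Module.End.mul_apply, ← ih]
      rfl
  have : CharP (Module.End k (Module.End k A)) p :=
    charP_of_injective_algebraMap (algebraMap k (Module.End k (Module.End k A))).injective p
  have h2 := h1 p
  have h3 : (LinearMap.mulLeft k E - LinearMap.mulRight k E) ^ p
      = (LinearMap.mulLeft k E) ^ p - (LinearMap.mulRight k E) ^ p :=
    sub_pow_char_of_commute (R := Module.End k (Module.End k A)) p
      (LinearMap.commute_mulLeft_right E E)
  rw [h3, LinearMap.pow_mulLeft,
    LinearMap.pow_mulRight, show E ^ p = _ from h] at h2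
  ext a
  exact congrArg (fun g : Module.End k A => g a) h2

theorem ι_ad_pow (e v : Derivation k A A) (m : ℕ) :
    ((LieAlgebra.ad k L (ι e)) ^ m) (ι v) = ι (((LieAlgebra.ad k (Derivation k A A) e) ^ m) v) := by
  induction m with
  | zero => simp
  | succ m ih =>
    rw [pow_succ', pow_succ', Module.End.mul_apply, Module.End.mul_apply, ih, LieAlgebra.ad_apply,
      LieAlgebra.ad_apply, LieHom.map_lie]

theorem op_eq (S : WData p k A n) (hp : p.Prime) [Nontrivial A] (hι : Function.Injective ι) (op : L → L)
    (hop : ∀ x : L, LieAlgebra.ad k L (op x) = (LieAlgebra.ad k L x) ^ p)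
    (hcl : ∀ w, ∃ w', op (ι w) = ι w') (e d : Derivation k A A)
    (h : ((e : A →ₗ[k] A) : Module.End k A) ^ p = ((d : A →ₗ[k] A) : Module.End k A)) :
    op (ι e) = ι d := by
  obtain ⟨w, hw⟩ := hcl e
  have : w - d = 0 := by
    refine S.center_eq_zero fun v => ?_
    have h1 : ι ⁅w, v⁆ = ι ⁅d, v⁆ := by
      rw [← ad_pow_coe hp e d v h, ← ι_ad_pow, ← hop, hw, LieAlgebra.ad_apply, LieHom.map_lie]
    rw [sub_lie, hι h1, sub_self]
  rw [hw, sub_eq_zero.1 this]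

theorem ideal_of_small (S : WData p k A n) (hp : p.Prime) (hp3 : 3 ≤ p) [IsAlgClosed k] [FiniteDimensional k L]
    [Nontrivial A] (hι : Function.Injective ι) (op : L → L)
    (hop : ∀ x : L, LieAlgebra.ad k L (op x) = (LieAlgebra.ad k L x) ^ p)
    (W : Submodule k L) (hW : ∀ x, x ∈ W ↔ ∃ w, ι w = x)
    (hcl : ∀ x ∈ W, op x ∈ W)
    (hdim : Module.finrank k (L ⧸ W) < p ^ n - 1) (x : L) (w : Derivation k A A) :
    ⁅x, ι w⁆ ∈ W := by
  have hcl' : ∀ w, ∃ w', op (ι w) = ι w' := by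
    intro w
    obtain ⟨w', h'⟩ := (hW _).1 (hcl _ ((hW _).2 ⟨w, rfl⟩))
    exact ⟨w', h'.symm⟩
  have hst : ∀ w, W ≤ W.comap (LieAlgebra.ad k L (ι w)) := by
    intro w z hz
    obtain ⟨v, rfl⟩ := (hW z).1 hz
    rw [Submodule.mem_comap, LieAlgebra.ad_apply, ← LieHom.map_lie]
    exact (hW _).2 ⟨_, rfl⟩
  let ρ : Derivation k A A →ₗ[k] Module.End k (L ⧸ W) :=
    { toFun := fun w => W.mapQ W (LieAlgebra.ad k L (ι w)) (hst w)
      map_add' := by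
        intro a b
        refine LinearMap.ext fun z => ?_
        obtain ⟨z, rfl⟩ := W.mkQ_surjective z
        simp
      map_smul' := by
        intro a b
        refine LinearMap.ext fun z => ?_
        obtain ⟨z, rfl⟩ := W.mkQ_surjective z
        simp }
  have hρa : ∀ w (z : L), ρ w (W.mkQ z) = W.mkQ ⁅ι w, z⁆ := fun w z => rfl
  have hρ : ∀ a b, ρ ⁅a, b⁆ = ρ a * ρ b - ρ b * ρ a := by
    intro a b
    refine LinearMap.ext fun z => ?_
    obtain ⟨z, rfl⟩ := W.mkQ_surjective z
    rw [LinearMap.sub_apply, Module.End.mul_apply, Module.End.mul_apply]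
    simp only [hρa]
    rw [LieHom.map_lie, lie_lie, map_sub]
  have hpow : ∀ e (m : ℕ) (z : L), ((ρ e) ^ m) (W.mkQ z) = W.mkQ (((LieAlgebra.ad k L (ι e)) ^ m) z) := by
    intro e m z
    induction m with
    | zero => simp
    | succ m ih =>
      rw [pow_succ', pow_succ', Module.End.mul_apply, Module.End.mul_apply, ih, hρa,
        LieAlgebra.ad_apply]
  have hres : ∀ e d : Derivation k A A,
      ((e : A →ₗ[k] A) : Module.End k A) ^ p = ((d : A →ₗ[k] A) : Module.End k A) →
      ρ e ^ p = ρ d := by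
    intro e d h
    refine LinearMap.ext fun z => ?_
    obtain ⟨z, rfl⟩ := W.mkQ_surjective z
    rw [hpow, ← hop, op_eq ι S hp hι op hop hcl' e d h, LieAlgebra.ad_apply, hρa]
  have h0 : ρ = 0 := by
    refine rep_trivial S ρ hp hp3 hρ (fun i => ?_) (fun α lam h => ?_) hdim
    · rw [hres (S.pd i) 0 (by rw [S.pd_pow hp]; rfl), map_zero]
    · exact hres _ _ (S.mon_dd_pow hp α lam h)
  have h1 := hρa w x
  rw [h0, LinearMap.zero_apply, LinearMap.zero_apply, eq_comm, Submodule.mkQ_apply,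
    Submodule.Quotient.mk_eq_zero] at h1
  rw [← lie_skew]
  exact W.neg_mem h1

theorem step_a (hp3 : 3 ≤ p) 
    (hid : ∀ (x : L) w, ∃ w', ⁅x, ι w⁆ = ι w')
    (hres : ∀ i, (LieAlgebra.ad k L (ι (S.t i))) ^ p = LieAlgebra.ad k L (ι (S.t i)))
    (x : L) (s : Finset (Fin n)) : ∃ w, ∀ i ∈ s, ⁅ι (S.t i), x - ι w⁆ = 0 := by
  induction s using Finset.induction_on with
  | empty => exact ⟨0, by simp⟩
  | insert a s ha ih =>
    obtain ⟨w, hw⟩ := ih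
    set z := x - ι w with hz
    have hr : ∀ m : ℕ, ∃ u, ((LieAlgebra.ad k L (ι (S.t a))) ^ (m + 1)) z = ι u := by
      intro m
      induction m with
      | zero =>
        obtain ⟨u, hu⟩ := hid z (S.t a)
        refine ⟨-u, ?_⟩
        rw [zero_add, pow_one, LieAlgebra.ad_apply, ← lie_skew, hu, map_neg]
      | succ m ih =>
        obtain ⟨u, hu⟩ := ih
        refine ⟨⁅S.t a, u⁆, ?_⟩
        rw [pow_succ', Module.End.mul_apply, hu, LieAlgebra.ad_apply, LieHom.map_lie]
    obtain ⟨u, hu⟩ := hr (p - 2)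
    have hp1 : p - 2 + 1 = p - 1 := by omega
    refine ⟨w + u, fun i hi => ?_⟩
    have e1 : x - ι (w + u) = z - ((LieAlgebra.ad k L (ι (S.t a))) ^ (p - 2 + 1)) z := by
      rw [hu, map_add, hz]; abel
    rw [e1, lie_sub]
    have hc : Commute (LieAlgebra.ad k L (ι (S.t i))) (LieAlgebra.ad k L (ι (S.t a))) := by
      refine LinearMap.ext fun y => ?_
      rw [Module.End.mul_apply, Module.End.mul_apply]
      simp only [LieAlgebra.ad_apply]
      rw [leibniz_lie, ← LieHom.map_lie, S.lie_t_t, map_zero, zero_lie, zero_add]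
    rcases Finset.mem_insert.1 hi with rfl | hi
    · have h2 : ⁅ι (S.t i), ((LieAlgebra.ad k L (ι (S.t i))) ^ (p - 2 + 1)) z⁆
          = ((LieAlgebra.ad k L (ι (S.t i))) ^ p) z := by
        rw [← LieAlgebra.ad_apply k, ← Module.End.mul_apply, ← pow_succ']
        exact congrArg (fun r => ((LieAlgebra.ad k L (ι (S.t i))) ^ r) z) (by omega)
      rw [h2, hres, LieAlgebra.ad_apply, sub_self]
    · have h2 := congrArg (fun g => g z) (hc.pow_right (p - 2 + 1)).eq
      simp only [Module.End.mul_apply, LieAlgebra.ad_apply] at h2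
      rw [h2, hw i hi, map_zero, sub_zero]

theorem step_b (hp : p.Prime) (hι : Function.Injective ι)
    (hid : ∀ (x : L) w, ∃ w', ⁅x, ι w⁆ = ι w')
    (x : L) (hx : ∀ i, ⁅ι (S.t i), x⁆ = 0) :
    ∃ w, (∀ i, ⁅x - ι w, ι (S.t i)⁆ = 0) ∧ ∀ i, ⁅x - ι w, ι (S.pd i)⁆ = 0 := by
  choose D hD using fun i => hid x (S.pd i)
  have ht : ∀ j i, ⁅S.t j, D i⁆ = -((if j = i then (1 : k) else 0) • D i) := by
    intro j i
    apply hι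
    rw [LieHom.map_lie, ← hD, leibniz_lie, hx, zero_lie, zero_add, ← LieHom.map_lie, S.lie_t_pd,
      map_neg, lie_neg, map_neg, map_smul, map_smul, ← hD, lie_smul]
  have hty : ∀ j i l, S.t j (D i (S.y l))
      = (if j = l then D i (S.y l) else 0) - (if j = i then D i (S.y l) else 0) := by
    intro j i l
    have := congrArg (fun E => E (S.y l)) (ht j i)
    simp only [Derivation.commutator_apply, S.t_y, Derivation.neg_apply, Derivation.smul_apply] at this
    rw [sub_eq_iff_eq_add] at this
    rw [this]
    split_ifs <;> simp
  have hcross : ∀ i j, ⁅D i, S.pd j⁆ + ⁅S.pd i, D j⁆ = 0 := by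
    intro i j
    apply hι
    rw [map_add, LieHom.map_lie, LieHom.map_lie, ← hD, ← hD, map_zero, ← leibniz_lie,
      ← LieHom.map_lie, S.lie_pd, map_zero, lie_zero]
  have tz : ∀ j (a : A), S.t j a = 0 → S.pd j a = 0 := by
    intro j a h
    refine S.y_cancel hp.ne_zero j ?_
    rw [← S.t_apply, h, mul_zero]
  have hoff : ∀ i j, i ≠ j → D i (S.y j) = 0 := by
    intro i j hij
    have h1 := congrArg (fun E => E (S.y j)) (hcross i j)
    simp only [Derivation.commutator_apply, Derivation.add_apply, S.pd_y, if_neg hij, if_pos,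
      Derivation.map_one_eq_zero, map_zero, sub_zero, zero_sub, Derivation.zero_apply] at h1
    have h2 : S.pd i (D j (S.y j)) = 0 := by
      apply tz
      rw [hty]; simp [hij]
    rw [h2, add_zero, neg_eq_zero] at h1
    have h3 := hty j i j
    rw [S.t_apply, h1, mul_zero, if_pos rfl, if_neg hij.symm, sub_zero] at h3
    exact h3.symm
  have hDi : ∀ i, D i = D i (S.y i) • S.pd i := by
    intro i
    refine S.der_ext fun j => ?_
    rw [Derivation.smul_apply, S.pd_y]
    split_ifs with h
    · subst h; simp
    · rw [hoff i j h, smul_zero]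
  have hc : ∀ j i, S.t j (D i (S.y i)) = 0 := by
    intro j i; rw [hty]; simp
  let c : Fin n → A := fun i => D i (S.y i)
  have hE1 : ∀ i, ⁅∑ j, c j • S.t j, S.t i⁆ = 0 := by
    intro i
    rw [sum_lie]
    refine Finset.sum_eq_zero fun j _ => ?_
    have := WData.lie_smul_smul (c j) (1 : A) (S.t j) (S.t i)
    rw [one_smul, S.lie_t_t, hc] at this
    rw [this]; simp
  have hE2 : ∀ i, ⁅∑ j, c j • S.t j, S.pd i⁆ = - D i := by
    intro i
    rw [sum_lie, Finset.sum_eq_single i]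
    · have := WData.lie_smul_smul (c i) (1 : A) (S.t i) (S.pd i)
      rw [one_smul, S.lie_t_pd, tz _ _ (hc i i)] at this
      rw [this, hDi i]; simp [c]
    · intro j _ hj
      have := WData.lie_smul_smul (c j) (1 : A) (S.t j) (S.pd i)
      rw [one_smul, S.lie_t_pd, tz _ _ (hc i j)] at this
      rw [this]; simp [hj]
    · simp
  refine ⟨-∑ j, c j • S.t j, fun i => ?_, fun i => ?_⟩
  · rw [map_neg, sub_neg_eq_add, add_lie, ← LieHom.map_lie, hE1, map_zero, add_zero, ← lie_skew, hx,
      neg_zero]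
  · rw [map_neg, sub_neg_eq_add, add_lie, ← LieHom.map_lie, hE2, hD, map_neg, add_neg_cancel]

theorem step_c (hp : p.Prime) (hp3 : 3 ≤ p) (hι : Function.Injective ι)
    (hid : ∀ (x : L) w, ∃ w', ⁅x, ι w⁆ = ι w')
    (x : L) (hx : ∀ i, ⁅x, ι (S.t i)⁆ = 0) (hx' : ∀ i, ⁅x, ι (S.pd i)⁆ = 0) (N : ℕ) :
    ∀ (β : Fin n → ℕ) (l : Fin n), ∑ i, β i = N → ⁅x, ι (S.mon β • S.pd l)⁆ = 0 := by
  induction N using Nat.strong_induction_on with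
  | _ N ih =>
  intro β l hN
  have hN0 : N ≠ 0 ∨ N = 0 := ne_or_eq _ _
  rcases hN0 with hN0 | hN0
  swap
  · have : β = 0 := by
      funext i
      have := Finset.single_le_sum (f := β) (fun i _ => Nat.zero_le _) (Finset.mem_univ i)
      simp only [Pi.zero_apply]
      omega
    rw [this, S.mon_zero, one_smul, hx']
  have hsub : ∀ i, β i ≠ 0 → ∑ j, (β - Pi.single i 1 : Fin n → ℕ) j = N - 1 := by
    intro i hi
    have h1 : β = (β - Pi.single i 1) + Pi.single i 1 := by
      ext j
      by_cases hj : j = i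
      · subst hj; simp; omega
      · simp [hj]
    have h2 : ∑ j, ((β - Pi.single i 1) + Pi.single i 1 : Fin n → ℕ) j = N := by rw [← h1, hN]
    simp only [Pi.add_apply, Finset.sum_add_distrib, Finset.sum_pi_single', Finset.mem_univ, if_true] at h2
    omega
  obtain ⟨D, hD⟩ := hid x (S.mon β • S.pd l)
  have hpdD : ∀ i, ⁅S.pd i, D⁆ = 0 := by
    intro i
    apply hι
    have e1 : ⁅S.pd i, S.mon β • S.pd l⁆ = (β i : k) • (S.mon (β - Pi.single i 1) • S.pd l) := by
      have := WData.lie_smul_smul (1 : A) (S.mon β) (S.pd i) (S.pd l)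
      rw [one_smul, S.lie_pd, S.pd_mon hp.ne_zero] at this
      rw [this]
      ext a
      simp [Algebra.smul_def, mul_assoc]
    rw [LieHom.map_lie, ← hD, leibniz_lie, ← lie_skew (ι (S.pd i)) x, hx', neg_zero, zero_lie, zero_add,
      ← LieHom.map_lie, e1, map_smul, lie_smul, map_zero]
    by_cases hi : β i = 0
    · rw [hi]; simp
    · rw [ih (N - 1) (by omega) _ l (hsub i hi), smul_zero]
  have htD : ∀ j, ⁅S.t j, D⁆ = ((β j : k) - if j = l then 1 else 0) • D := by
    intro j
    apply hι
    rw [LieHom.map_lie, ← hD, leibniz_lie, ← lie_skew (ι (S.t j)) x, hx, neg_zero, zero_lie, zero_add,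
      ← LieHom.map_lie, S.lie_t_smul_pd, map_smul ι (_ : k), map_smul ι (_ : k), lie_smul, hD]
  rw [hD]
  by_cases hD0 : D = 0
  · rw [hD0, map_zero]
  obtain ⟨m, hm⟩ : ∃ m, D (S.y m) ≠ 0 := by
    by_contra hcon
    push Not at hcon
    exact hD0 (S.der_ext fun i => by rw [hcon i]; rfl)
  have hwt : ∀ j, (β j : k) = (if j = l then 1 else 0) - (if j = m then 1 else 0) := by
    intro j
    have h1 := congrArg (fun E => E (S.y m)) (hpdD j)
    simp only [Derivation.commutator_apply, S.pd_y, Derivation.zero_apply] at h1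
    have h2 : S.pd j (D (S.y m)) = 0 := by
      rw [sub_eq_zero] at h1; rw [h1]; split_ifs <;> simp
    have h3 := congrArg (fun E => E (S.y m)) (htD j)
    simp only [Derivation.commutator_apply, S.t_y, Derivation.smul_apply] at h3
    rw [S.t_apply, h2, mul_zero, zero_sub] at h3
    have h4 : ((β j : k) - (if j = l then 1 else 0) + (if j = m then 1 else 0)) • D (S.y m) = 0 := by
      rw [add_smul, ← h3]
      split_ifs <;> simp
    have h5 := (smul_eq_zero.1 h4).resolve_right hm
    linear_combination h5
  rw [← hD]
  by_cases hml : m = l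
  · have : S.mon β = S.mon 0 := by
      refine S.mon_congr fun i => ?_
      rw [← CharP.natCast_eq_natCast k p, hwt i, hml]
      simp
    rw [this, S.mon_zero, one_smul, hx']
  · have hbl : (β l : k) = 1 := by
      rw [hwt l]; simp [Ne.symm hml]
    have hbl0 : β l ≠ 0 := by
      intro h; rw [h] at hbl; simp at hbl
    have hpN : p ∣ N := by
      rw [← CharP.cast_eq_zero_iff k p, ← hN]
      push_cast
      simp [hwt]
    have hN3 : 3 ≤ N := hp3.trans (Nat.le_of_dvd (Nat.pos_of_ne_zero hN0) hpN)
    set γ := β - Pi.single l 1 with hγ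
    have hg : β = γ + Pi.single l 1 := by
      ext j
      by_cases hj : j = l
      · subst hj; simp [hγ]; omega
      · simp [hγ, hj]
    have hgl : (γ l : A) = 0 := by
      have : (γ l : k) = 0 := by
        have h9 : β l = γ l + 1 := by
          conv_lhs => rw [hg]
          simp
        rw [h9] at hbl
        push_cast at hbl
        linear_combination hbl
      rw [← map_natCast (algebraMap k A), this, map_zero]
    have i1 := ih (N - 1) (by omega) γ l (hsub l hbl0)
    have i2 := ih 2 (by omega) (Pi.single l 1 + Pi.single l 1) l (by
      simp [Finset.sum_add_distrib])
    have hb : ⁅S.mon γ • S.pd l, S.mon (Pi.single l 1 + Pi.single l 1) • S.pd l⁆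
        = (2 : k) • (S.mon β • S.pd l) := by
      rw [WData.lie_smul_smul, S.lie_pd, S.pd_mon hp.ne_zero l γ, hgl, S.mon_add, S.mon_single, hg,
        S.mon_add, S.mon_single, Derivation.leibniz, S.pd_y, if_pos rfl]
      ext a
      have h20 : algebraMap k A 2 = 2 := map_ofNat _ 2
      simp only [Algebra.smul_def, Derivation.smul_apply, Derivation.add_apply, Derivation.sub_apply, h20]
      simp [h20]
      ring
    have h2 : (2 : k) ≠ 0 := by
      intro e
      have := Nat.le_of_dvd (by norm_num) ((CharP.cast_eq_zero_iff k p 2).1 (by exact_mod_cast e))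
      omega
    have h3 : ⁅x, ι ((2 : k) • (S.mon β • S.pd l))⁆ = 0 := by
      rw [← hb, LieHom.map_lie, leibniz_lie, i1, i2, zero_lie, lie_zero, add_zero]
    rw [map_smul, lie_smul] at h3
    exact (smul_eq_zero.1 h3).resolve_left h2

theorem exists_central (hp : p.Prime) (hp3 : 3 ≤ p) (hι : Function.Injective ι)
    (hid : ∀ (x : L) w, ∃ w', ⁅x, ι w⁆ = ι w')
    (hres : ∀ i, (LieAlgebra.ad k L (ι (S.t i))) ^ p = LieAlgebra.ad k L (ι (S.t i)))
    (x : L) : ∃ w, ∀ v, ⁅x - ι w, ι v⁆ = 0 := by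
  obtain ⟨w1, h1⟩ := step_a S ι hp3 hid hres x Finset.univ
  obtain ⟨w2, h2, h3⟩ := step_b S ι hp hι hid (x - ι w1) (fun i => h1 i (Finset.mem_univ i))
  refine ⟨w1 + w2, fun v => ?_⟩
  have e : x - ι (w1 + w2) = x - ι w1 - ι w2 := by rw [map_add]; abel
  rw [e]
  have := S.der_mem (LinearMap.ker ((LieAlgebra.ad k L (x - ι w1 - ι w2)).comp (ι : Derivation k A A →ₗ[k] L)))
    (fun β l => by
      rw [LinearMap.mem_ker]
      exact step_c S ι hp hp3 hι hid _ h2 h3 _ β l rfl) v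
  exact this

end Main

section Final

variable (p : ℕ) (k : Type*) [Field k] [CharP k p] (n : ℕ)

theorem truncX_pow (i : Fin n) : truncX p k n i ^ p = 0 := by
  rw [truncX, ← map_pow, Ideal.Quotient.eq_zero_iff_mem]
  exact Ideal.subset_span ⟨i, rfl⟩

theorem trunc_nontrivial (hp : p.Prime) : Nontrivial (TruncPoly p k n) := by
  refine Ideal.Quotient.nontrivial_iff.2 fun h => ?_
  have hle : truncIdeal p k n ≤ RingHom.ker (MvPolynomial.constantCoeff (σ := Fin n) (R := k)) := by
    refine Ideal.span_le.2 ?_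
    rintro _ ⟨i, rfl⟩
    simp [RingHom.mem_ker, hp.ne_zero]
  have h1 : (1 : MvPolynomial (Fin n) k) ∈ truncIdeal p k n := by rw [h]; trivial
  have := hle h1
  rw [RingHom.mem_ker, map_one] at this
  exact one_ne_zero this

theorem trunc_y_pow (hp : p.Prime) (i : Fin n) : (1 + truncX p k n i) ^ p = 1 := by
  have := trunc_nontrivial p k n hp
  have : Fact p.Prime := ⟨hp⟩
  have : CharP (TruncPoly p k n) p :=
    charP_of_injective_algebraMap (algebraMap k (TruncPoly p k n)).injective p
  rw [add_pow_char, truncX_pow, one_pow, add_zero]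

theorem truncPD_X (i j : Fin n) : truncPD p k n i (truncX p k n j) = if i = j then 1 else 0 := by
  have h : truncPD p k n i (truncX p k n j)
    = Ideal.Quotient.mk (truncIdeal p k n) (MvPolynomial.pderiv i (MvPolynomial.X j)) := rfl
  rw [h, MvPolynomial.pderiv_X]
  by_cases hij : i = j
  · subst hij; simp
  · rw [if_neg hij, Pi.single_eq_of_ne (Ne.symm hij), map_zero]

theorem trunc_gen : Algebra.adjoin k (Set.range fun i => 1 + truncX p k n i) = ⊤ := by
  have h1 : Algebra.adjoin k (Set.range fun i => truncX p k n i) = ⊤ := by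
    have h := congrArg (Subalgebra.map (Ideal.Quotient.mkₐ k (truncIdeal p k n)))
      (MvPolynomial.adjoin_range_X (R := k) (σ := Fin n))
    rw [AlgHom.map_adjoin, ← Set.range_comp, Algebra.map_top,
      (AlgHom.range_eq_top _).2 (Ideal.Quotient.mkₐ_surjective k _)] at h
    exact h
  rw [eq_top_iff, ← h1]
  refine Algebra.adjoin_le ?_
  rintro _ ⟨i, rfl⟩
  have h2 : 1 + truncX p k n i ∈ Algebra.adjoin k (Set.range fun i => 1 + truncX p k n i) :=
    Algebra.subset_adjoin ⟨i, rfl⟩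
  have h3 := sub_mem h2 (one_mem _)
  rwa [add_sub_cancel_left] at h3

/-- the data for the truncated polynomial ring -/
noncomputable def truncData (hp : p.Prime) : WData p k (TruncPoly p k n) n where
  y := fun i => 1 + truncX p k n i
  pd := truncPD p k n
  pd_y := fun i j => by rw [map_add, Derivation.map_one_eq_zero, zero_add, truncPD_X]
  y_pow := trunc_y_pow p k n hp
  gen := trunc_gen p k n

end Final

end WProof


/-- Example 2.7.  Suppose the restricted Jacobson–Witt algebra `W(n)`
is a `p`-subalgebra of a finite-dimensional restricted Lie algebra `(L, op)`, of
codimension `< p^n − 1`.  Then `W(n)` is an ideal of `L` and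
`L = C_L(W(n)) ⊕ W(n)`. -/
theorem wittAlg_subalgebra_isIdeal_and_compl
    (p : ℕ) (hp : p.Prime) (hp3 : 3 ≤ p)
    (k : Type*) [Field k] [IsAlgClosed k] [CharP k p]
    {L : Type*} [LieRing L] [LieAlgebra k L] [FiniteDimensional k L]
    (op : L → L) (hop : IsPMap p k op)
    (n : ℕ) (hn : 1 ≤ n)
    (W : LieSubalgebra k L) (hcl : ∀ x ∈ W, op x ∈ W)
    (hiso : Nonempty ((W : LieSubalgebra k L) ≃ₗ⁅k⁆ WittAlg p k n))
    (hcodim : Module.finrank k L - Module.finrank k W < p ^ n - 1) :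
    (∀ x : L, ∀ y ∈ W, ⁅x, y⁆ ∈ W) ∧
    IsCompl (lieCentralizer k W) W.toSubmodule := by
  have := WProof.trunc_nontrivial p k n hp
  let S := WProof.truncData p k n hp
  obtain ⟨e⟩ := hiso
  let ι : WittAlg p k n →ₗ⁅k⁆ L := W.incl.comp e.symm.toLieHom
  have hιa : ∀ w, ι w = ((e.symm w : W) : L) := fun w => rfl
  have hι : Function.Injective ι := by
    intro a b h
    rw [hιa, hιa] at h
    exact e.symm.injective (Subtype.ext h)
  have hW : ∀ x, x ∈ W.toSubmodule ↔ ∃ w, ι w = x := by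
    intro x
    constructor
    · intro hx
      refine ⟨e ⟨x, hx⟩, ?_⟩
      rw [hιa, LieEquiv.symm_apply_apply]
    · rintro ⟨w, rfl⟩
      exact (e.symm w).2
  have hdim : Module.finrank k (L ⧸ W.toSubmodule) < p ^ n - 1 := by
    have h1 := W.toSubmodule.finrank_quotient_add_finrank
    have h2 : Module.finrank k W.toSubmodule = Module.finrank k W := rfl
    omega
  have hideal : ∀ x w, ⁅x, ι w⁆ ∈ W.toSubmodule :=
    WProof.ideal_of_small ι S hp hp3 hι op hop.ad_op W.toSubmodule hW hcl hdim
  have hid : ∀ (x : L) w, ∃ w', ⁅x, ι w⁆ = ι w' := by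
    intro x w
    obtain ⟨w', h⟩ := (hW _).1 (hideal x w)
    exact ⟨w', h.symm⟩
  have hcl' : ∀ w, ∃ w', op (ι w) = ι w' := by
    intro w
    obtain ⟨w', h⟩ := (hW _).1 (hcl _ ((hW _).2 ⟨w, rfl⟩))
    exact ⟨w', h.symm⟩
  have hres : ∀ i, (LieAlgebra.ad k L (ι (S.t i))) ^ p = LieAlgebra.ad k L (ι (S.t i)) := by
    intro i
    have h := S.dd_pow hp (Pi.single i 1)
    rw [WProof.dd_single] at h
    rw [← hop.ad_op, WProof.op_eq ι S hp hι op hop.ad_op hcl' _ _ h]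
  refine ⟨?_, ?_⟩
  · intro x y hy
    obtain ⟨w, rfl⟩ := (hW y).1 hy
    exact hideal x w
  · rw [isCompl_iff]
    constructor
    · rw [Submodule.disjoint_def]
      intro x hx hxW
      obtain ⟨w, rfl⟩ := (hW x).1 hxW
      have hw : w = 0 := by
        refine S.center_eq_zero fun v => hι ?_
        rw [LieHom.map_lie, map_zero]
        exact hx _ ((hW _).2 ⟨v, rfl⟩)
      rw [hw, map_zero]
    · rw [codisjoint_iff, eq_top_iff]
      intro x _
      obtain ⟨w, hw⟩ := WProof.exists_central S ι hp hp3 hι hid hres x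
      refine Submodule.mem_sup.2 ⟨x - ι w, ?_, ι w, (hW _).2 ⟨w, rfl⟩, sub_add_cancel _ _⟩
      intro y hy
      obtain ⟨v, rfl⟩ := (hW y).1 hy
      exact hw v
end

section
/- Let P(2r) be the restricted Poisson algebra, H'(2r) = D_H(P(2r)) the image of P(2r) under the map D_H, and H(2r) the Hamiltonian algebra. Then μ(H'(2r)) = r, H(2r) is a restricted ideal of H'(2r) of codimension one, and rk(H'(2r)) = p^r − 1. -/
/-!
The truncated polynomial ring `A(n) = k[X₁,…,Xₙ]/(X₁^p,…,Xₙ^p)`, its partial derivatives,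
the Jacobson–Witt algebra `W(n) = Der(A(n))`, and related Lie algebras of Cartan type.
-/

set_option synthInstance.maxHeartbeats 1000000
set_option maxHeartbeats 1600000

section CartanAlgebras

variable (p : ℕ) (k : Type*) [Field k] [CharP k p]

/-- The divergence of a derivation `D = ∑ fᵢ ∂ᵢ`, namely `∑ ∂ᵢ(fᵢ) = ∑ ∂ᵢ(D(xᵢ))`. -/
noncomputable def divergence (n : ℕ) (D : WittAlg p k n) : TruncPoly p k n :=
  ∑ i : Fin n, truncPD p k n i (D (truncX p k n i))

/-- The linear embedding of `W(n)` into the associative algebra of `k`-linear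
endomorphisms of `A(n)`; the `p`-map of `W(n)` is `D ↦ D^p` under this embedding. -/
noncomputable def derToEnd (n : ℕ) :
    WittAlg p k n →ₗ[k] Module.End k (TruncPoly p k n) where
  toFun D := D.toLinearMap
  map_add' := fun _ _ => rfl
  map_smul' := fun _ _ => rfl

/-- The Hamiltonian map `D_H : A(2r) → W(2r)`,
`f ↦ ∑ᵢ (∂ᵢ(f) ∂_{i+r} − ∂_{i+r}(f) ∂ᵢ)`. -/
noncomputable def DH (r : ℕ) (f : TruncPoly p k (2 * r)) : WittAlg p k (2 * r) :=
  ∑ i : Fin r,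
    (truncPD p k (2 * r) ⟨i.1, by have := i.isLt; omega⟩ f •
        truncPD p k (2 * r) ⟨i.1 + r, by have := i.isLt; omega⟩
      - truncPD p k (2 * r) ⟨i.1 + r, by have := i.isLt; omega⟩ f •
        truncPD p k (2 * r) ⟨i.1, by have := i.isLt; omega⟩)

/-- The contact map `D_K : A(2r+1) → W(2r+1)` (Strade–Farnsteiner, §4.5). -/
noncomputable def DK (r : ℕ) (f : TruncPoly p k (2 * r + 1)) : WittAlg p k (2 * r + 1) :=
  (∑ i : Fin r,
    ((truncX p k (2 * r + 1) ⟨i.1, by have := i.isLt; omega⟩ *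
        truncPD p k (2 * r + 1) (Fin.last (2 * r)) f
      - truncPD p k (2 * r + 1) ⟨i.1 + r, by have := i.isLt; omega⟩ f) •
        truncPD p k (2 * r + 1) ⟨i.1, by have := i.isLt; omega⟩
    + (truncX p k (2 * r + 1) ⟨i.1 + r, by have := i.isLt; omega⟩ *
        truncPD p k (2 * r + 1) (Fin.last (2 * r)) f
      + truncPD p k (2 * r + 1) ⟨i.1, by have := i.isLt; omega⟩ f) •
        truncPD p k (2 * r + 1) ⟨i.1 + r, by have := i.isLt; omega⟩))
  + ((2 : TruncPoly p k (2 * r + 1)) * f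
      - ∑ i : Fin (2 * r), truncX p k (2 * r + 1) ⟨i.1, by have := i.isLt; omega⟩ *
          truncPD p k (2 * r + 1) ⟨i.1, by have := i.isLt; omega⟩ f) •
      truncPD p k (2 * r + 1) (Fin.last (2 * r))

/-- The derived subalgebra `[K, K]` of a Lie subalgebra. -/
noncomputable def derivedSub {L : Type*} [LieRing L] [LieAlgebra k L]
    (K : LieSubalgebra k L) : LieSubalgebra k L :=
  LieSubalgebra.lieSpan k L {z | ∃ x ∈ K, ∃ y ∈ K, z = ⁅x, y⁆}

/-- `K''(2r+1) = {D ∈ W(n) | D(ω_K) ∈ A(n)·ω_K}`, realized as the image of `D_K`. -/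
noncomputable def contactAmbient (r : ℕ) : LieSubalgebra k (WittAlg p k (2 * r + 1)) :=
  LieSubalgebra.lieSpan k _ (Set.range (DK p k r))

/-- The restricted contact algebra `K(2r+1) := [K''(2r+1), K''(2r+1)]`. -/
noncomputable def contactAlg (r : ℕ) : LieSubalgebra k (WittAlg p k (2 * r + 1)) :=
  derivedSub k (contactAmbient p k r)

/-- `H'(2r) := D_H(A(2r))`, the image of the Hamiltonian map. -/
noncomputable def hamiltonianAmbient (r : ℕ) : LieSubalgebra k (WittAlg p k (2 * r)) :=
  LieSubalgebra.lieSpan k _ (Set.range (DH p k r))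

/-- The restricted Hamiltonian algebra `H(2r) := H'(2r)^{(1)}`. -/
noncomputable def hamiltonianAlg (r : ℕ) : LieSubalgebra k (WittAlg p k (2 * r)) :=
  derivedSub k (hamiltonianAmbient p k r)

/-- `S̃(n) := {D ∈ W(n) | div(D) = 0}`. -/
noncomputable def specialAmbient (n : ℕ) : LieSubalgebra k (WittAlg p k n) :=
  LieSubalgebra.lieSpan k _ {D | divergence p k n D = 0}

/-- The restricted special algebra `S(n) := S̃(n)^{(1)}`. -/
noncomputable def specialAlg (n : ℕ) : LieSubalgebra k (WittAlg p k n) :=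
  derivedSub k (specialAmbient p k n)

/-- A torus of a `p`-subalgebra `K` of the Jacobson–Witt algebra `W(n)` (whose `p`-map is
`D ↦ D^p`, the `p`-th power in `End_k(A(n))`): a subalgebra of `K` closed under the
`p`-power map and consisting of semisimple elements. -/
def IsTorusIn (n : ℕ) (K : LieSubalgebra k (WittAlg p k n))
    (T : Submodule k (WittAlg p k n)) : Prop :=
  (∀ x ∈ T, x ∈ K) ∧
  (∀ x ∈ T, ∀ y ∈ T, ⁅x, y⁆ ∈ T) ∧
  (∀ x ∈ T, ∃ y ∈ T, derToEnd p k n y = (derToEnd p k n x) ^ p) ∧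
  (∀ x ∈ T, derToEnd p k n x ∈ Submodule.span k
    {z : Module.End k (TruncPoly p k n) | ∃ m : ℕ, 1 ≤ m ∧ z = (derToEnd p k n x) ^ (p ^ m)})

/-- `μ(K)`: the maximal dimension of a torus of `K ⊆ W(n)`. -/
noncomputable def muIn (n : ℕ) (K : LieSubalgebra k (WittAlg p k n)) : ℕ :=
  sSup {d : ℕ | ∃ T : Submodule k (WittAlg p k n),
    IsTorusIn p k n K T ∧ Module.finrank k T = d}

end CartanAlgebras

/-- The rank of a Lie subalgebra `K`: the minimal dimension of a Cartan subalgebra of the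
Lie algebra `K`. -/
noncomputable def lieRankOf (k : Type*) [Field k] {L : Type*} [LieRing L] [LieAlgebra k L]
    (K : LieSubalgebra k L) : ℕ :=
  sInf {d : ℕ | ∃ H : LieSubalgebra k K, H.IsCartanSubalgebra ∧ Module.finrank k H = d}


set_option synthInstance.maxHeartbeats 1000000
set_option maxHeartbeats 1600000

set_option linter.all false
namespace HamAux
open Polynomial

theorem choose_pred_char (p : ℕ) (hp : p.Prime) (R : Type*) [Ring R] [CharP R p] (m : ℕ)
    (hm : m + 1 ≤ p) : ((Nat.choose (p - 1) m : ℕ) : R) = (-1) ^ m := by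
  induction m with
  | zero => simp
  | succ m ih =>
    have h1 : Nat.choose p (m + 1) = Nat.choose (p - 1) m + Nat.choose (p - 1) (m + 1) := by
      conv_lhs => rw [show p = (p - 1) + 1 by omega]
      exact Nat.choose_succ_succ _ _
    have h2 : ((Nat.choose p (m + 1) : ℕ) : R) = 0 := by
      rw [CharP.cast_eq_zero_iff R p]
      exact hp.dvd_choose_self (by omega) (by omega)
    rw [h1, Nat.cast_add, ih (by omega)] at h2
    rw [pow_succ]
    rw [mul_neg, mul_one]; exact (neg_eq_of_add_eq_zero_right h2).symm

theorem geom_char (p : ℕ) (hp : p.Prime) {R : Type*} [Ring R] [CharP R p] (x y : R)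
    (h : Commute x y) :
    (x - y) ^ (p - 1) = ∑ j ∈ Finset.range p, x ^ j * y ^ (p - 1 - j) := by
  rw [sub_eq_add_neg, (h.neg_right).add_pow, show p - 1 + 1 = p by have := hp.two_le; omega]
  refine Finset.sum_congr rfl fun j hj => ?_
  rw [Finset.mem_range] at hj
  have h1 : Nat.choose (p - 1) j = Nat.choose (p - 1) (p - 1 - j) :=
    (Nat.choose_symm (by omega)).symm
  rw [h1, choose_pred_char p hp R _ (by omega), neg_pow y, mul_assoc, mul_assoc]
  congr 1
  have : Commute (y ^ (p - 1 - j)) ((-1 : R) ^ (p - 1 - j)) :=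
    ((Commute.neg_one_left y).symm.pow_pow _ _)
  rw [this.eq, ← mul_assoc, ← pow_add, Even.neg_one_pow ⟨_, rfl⟩, one_mul]

theorem derivative_pow_nc {R : Type*} [Ring R] (P : R[X]) (n : ℕ) :
    derivative (P ^ n) = ∑ j ∈ Finset.range n, P ^ j * derivative P * P ^ (n - 1 - j) := by
  induction n with
  | zero => simp
  | succ n ih =>
    rw [pow_succ, derivative_mul, ih, Finset.sum_range_succ, Finset.sum_mul]
    congr 1
    · refine Finset.sum_congr rfl fun j hj => ?_
      rw [Finset.mem_range] at hj
      rw [mul_assoc, ← pow_succ]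
      congr 2; omega
    · simp

theorem jacobson (p : ℕ) (hp : p.Prime) {k R : Type*} [Field k] [CharP k p] [Ring R] [Nontrivial R]
    [Algebra k R] (L S : Submodule k R) (hLS : ∀ x ∈ L, ∀ y ∈ L, x * y - y * x ∈ S)
    (hSL : S ≤ L) (a b : R) (ha : a ∈ L) (hb : b ∈ L) :
    (a + b) ^ p - a ^ p - b ^ p ∈ S := by
  have hp2 := hp.two_le
  haveI : CharP R p := charP_of_injective_algebraMap (algebraMap k R).injective p
  set P : R[X] := C a * X + C b with hP
  let lm : Module.End ℤ R[X] := LinearMap.mulLeft ℤ P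
  let rm : Module.End ℤ R[X] := LinearMap.mulRight ℤ P
  have hcomm : Commute lm rm := by
    apply LinearMap.ext; intro x; simp [lm, rm, mul_assoc]
  haveI : CharP (Module.End ℤ R[X]) p := by
    refine ⟨fun x => ?_⟩
    rw [← CharP.cast_eq_zero_iff R[X] p]
    constructor
    · intro h
      have := LinearMap.congr_fun h 1
      simpa [Module.End.natCast_apply] using this
    · intro h
      ext1 y
      rw [Module.End.natCast_apply, ← Nat.cast_smul_eq_nsmul R[X], h]; simp
  have hder : derivative (P ^ p) = ((lm - rm) ^ (p - 1)) (C a) := by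
    rw [geom_char p hp lm rm hcomm, derivative_pow_nc]
    simp only [LinearMap.sum_apply, Module.End.mul_apply]
    refine Finset.sum_congr rfl fun j _ => ?_
    have : derivative P = C a := by simp [hP]
    rw [this]
    have h1 : ∀ (n : ℕ) (x : R[X]), (rm ^ n) x = x * P ^ n := by
      intro n x; simp [rm, LinearMap.pow_mulRight]
    have h2 : ∀ (n : ℕ) (x : R[X]), (lm ^ n) x = P ^ n * x := by
      intro n x; simp [lm, LinearMap.pow_mulLeft]
    rw [h1, h2, mul_assoc]
  have hstep : ∀ Q : R[X], (∀ i, Q.coeff i ∈ L) → ∀ i, ((lm - rm) Q).coeff i ∈ S := by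
    intro Q hQ i
    have : (lm - rm) Q = P * Q - Q * P := rfl
    rw [this, hP, add_mul, mul_add, mul_assoc, ← mul_assoc Q, X_mul]
    rcases i with _ | i
    · simp only [coeff_sub, coeff_add, mul_coeff_zero, coeff_X_zero, mul_zero, zero_add, coeff_C_zero]
      exact hLS _ hb _ (hQ _)
    · simp only [coeff_sub, coeff_add, coeff_C_mul, coeff_mul_C, coeff_mul_X]
      have := S.add_mem (hLS _ ha _ (hQ i)) (hLS _ hb _ (hQ (i + 1)))
      convert this using 1; abel
  have hall : ∀ n, ∀ i, (((lm - rm) ^ (n + 1)) (C a)).coeff i ∈ S := by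
    intro n
    induction n with
    | zero =>
      rw [zero_add, pow_one]
      apply hstep
      intro i; rw [coeff_C]; split_ifs
      · exact ha
      · exact L.zero_mem
    | succ n ih =>
      rw [pow_succ']
      exact hstep _ (fun i => hSL (ih i))
  have hcoef : ∀ i, 1 ≤ i → i < p → (P ^ p).coeff i ∈ S := by
    intro i hi hip
    have h1 := hall (p - 2) (i - 1)
    rw [show p - 2 + 1 = p - 1 by omega, ← hder, coeff_derivative, show i - 1 + 1 = i by omega] at h1
    have h2 : (P ^ p).coeff i * (((i - 1 : ℕ) : R) + 1) = (i : k) • (P ^ p).coeff i := by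
      rw [Algebra.smul_def, ← Nat.cast_succ, Nat.succ_eq_add_one, show i - 1 + 1 = i by omega, map_natCast]
      exact (Nat.cast_commute _ _).symm.eq
    rw [h2] at h1
    have h3 : (i : k) ≠ 0 := by
      rw [Ne, CharP.cast_eq_zero_iff k p]
      exact Nat.not_dvd_of_pos_of_lt hi hip
    exact (S.smul_mem_iff h3).1 h1
  let ev : R[X] →+* R := eval₂RingHom' (RingHom.id R) 1 (fun a => Commute.one_right _)
  have hevP : ev P = a + b := by simp [ev, hP]
  have hdeg : P.natDegree ≤ 1 := natDegree_linear_le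
  have hsum : ev (P ^ p) = ∑ i ∈ Finset.range (p + 1), (P ^ p).coeff i := by
    have : ev (P ^ p) = eval₂ (RingHom.id R) 1 (P ^ p) := rfl
    rw [this, eval₂_eq_sum_range' (RingHom.id R) (n := p + 1)]
    · simp
    · have := natDegree_pow_le_of_le p hdeg
      omega
  rw [map_pow, hevP, Finset.sum_range_succ, Finset.sum_range_eq_add_Ico _ hp.pos] at hsum
  have h0 : (P ^ p).coeff 0 = b ^ p := by
    rw [coeff_zero_eq_eval_zero]
    have : ∀ n : ℕ, (P ^ n).coeff 0 = b ^ n := by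
      intro n
      induction n with
      | zero => simp
      | succ n ih => rw [pow_succ, mul_coeff_zero, ih, pow_succ]; simp [hP]
    rw [← coeff_zero_eq_eval_zero, this]
  have hpp : (P ^ p).coeff p = a ^ p := by
    have := coeff_pow_of_natDegree_le (m := p) hdeg
    rw [mul_one] at this
    rw [this]; simp [hP]
  rw [hsum, h0, hpp]
  have : ∑ i ∈ Finset.Ico 1 p, (P ^ p).coeff i ∈ S := by
    refine S.sum_mem fun i hi => ?_
    rw [Finset.mem_Ico] at hi
    exact hcoef i hi.1 hi.2
  convert this using 1; abel

theorem frob_span (p : ℕ) (hp : p.Prime) {k : Type*} [Field k] [IsAlgClosed k] [CharP k p]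
    {r : ℕ} (v : Fin r → k) :
    v ∈ Submodule.span k (Set.range fun m : ℕ => fun i => v i ^ (p ^ (m + 1))) := by
  haveI : Fact p.Prime := ⟨hp⟩
  haveI : ExpChar k p := ExpChar.prime hp
  haveI : PerfectRing k p := PerfectField.toPerfectRing p
  set W0 := Submodule.span k (Set.range fun m : ℕ => fun i => v i ^ (p ^ m)) with hW0
  set W1 := Submodule.span k (Set.range fun m : ℕ => fun i => v i ^ (p ^ (m + 1))) with hW1
  have hle : W1 ≤ W0 := by
    refine Submodule.span_mono ?_
    rintro _ ⟨m, rfl⟩; exact ⟨m + 1, rfl⟩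
  let F : (Fin r → k) ≃+ (Fin r → k) := AddEquiv.piCongrRight fun _ => (frobeniusEquiv k p).toAddEquiv
  have hF : ∀ w i, F w i = w i ^ p := fun w i => rfl
  have hFs : ∀ (c : k) w, F (c • w) = c ^ p • F w := by
    intro c w; funext i; simp [hF, mul_pow]
  have hF01 : ∀ w ∈ W0, F w ∈ W1 := by
    intro w hw
    induction hw using Submodule.span_induction with
    | mem x hx =>
      obtain ⟨m, rfl⟩ := hx
      refine Submodule.subset_span ⟨m, ?_⟩
      funext i; simp [hF, ← pow_mul, pow_succ]
    | zero => simp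
    | add x y _ _ hx hy => rw [map_add]; exact W1.add_mem hx hy
    | smul c x _ hx => rw [hFs]; exact W1.smul_mem _ hx
  have hF10 : ∀ w ∈ W1, F.symm w ∈ W0 := by
    intro w hw
    induction hw using Submodule.span_induction with
    | mem x hx =>
      obtain ⟨m, rfl⟩ := hx
      refine Submodule.subset_span ⟨m, ?_⟩
      rw [← F.injective.eq_iff, F.apply_symm_apply]
      funext i; simp [hF, ← pow_mul, pow_succ]
    | zero => simp
    | add x y _ _ hx hy => rw [map_add]; exact W0.add_mem hx hy
    | smul c x _ hx =>
      obtain ⟨d, hd⟩ := (frobeniusEquiv k p).surjective c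
      have : F.symm (c • x) = d • F.symm x := by
        rw [← F.injective.eq_iff, F.apply_symm_apply, hFs, F.apply_symm_apply, ← hd]; rfl
      rw [this]; exact W0.smul_mem _ hx
  let j : W0 ≃+ W1 :=
    { toFun := fun w => ⟨F w, hF01 w w.2⟩
      invFun := fun w => ⟨F.symm w, hF10 w w.2⟩
      left_inv := fun w => by ext1; simp
      right_inv := fun w => by ext1; simp
      map_add' := fun a b => by ext1; simp }
  have hr : Module.rank k W0 = Module.rank k W1 :=
    rank_eq_of_equiv_equiv (fun c => c ^ p) j (frobeniusEquiv k p).bijective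
      (fun c m => by ext1; exact hFs c m)
  have heq : W1 = W0 := by
    refine Submodule.eq_of_le_of_finrank_eq hle ?_
    rw [Module.finrank, Module.finrank, hr]
  rw [heq]
  exact Submodule.subset_span ⟨0, by funext i; simp⟩

open LieSubalgebra in
theorem lieRank_eq {K L : Type*} [Field K] [Infinite K] [LieRing L] [LieAlgebra K L]
    [Module.Finite K L] (N : ℕ) (h1 : ∀ x : L, N ≤ Module.finrank K (engel K x))
    (h2 : ∃ x : L, Module.finrank K (engel K x) ≤ N) :
    sInf {d : ℕ | ∃ H : LieSubalgebra K L, H.IsCartanSubalgebra ∧ Module.finrank K H = d} = N := by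
  have hcard : (Module.finrank K L : Cardinal) ≤ Cardinal.mk K :=
    Cardinal.natCast_le_aleph0.trans <| Cardinal.infinite_iff.mp ‹Infinite K›
  have hmin : ∀ (U : LieSubalgebra K L) (x : L) (hx : x ∈ U), U ≤ engel K x →
      (∀ y ∈ U, Module.finrank K (engel K x) ≤ Module.finrank K (engel K y)) →
      ∀ y ∈ U, engel K x ≤ engel K y := by
    intro U x hx hU hm y hy
    set Ex : {engel K z | z ∈ U} := ⟨engel K x, x, hx, rfl⟩
    suffices IsBot Ex from @this ⟨engel K y, y, hy, rfl⟩
    apply LieAlgebra.engel_isBot_of_isMin hcard U Ex hU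
    rintro ⟨_, y, hy, rfl⟩ hyx
    suffices engel K y = engel K x from this.ge
    apply LieSubalgebra.toSubmodule_injective
    exact Submodule.eq_of_le_of_finrank_le hyx (hm y hy)
  obtain ⟨x0, hx0⟩ := h2
  have hC : (engel K x0).IsCartanSubalgebra := by
    refine ⟨?_, normalizer_engel _ _⟩
    apply isNilpotent_of_forall_le_engel
    exact hmin (engel K x0) x0 (self_mem_engel _ _) le_rfl (fun y _ => hx0.trans (h1 y))
  apply le_antisymm
  · exact Nat.sInf_le ⟨_, hC, le_antisymm hx0 (h1 _)⟩
  · refine le_csInf ⟨_, ⟨engel K x0, hC, rfl⟩⟩ ?_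
    rintro d ⟨H, hH, rfl⟩
    haveI := hH
    have hz := LieAlgebra.zeroRootSubalgebra_eq_of_is_cartan K L H
    have hHE : ∀ x ∈ H, H ≤ engel K x := by
      intro x hx y hy
      have hy' : y ∈ LieAlgebra.zeroRootSubalgebra K L H := hz.symm ▸ hy
      rw [LieAlgebra.mem_zeroRootSubalgebra] at hy'
      rw [mem_engel_iff]
      exact hy' ⟨x, hx⟩
    obtain ⟨x, hx⟩ : ∃ x : H, ∀ y : H, Module.finrank K (engel K (x : L)) ≤ Module.finrank K (engel K (y : L)) := by
      exact ⟨_, fun y => Function.argmin_le (fun x : H => Module.finrank K (engel K (x : L))) y⟩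
    have hle := hmin H x x.2 (hHE x x.2) (fun y hy => hx ⟨y, hy⟩)
    have : engel K (x : L) ≤ H := by
      intro z hz'
      rw [← hz, LieAlgebra.mem_zeroRootSubalgebra]
      intro y
      have := hle y y.2 hz'
      rwa [mem_engel_iff] at this
    exact (h1 x).trans (Submodule.finrank_mono (s := (engel K (x : L)).toSubmodule) (t := H.toSubmodule) this)

theorem line_nil {K M : Type*} [Field K] [Infinite K] [AddCommGroup M] [Module K M]
    [Module.Finite K M] (a b : Module.End K M) (N : ℕ) (P : K[X]) (hP : P ≠ 0)
    (h : ∀ t : K, P.eval t ≠ 0 → N ≤ Module.finrank K ((a + t • b).maxGenEigenspace 0)) :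
    N ≤ Module.finrank K (a.maxGenEigenspace 0) := by
  classical
  let bs := Module.finBasis K M
  let A := LinearMap.toMatrix bs bs a
  let B := LinearMap.toMatrix bs bs b
  let Q : K[X][X] := (A.map C + (X : K[X]) • B.map C).charpoly
  have hQ : ∀ t : K, Q.map (evalRingHom t) = (a + t • b).charpoly := by
    intro t
    rw [← LinearMap.charpoly_toMatrix (a + t • b) bs, ← Matrix.charpoly_map]
    congr 1
    ext i j
    simp [A, B]
    ring
  have hz : ∀ i < N, Q.coeff i = 0 := by
    intro i hi
    have : P * Q.coeff i = 0 := by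
      refine Polynomial.funext fun t => ?_
      rw [eval_mul, eval_zero]
      by_cases ht : P.eval t = 0
      · rw [ht, zero_mul]
      · have h1 := h t ht
        rw [LinearMap.finrank_maxGenEigenspace_zero_eq] at h1
        have h2 : ((a + t • b).charpoly).coeff i = 0 := coeff_eq_zero_of_lt_natTrailingDegree (by omega)
        rw [← hQ t, coeff_map] at h2
        have h3 : (Q.coeff i).eval t = 0 := h2
        rw [h3, mul_zero]
    exact (mul_eq_zero.1 this).resolve_left hP
  rw [LinearMap.finrank_maxGenEigenspace_zero_eq]
  refine le_natTrailingDegree (LinearMap.charpoly_monic a).ne_zero ?_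
  intro i hi
  have := hQ 0
  rw [zero_smul, add_zero] at this
  rw [← this, coeff_map, hz i hi, map_zero]

end HamAux

set_option synthInstance.maxHeartbeats 1000000
set_option maxHeartbeats 1600000
set_option linter.all false
namespace HamAux
open Polynomial

theorem iso_bound {k V : Type*} [Field k] [IsAlgClosed k] [AddCommGroup V] [Module k V]
    [FiniteDimensional k V] (ω : LinearMap.BilinForm k V) (hnd : ω.Nondegenerate)
    (halt : ω.IsAlt) (e : ℕ) (t : Fin e → Module.End k V) (hli : LinearIndependent k t)
    (hcomm : ∀ i j, Commute (t i) (t j)) (hss : ∀ i, (t i).IsSemisimple)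
    (hskew : ∀ i u v, ω (t i u) v = - ω u (t i v)) (U : Submodule k V)
    (hU : ∀ u ∈ U, ∀ v ∈ U, ω u v = 0) (hUt : ∀ i, ∀ u ∈ U, t i u = 0) :
    2 * (e + Module.finrank k U) ≤ Module.finrank k V := by
  classical
  have htop : ⨆ χ : Fin e → k, ⨅ i, (t i).maxGenEigenspace (χ i) = ⊤ := by
    apply Module.End.iSup_iInf_maxGenEigenspace_eq_top_of_iSup_maxGenEigenspace_eq_top_of_commute
    · intro i j _; exact hcomm i j
    · intro i; exact Module.End.iSup_maxGenEigenspace_eq_top (t i)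
  have heig : ∀ (χ : Fin e → k) v, v ∈ (⨅ i, (t i).maxGenEigenspace (χ i)) → ∀ i, t i v = χ i • v := by
    intro χ v hv i
    have h1 : v ∈ (t i).maxGenEigenspace (χ i) := (Submodule.mem_iInf _).1 hv i
    rw [(hss i).isFinitelySemisimple.maxGenEigenspace_eq_eigenspace] at h1
    exact Module.End.mem_eigenspace_iff.1 h1
  let s : ((Fin e → k) →ₗ[k] k) → Module.End k V := fun φ => ∑ i, φ (Pi.single i 1) • t i
  have hs : ∀ φ (χ : Fin e → k) v, (∀ i, t i v = χ i • v) → s φ v = φ χ • v := by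
    intro φ χ v hv
    simp only [s, LinearMap.sum_apply, LinearMap.smul_apply, hv]
    conv_rhs => rw [LinearMap.pi_apply_eq_sum_univ φ χ, Finset.sum_smul]
    refine Finset.sum_congr rfl fun i _ => ?_
    rw [smul_smul, smul_eq_mul, mul_comm]
    have : (fun j => if i = j then (1:k) else 0) = Pi.single i 1 := by
      funext j; simp [Pi.single_apply, eq_comm]
    rw [this]
  let Xs : Set (Fin e → k) := {χ | ∃ v, v ≠ 0 ∧ ∀ i, t i v = χ i • v}
  have hspan : Submodule.span k Xs = ⊤ := by
    by_contra hne
    obtain ⟨φ, hφ, hle⟩ := Submodule.exists_le_ker_of_lt_top _ (lt_top_iff_ne_top.2 hne)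
    have h0 : s φ = 0 := by
      have : (⨆ χ : Fin e → k, ⨅ i, (t i).maxGenEigenspace (χ i)) ≤ LinearMap.ker (s φ) := by
        refine iSup_le fun χ v hv => ?_
        rw [LinearMap.mem_ker, hs φ χ v (heig χ v hv)]
        by_cases hv0 : v = 0
        · simp [hv0]
        · have : φ χ = 0 := hle (Submodule.subset_span ⟨v, hv0, heig χ v hv⟩)
          rw [this, zero_smul]
      rw [htop] at this
      exact LinearMap.ker_eq_top.1 (top_le_iff.1 this)
    have h1 := Fintype.linearIndependent_iff.1 hli _ h0
    apply hφ
    apply LinearMap.pi_ext'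
    intro i
    ext
    simpa using h1 i
  have hfr : Module.finrank k (Submodule.span k Xs) = e := by
    rw [hspan, finrank_top, Module.finrank_fin_fun]
  have hex := Submodule.exists_fun_fin_finrank_span_eq k Xs
  rw [hfr] at hex
  obtain ⟨f, hfX, hfs, hfli⟩ := hex
  choose v hv0 hv using hfX
  let B := Module.Basis.mk hfli (by rw [hfs, hspan])
  have hB : ∀ j, B j = f j := fun j => by simp [B]
  have hsU : ∀ φ, ∀ u ∈ U, s φ u = 0 := by
    intro φ u hu
    simp [s, LinearMap.sum_apply, hUt _ u hu]
  have hsv : ∀ l j, s (B.coord l) (v j) = if l = j then v j else 0 := by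
    intro l j
    rw [hs _ (f j) (v j) (hv j), ← hB, Module.Basis.coord_apply, Module.Basis.repr_self,
      Finsupp.single_apply]
    by_cases h : l = j
    · simp [h]
    · simp [h, Ne.symm h]
  have hkey : ∀ c : Fin e → k, (∑ j, c j • v j) ∈ U → ∀ j, c j = 0 := by
    intro c hc l
    have h1 := hsU (B.coord l) _ hc
    rw [map_sum] at h1
    simp only [map_smul, hsv, smul_ite, smul_zero] at h1
    simp at h1
    exact h1.resolve_right (hv0 l)
  have hvli : LinearIndependent k v := by
    rw [Fintype.linearIndependent_iff]
    intro c hc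
    exact hkey c (hc ▸ U.zero_mem)
  let W := U ⊔ Submodule.span k (Set.range v)
  have hWf : Module.finrank k W = Module.finrank k U + e := by
    have h1 := Submodule.finrank_sup_add_finrank_inf_eq U (Submodule.span k (Set.range v))
    have h2 : U ⊓ Submodule.span k (Set.range v) = ⊥ := by
      rw [eq_bot_iff]
      rintro x ⟨hx1, hx2⟩
      obtain ⟨c, rfl⟩ := (Submodule.mem_span_range_iff_exists_fun k).1 hx2
      have := hkey c hx1
      simp [this]
    rw [h2, finrank_bot, add_zero, finrank_span_eq_card hvli, Fintype.card_fin] at h1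
    exact h1
  have hUv : ∀ u ∈ U, ∀ j, ω u (v j) = 0 := by
    intro u hu j
    have hne : f j ≠ 0 := hfli.ne_zero j
    obtain ⟨i, hi⟩ := Function.ne_iff.1 hne
    have h1 := hskew i u (v j)
    rw [hUt i u hu, hv j i] at h1
    simp at h1
    exact h1.resolve_left hi
  have hvv : ∀ j l, ω (v j) (v l) = 0 := by
    intro j l
    by_cases hjl : j = l
    · rw [hjl]; exact halt _
    · have hne : f j + f l ≠ 0 := by
        intro h
        have := Fintype.linearIndependent_iff.1 hfli (Pi.single j 1 + Pi.single l 1) (by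
          simp [add_smul, Finset.sum_add_distrib, Pi.single_apply, ite_smul, h]) j
        simp [hjl] at this
      obtain ⟨i, hi⟩ := Function.ne_iff.1 hne
      have h1 := hskew i (v j) (v l)
      rw [hv j i, hv l i, map_smul, map_smul, LinearMap.smul_apply, smul_eq_mul, smul_eq_mul] at h1
      have h2 : (f j i + f l i) * ω (v j) (v l) = 0 := by linear_combination h1
      exact (mul_eq_zero.1 h2).resolve_left hi
  have hWW : W ≤ ω.orthogonal W := by
    have hvU : ∀ j, ∀ u ∈ U, ω (v j) u = 0 := by
      intro j u hu; rw [← halt.neg_eq, hUv u hu j, neg_zero]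
    have hgen : ∀ x, (∀ u ∈ U, ω x u = 0) → (∀ j, ω x (v j) = 0) → ∀ y ∈ W, ω x y = 0 := by
      intro x h1 h2
      have : W ≤ LinearMap.ker (ω x) := by
        refine sup_le (fun u hu => h1 u hu) ?_
        rw [Submodule.span_le]; rintro _ ⟨j, rfl⟩; exact h2 j
      exact fun y hy => this hy
    have hall : W ≤ ω.flip.orthogonal W := by
      refine sup_le (fun u hu => ?_) ?_
      · rw [LinearMap.BilinForm.mem_orthogonal_iff]
        exact hgen u (fun w hw => hU u hu w hw) (hUv u hu)
      · rw [Submodule.span_le]; rintro _ ⟨j, rfl⟩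
        show v j ∈ ω.flip.orthogonal W
        rw [LinearMap.BilinForm.mem_orthogonal_iff]
        exact hgen _ (hvU j) (hvv j)
    intro x hx
    rw [LinearMap.BilinForm.mem_orthogonal_iff]
    intro y hy
    have := LinearMap.BilinForm.mem_orthogonal_iff.1 (hall hy) x hx
    exact this
  have h3 := LinearMap.BilinForm.finrank_orthogonal hnd W
  have h4 := Submodule.finrank_mono hWW
  have h5 := Submodule.finrank_le W
  omega
end HamAux

set_option synthInstance.maxHeartbeats 1000000
set_option maxHeartbeats 1600000
set_option linter.all false
namespace HamAux
open Polynomial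

/-- Abstract package describing a truncated polynomial ring in `2r` variables. -/
structure TD (p r : ℕ) (k A : Type*) [Field k] [CommRing A] [Algebra k A] where
  X : Fin r ⊕ Fin r → A
  pd : Fin r ⊕ Fin r → Derivation k A A
  pd_X : ∀ i j, pd i (X j) = if i = j then 1 else 0
  X_pow : ∀ i, X i ^ p = 0
  b : Module.Basis (Fin r ⊕ Fin r → Fin p) k A
  hb : ∀ a, b a = ∏ i, X i ^ (a i : ℕ)
  ev : A →ₐ[k] k
  ev_X : ∀ i, ev (X i) = 0
  lift : ∀ h : Fin r ⊕ Fin r → A, (∀ i, h i ^ p = 0) → ∃ φ : A →ₐ[k] A, ∀ i, φ (X i) = h i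

namespace TD
variable {p r : ℕ} {k A : Type*} [Field k] [CommRing A] [Algebra k A] (T : TD p r k A)

theorem fin {p r : ℕ} {k A : Type*} [Field k] [CommRing A] [Algebra k A] (T : TD p r k A) : Module.Finite k A := Module.Finite.of_basis T.b

theorem adjoin : Algebra.adjoin k (Set.range T.X) = ⊤ := by
  rw [eq_top_iff]
  intro f _
  have : f ∈ Submodule.span k (Set.range T.b) := by rw [T.b.span_eq]; trivial
  induction this using Submodule.span_induction with
  | mem x hx =>
    obtain ⟨a, rfl⟩ := hx
    rw [T.hb]
    exact Subalgebra.prod_mem _ fun i _ => Subalgebra.pow_mem _ (Algebra.subset_adjoin (Set.mem_range_self i)) _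
  | zero => exact Subalgebra.zero_mem _
  | add x y _ _ hx hy => exact Subalgebra.add_mem _ (hx trivial) (hy trivial)
  | smul c x _ hx => exact Subalgebra.smul_mem _ (hx trivial) c

theorem ind {P : A → Prop} (hX : ∀ i, P (T.X i)) (hc : ∀ c : k, P (algebraMap k A c))
    (hadd : ∀ f g, P f → P g → P (f + g)) (hmul : ∀ f g, P f → P g → P (f * g)) (f : A) : P f := by
  have : f ∈ Algebra.adjoin k (Set.range T.X) := by rw [T.adjoin]; trivial
  induction this using Algebra.adjoin_induction with
  | mem x hx => obtain ⟨i, rfl⟩ := hx; exact hX i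
  | algebraMap c => exact hc c
  | add x y _ _ hx hy => exact hadd _ _ hx hy
  | mul x y _ _ hx hy => exact hmul _ _ hx hy

theorem der_ext {D E : Derivation k A A} (h : ∀ i, D (T.X i) = E (T.X i)) : D = E := by
  refine Derivation.ext fun f => ?_
  refine T.ind (P := fun f => D f = E f) h (fun c => by simp) ?_ ?_ f
  · intro f g hf hg; rw [map_add, map_add, hf, hg]
  · intro f g hf hg; rw [Derivation.leibniz, Derivation.leibniz, hf, hg]

theorem pd_comm (i j) (f : A) : T.pd i (T.pd j f) = T.pd j (T.pd i f) := by
  have : ⁅T.pd i, T.pd j⁆ = 0 := by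
    apply T.der_ext
    intro l
    rw [Derivation.commutator_apply, T.pd_X, T.pd_X]
    split_ifs <;> simp
  have h := congrArg (fun D : Derivation k A A => D f) this
  simp only [Derivation.commutator_apply] at h
  exact sub_eq_zero.1 h

/-- The Hamiltonian map. -/
noncomputable def dh : A →ₗ[k] Derivation k A A where
  toFun f := ∑ i : Fin r, (T.pd (Sum.inl i) f • T.pd (Sum.inr i) - T.pd (Sum.inr i) f • T.pd (Sum.inl i))
  map_add' f g := by
    rw [← Finset.sum_add_distrib]
    refine Finset.sum_congr rfl fun i _ => ?_
    rw [map_add, map_add, add_smul, add_smul]; abel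
  map_smul' c f := by
    rw [Finset.smul_sum]
    refine Finset.sum_congr rfl fun i _ => ?_
    simp only [Derivation.map_smul, smul_assoc, smul_sub, RingHom.id_apply]

theorem dh_apply (f g : A) : T.dh f g =
    ∑ i : Fin r, (T.pd (Sum.inl i) f * T.pd (Sum.inr i) g - T.pd (Sum.inr i) f * T.pd (Sum.inl i) g) := by
  have : T.dh f = ∑ i : Fin r, (T.pd (Sum.inl i) f • T.pd (Sum.inr i) - T.pd (Sum.inr i) f • T.pd (Sum.inl i)) := rfl
  rw [this, ← Derivation.coeFnAddMonoidHom_apply, map_sum, Finset.sum_apply]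
  refine Finset.sum_congr rfl fun i _ => ?_
  simp

theorem dh_inl (f : A) (j : Fin r) : T.dh f (T.X (Sum.inl j)) = - T.pd (Sum.inr j) f := by
  rw [dh_apply]
  simp [T.pd_X]

theorem dh_inr (f : A) (j : Fin r) : T.dh f (T.X (Sum.inr j)) = T.pd (Sum.inl j) f := by
  rw [dh_apply]
  simp [T.pd_X]

theorem dh_swap (f g : A) : T.dh f g = - T.dh g f := by
  rw [dh_apply, dh_apply, ← Finset.sum_neg_distrib]
  exact Finset.sum_congr rfl fun i _ => by ring

theorem dh_self (f : A) : T.dh f f = 0 := by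
  rw [dh_apply]
  exact Finset.sum_eq_zero fun i _ => by ring

theorem pd_dh (j) (f g : A) : T.pd j (T.dh f g) = T.dh (T.pd j f) g + T.dh f (T.pd j g) := by
  rw [dh_apply, dh_apply, dh_apply, map_sum, ← Finset.sum_add_distrib]
  refine Finset.sum_congr rfl fun i _ => ?_
  simp only [map_sub, Derivation.leibniz, smul_eq_mul, T.pd_comm j]
  ring

theorem dh_lie (f g : A) : ⁅T.dh f, T.dh g⁆ = T.dh (T.dh f g) := by
  apply T.der_ext
  rintro (j | j)
  · rw [Derivation.commutator_apply, dh_inl, dh_inl, dh_inl, pd_dh, T.dh_swap (T.pd _ f) g,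
      map_neg, map_neg]
    ring
  · rw [Derivation.commutator_apply, dh_inr, dh_inr, dh_inr, pd_dh, T.dh_swap (T.pd _ f) g]
    ring

theorem pd_prod (j) (s : Finset (Fin r ⊕ Fin r)) (hj : j ∉ s) (a : Fin r ⊕ Fin r → ℕ) :
    T.pd j (∏ i ∈ s, T.X i ^ a i) = 0 := by
  classical
  induction s using Finset.induction_on with
  | empty => simp
  | insert i s hi ih =>
    rw [Finset.mem_insert, not_or] at hj
    rw [Finset.prod_insert hi, Derivation.leibniz, ih hj.2, Derivation.leibniz_pow, T.pd_X,
      if_neg hj.1]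
    simp

theorem b_split (a) (j) : T.b a = T.X j ^ (a j : ℕ) * ∏ i ∈ Finset.univ.erase j, T.X i ^ (a i : ℕ) := by
  rw [T.hb, Finset.mul_prod_erase _ (fun i => T.X i ^ (a i : ℕ)) (Finset.mem_univ j)]

theorem pd_b (j) (a) : T.pd j (T.b a) = ((a j : ℕ) : k) •
    (T.X j ^ ((a j : ℕ) - 1) * ∏ i ∈ Finset.univ.erase j, T.X i ^ (a i : ℕ)) := by
  rw [T.b_split a j, Derivation.leibniz, T.pd_prod j _ (by simp) (fun i => (a i : ℕ)),
    Derivation.leibniz_pow, T.pd_X, if_pos rfl]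
  simp only [smul_zero, zero_add, smul_eq_mul, nsmul_eq_mul, mul_one]
  rw [Algebra.smul_def, map_natCast]
  ring

theorem euler_b (j) (a) : T.X j * T.pd j (T.b a) = ((a j : ℕ) : k) • T.b a := by
  rw [pd_b, mul_smul_comm, ← mul_assoc, T.b_split a j]
  rcases Nat.eq_zero_or_pos (a j : ℕ) with h | h
  · simp [h]
  · rw [← pow_succ', Nat.sub_add_cancel h]

theorem euler (j) (f : A) (a) : T.b.repr (T.X j * T.pd j f) a = ((a j : ℕ) : k) * T.b.repr f a := by
  have : f ∈ Submodule.span k (Set.range T.b) := by rw [T.b.span_eq]; trivial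
  induction this using Submodule.span_induction with
  | mem x hx =>
    obtain ⟨c, rfl⟩ := hx
    rw [euler_b, map_smul, T.b.repr_self, Finsupp.smul_apply, Finsupp.single_apply, smul_eq_mul]
    split_ifs with h
    · rw [h]
    · simp
  | zero => simp
  | add x y _ _ hx hy => simp only [map_add, mul_add, Finsupp.add_apply, hx, hy]
  | smul c x _ hx =>
    simp only [Derivation.map_smul, mul_smul_comm, map_smul, Finsupp.smul_apply, hx, smul_eq_mul]
    ring

section prime
variable [CharP k p]

theorem cast_ne (hp : p.Prime) (n : Fin p) (h : (n : ℕ) ≠ 0) : ((n : ℕ) : k) ≠ 0 := by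
  rw [Ne, CharP.cast_eq_zero_iff k p]
  exact Nat.not_dvd_of_pos_of_lt (Nat.pos_of_ne_zero h) n.2

theorem const_of_pd (hp : p.Prime) (f : A) (h : ∀ j, T.pd j f = 0) : f = algebraMap k A (T.ev f) := by
  haveI : NeZero p := ⟨hp.ne_zero⟩
  have h1 : ∀ a, a ≠ 0 → T.b.repr f a = 0 := by
    intro a ha
    obtain ⟨j, hj⟩ := Function.ne_iff.1 ha
    have := T.euler j f a
    rw [h j, mul_zero, map_zero, Finsupp.zero_apply, eq_comm, mul_eq_zero] at this
    refine this.resolve_left (cast_ne hp _ ?_)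
    intro h0; exact hj (Fin.ext (by simpa using h0))
  have hb0 : T.b 0 = 1 := by rw [T.hb]; simp
  have h2 : f = algebraMap k A (T.b.repr f 0) := by
    conv_lhs => rw [← T.b.sum_repr f]
    rw [Finset.sum_eq_single 0 (fun a _ ha => by rw [h1 a ha, zero_smul]) (by simp), hb0,
      Algebra.algebraMap_eq_smul_one]
  have h3 : T.ev f = T.b.repr f 0 := by
    conv_lhs => rw [h2]
    simp
  rw [h3]; exact h2

theorem dh_eq_zero_iff (hp : p.Prime) (f : A) : T.dh f = 0 ↔ f = algebraMap k A (T.ev f) := by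
  constructor
  · intro h
    refine T.const_of_pd hp f ?_
    rintro (j | j)
    · rw [← dh_inr, h]; rfl
    · have := T.dh_inl f j
      rw [h] at this
      simpa [eq_comm] using this
  · intro h
    rw [h]
    refine Derivation.ext fun g => ?_
    rw [dh_apply]; simp

theorem const_of_dh (hp : p.Prime) (f : A) (h : ∀ g, T.dh f g = 0) : f = algebraMap k A (T.ev f) :=
  (T.dh_eq_zero_iff hp f).1 (Derivation.ext h)

theorem dh_alg (hp : p.Prime) (c : k) : T.dh (algebraMap k A c) = 0 := by
  rw [T.dh_eq_zero_iff hp]; simp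

end prime

/-- top coefficient -/
noncomputable def top (hp : 0 < p) : A →ₗ[k] k := T.b.coord (fun _ => ⟨p - 1, by omega⟩)

theorem top_pd (hp : 2 ≤ p) (j) (f : A) : T.top (by omega) (T.pd j f) = 0 := by
  have : f ∈ Submodule.span k (Set.range T.b) := by rw [T.b.span_eq]; trivial
  induction this using Submodule.span_induction with
  | mem x hx =>
    classical
    obtain ⟨c, rfl⟩ := hx
    rw [pd_b, map_smul]
    let c' : Fin r ⊕ Fin r → Fin p := Function.update c j ⟨(c j : ℕ) - 1, by omega⟩
    have h1 : T.X j ^ ((c j : ℕ) - 1) * ∏ i ∈ Finset.univ.erase j, T.X i ^ (c i : ℕ) = T.b c' := by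
      rw [T.b_split c' j]
      congr 1
      · simp [c']
      · refine Finset.prod_congr rfl fun i hi => ?_
        rw [Finset.mem_erase] at hi
        simp [c', hi.1]
    rw [h1, top, Module.Basis.coord_apply, T.b.repr_self, Finsupp.single_apply, if_neg, smul_zero]
    intro h
    have := congrArg Fin.val (congrFun h j)
    simp [c'] at this
    omega
  | zero => simp
  | add x y _ _ hx hy => rw [map_add, map_add, hx, hy, add_zero]
  | smul c x _ hx => rw [Derivation.map_smul, map_smul, hx, smul_zero]

theorem top_dh (hp : 2 ≤ p) (f g : A) : T.top (by omega) (T.dh f g) = 0 := by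
  have : T.dh f g = ∑ i : Fin r, (T.pd (Sum.inl i) (f * T.pd (Sum.inr i) g)
      - T.pd (Sum.inr i) (f * T.pd (Sum.inl i) g)) := by
    rw [dh_apply]
    refine Finset.sum_congr rfl fun i _ => ?_
    simp only [Derivation.leibniz, smul_eq_mul, T.pd_comm (Sum.inl i)]
    ring
  rw [this, map_sum]
  refine Finset.sum_eq_zero fun i _ => ?_
  rw [map_sub, T.top_pd hp, T.top_pd hp, sub_zero]

theorem b_bracket (hp : p.Prime) [CharP k p] (a) (ha : a ≠ fun _ => ⟨p - 1, by have := hp.pos; omega⟩) :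
    ∃ f g, T.b a = T.dh f g := by
  classical
  obtain ⟨j, hj⟩ := Function.ne_iff.1 ha
  have hj' : (a j : ℕ) + 1 < p := by
    have h1 : (a j : ℕ) ≠ p - 1 := fun h => hj (Fin.ext h)
    have := (a j).2
    omega
  let c : Fin r ⊕ Fin r → Fin p := Function.update a j ⟨(a j : ℕ) + 1, hj'⟩
  have hc : (c j : ℕ) = a j + 1 := by simp [c]
  have h1 : T.pd j (T.b c) = ((c j : ℕ) : k) • T.b a := by
    rw [pd_b, T.b_split a j]
    congr 2
    · rw [hc]; simp
    · refine Finset.prod_congr rfl fun i hi => ?_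
      rw [Finset.mem_erase] at hi
      simp [c, hi.1]
  have h2 : ((c j : ℕ) : k) ≠ 0 := cast_ne hp _ (by omega)
  rcases j with j | j
  · refine ⟨((c (Sum.inl j) : ℕ) : k)⁻¹ • T.b c, T.X (Sum.inr j), ?_⟩
    rw [dh_inr, Derivation.map_smul, h1, smul_smul, inv_mul_cancel₀ h2, one_smul]
  · refine ⟨-(((c (Sum.inr j) : ℕ) : k)⁻¹ • T.b c), T.X (Sum.inl j), ?_⟩
    rw [dh_inl, map_neg, neg_neg, Derivation.map_smul, h1, smul_smul, inv_mul_cancel₀ h2, one_smul]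

theorem mem_of_top_zero (hp : p.Prime) [CharP k p] (S : Submodule k A)
    (hS : ∀ f g, T.dh f g ∈ S) (f : A) (hf : T.top hp.pos f = 0) : f ∈ S := by
  rw [← T.b.sum_repr f]
  refine S.sum_mem fun a _ => ?_
  by_cases ha : a = fun _ => ⟨p - 1, by have := hp.pos; omega⟩
  · have : T.b.repr f a = 0 := by rw [ha]; exact hf
    rw [this, zero_smul]; exact S.zero_mem
  · obtain ⟨g, h, e⟩ := T.b_bracket hp a ha
    rw [e]; exact S.smul_mem _ (hS _ _)

end TD
end HamAux

set_option synthInstance.maxHeartbeats 1000000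
set_option maxHeartbeats 1600000
set_option linter.all false
namespace HamAux
open scoped Polynomial
namespace TD
variable {p r : ℕ} {k A : Type*} [Field k] [CommRing A] [Algebra k A] (T : TD p r k A)

/-- The Hamiltonian map into endomorphisms. -/
noncomputable def E : A →ₗ[k] Module.End k A where
  toFun f := (T.dh f).toLinearMap
  map_add' f g := by rw [map_add]; rfl
  map_smul' c f := by rw [map_smul]; rfl

theorem E_apply (f g : A) : T.E f g = T.dh f g := rfl

theorem E_lie (f g : A) : T.E f * T.E g - T.E g * T.E f = T.E (T.dh f g) := by
  ext h
  have := congrArg (fun D : Derivation k A A => D h) (T.dh_lie f g)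
  simp only [Derivation.commutator_apply] at this
  simpa [E_apply] using this

theorem ntriv {p r : ℕ} {k A : Type*} [Field k] [CommRing A] [Algebra k A] (T : TD p r k A) :
    Nontrivial A := T.ev.toRingHom.domain_nontrivial

theorem charA {p r : ℕ} {k A : Type*} [Field k] [CommRing A] [Algebra k A] (T : TD p r k A)
    [CharP k p] : CharP A p := by
  haveI := T.ntriv
  exact charP_of_injective_algebraMap (algebraMap k A).injective p

theorem ev_pow (hp : p.Prime) [CharP k p] (f : A) : f ^ p = algebraMap k A (T.ev f ^ p) := by
  haveI := T.charA
  haveI : Fact p.Prime := ⟨hp⟩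
  refine T.ind (P := fun f => f ^ p = algebraMap k A (T.ev f ^ p)) ?_ ?_ ?_ ?_ f
  · intro i; rw [T.X_pow, T.ev_X, zero_pow hp.ne_zero, map_zero]
  · intro c; simp
  · intro f g hf hg
    rw [map_add, add_pow_char, hf, hg, add_pow_char, map_add]
  · intro f g hf hg
    rw [map_mul, mul_pow, mul_pow, hf, hg, map_mul]

theorem pd_iter (j) (m : ℕ) (u : A) (hu : T.pd j u = 0) :
    ((T.pd j).toLinearMap ^ (m + 1) : Module.End k A) (T.X j ^ m * u) = 0 := by
  induction m with
  | zero => simpa using hu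
  | succ m ih =>
    rw [pow_succ, Module.End.mul_apply]
    have : (T.pd j).toLinearMap (T.X j ^ (m + 1) * u) = ((m + 1 : ℕ) : k) • (T.X j ^ m * u) := by
      change T.pd j _ = _
      rw [Derivation.leibniz, hu, Derivation.leibniz_pow, T.pd_X, if_pos rfl]
      simp only [smul_zero, zero_add, smul_eq_mul, nsmul_eq_mul, mul_one, Nat.add_sub_cancel]
      rw [Algebra.smul_def, map_natCast]
      ring
    rw [this, map_smul, ih, smul_zero]

theorem pd_pow (j) : ((T.pd j).toLinearMap ^ p : Module.End k A) = 0 := by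
  refine T.b.ext fun a => ?_
  rw [T.b_split a j]
  have h := T.pd_iter j (a j : ℕ) _ (T.pd_prod j (Finset.univ.erase j) (by simp) (fun i => (a i : ℕ)))
  obtain ⟨n, hn⟩ : ∃ n, p = n + ((a j : ℕ) + 1) := ⟨p - (a j + 1), by have := (a j).2; omega⟩
  have h2 : ((T.pd j).toLinearMap ^ p : Module.End k A) = (T.pd j).toLinearMap ^ n * (T.pd j).toLinearMap ^ ((a j : ℕ) + 1) := by
    rw [← pow_add, ← hn]
  rw [h2, Module.End.mul_apply, h, map_zero]; rfl

theorem dh_X_inl (j) : T.dh (T.X (Sum.inl j)) = T.pd (Sum.inr j) := by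
  apply T.der_ext
  rintro (i | i)
  · rw [dh_inl, T.pd_X, T.pd_X]; simp
  · rw [dh_inr, T.pd_X, T.pd_X]; simp [eq_comm]

theorem dh_X_inr (j) : T.dh (T.X (Sum.inr j)) = - T.pd (Sum.inl j) := by
  apply T.der_ext
  rintro (i | i)
  · rw [dh_inl, T.pd_X, Derivation.neg_apply, T.pd_X]; simp [eq_comm]
  · rw [dh_inr, T.pd_X, Derivation.neg_apply, T.pd_X]; simp

theorem E_X_pow (i) : T.E (T.X i) ^ p = 0 := by
  rcases i with j | j
  · have : T.E (T.X (Sum.inl j)) = (T.pd (Sum.inr j)).toLinearMap := by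
      ext f; rw [E_apply, dh_X_inl]; rfl
    rw [this, pd_pow]
  · have : T.E (T.X (Sum.inr j)) = -(T.pd (Sum.inl j)).toLinearMap := by
      ext f; rw [E_apply, dh_X_inr]; rfl
    rw [this]
    have h := neg_pow ((T.pd (Sum.inl j)).toLinearMap : Module.End k A) p
    rw [T.pd_pow, mul_zero] at h
    exact h

theorem E_mul (f g h : A) : T.E (f * g) h = f * T.E g h + g * T.E f h := by
  simp only [E_apply]
  rw [T.dh_swap, Derivation.leibniz, T.dh_swap h, T.dh_swap h]
  simp only [smul_eq_mul]; ring

theorem E_sq (f : A) : T.E (f ^ 2) = (2 : k) • (LinearMap.mulLeft k f * T.E f) := by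
  ext h
  rw [sq, E_mul]
  simp [two_smul]

theorem E_self_comm (f : A) : Commute (LinearMap.mulLeft k f) (T.E f) := by
  ext h
  simp only [Module.End.mul_apply, LinearMap.mulLeft_apply, E_apply, Derivation.leibniz, T.dh_self]
  simp

theorem mulLeft_pow' (f : A) (n : ℕ) : (LinearMap.mulLeft k f) ^ n = LinearMap.mulLeft k (f ^ n) := by
  ext h; simp

theorem E_sq_pow (hp : p.Prime) [CharP k p] (f : A) :
    T.E (f ^ 2) ^ p = (2 * T.ev f : k) ^ p • T.E f ^ p := by
  rw [E_sq, _root_.smul_pow, (T.E_self_comm f).mul_pow, LinearMap.pow_mulLeft, T.ev_pow hp]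
  ext h
  rw [mul_pow, mul_smul, LinearMap.smul_apply, Module.End.mul_apply, LinearMap.mulLeft_apply, LinearMap.smul_apply, LinearMap.smul_apply, ← Algebra.smul_def]

theorem E_alg (hp : p.Prime) [CharP k p] (c : k) : T.E (algebraMap k A c) = 0 := by
  ext f; rw [E_apply, T.dh_alg hp]; rfl

theorem pclosed (hp : p.Prime) (hp3 : 3 ≤ p) [CharP k p] (f : A) :
    ∃ g, T.top hp.pos g = 0 ∧ T.E f ^ p = T.E g := by
  haveI := T.ntriv
  let S : Submodule k (Module.End k A) := Submodule.map T.E (LinearMap.ker (T.top hp.pos))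
  suffices H : T.E f ^ p ∈ S by
    obtain ⟨g, hg, e⟩ := H
    exact ⟨g, hg, e.symm⟩
  have hadd : ∀ f g, T.E f ^ p ∈ S → T.E g ^ p ∈ S → T.E (f + g) ^ p ∈ S := by
    intro f g hf hg
    have := jacobson p hp (LinearMap.range T.E) S ?_ ?_ (T.E f) (T.E g) ⟨f, rfl⟩ ⟨g, rfl⟩
    · rw [map_add]
      have h2 := S.add_mem (S.add_mem this hf) hg
      convert h2 using 1; abel
    · rintro _ ⟨a, rfl⟩ _ ⟨b, rfl⟩
      rw [E_lie]
      exact ⟨_, T.top_dh hp.two_le a b, rfl⟩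
    · rintro _ ⟨a, _, rfl⟩; exact ⟨a, rfl⟩
  have hsm : ∀ (c : k) f, T.E f ^ p ∈ S → T.E (c • f) ^ p ∈ S := by
    intro c f hf
    rw [map_smul, _root_.smul_pow]; exact S.smul_mem _ hf
  have hsq : ∀ f, T.E f ^ p ∈ S → T.E (f ^ 2) ^ p ∈ S := by
    intro f hf; rw [T.E_sq_pow hp]; exact S.smul_mem _ hf
  have h2 : (2 : k) ≠ 0 := by
    have := (CharP.cast_eq_zero_iff k p 2).not.2 (fun h => by have := Nat.le_of_dvd (by norm_num) h; omega)
    simpa using this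
  refine T.ind (P := fun f => T.E f ^ p ∈ S) ?_ ?_ hadd ?_ f
  · intro i; rw [E_X_pow]; exact S.zero_mem
  · intro c; rw [T.E_alg hp, zero_pow hp.ne_zero]; exact S.zero_mem
  · intro f g hf hg
    have : f * g = (2⁻¹ : k) • ((f + g) ^ 2 + ((-1 : k) • f ^ 2 + (-1 : k) • g ^ 2)) := by
      have e : (f + g) ^ 2 + ((-1 : k) • f ^ 2 + (-1 : k) • g ^ 2) = (2 : k) • (f * g) := by
        rw [neg_smul, neg_smul, one_smul, one_smul, two_smul]; ring
      rw [e, smul_smul, inv_mul_cancel₀ h2, one_smul]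
    rw [this]
    exact hsm _ _ (hadd _ _ (hsq _ (hadd _ _ hf hg)) (hadd _ _ (hsm _ _ (hsq _ hf)) (hsm _ _ (hsq _ hg))))

theorem pclosed_iter (hp : p.Prime) (hp3 : 3 ≤ p) [CharP k p] (f : A) (n : ℕ) :
    ∃ g, T.E f ^ (p ^ n) = T.E g := by
  induction n with
  | zero => exact ⟨f, by simp⟩
  | succ n ih =>
    obtain ⟨g, hg⟩ := ih
    obtain ⟨h, _, hh⟩ := T.pclosed hp hp3 g
    exact ⟨h, by rw [pow_succ, pow_mul, hg, hh]⟩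

theorem top_alg (hp : p.Prime) (hr : 1 ≤ r) (c : k) : T.top hp.pos (algebraMap k A c) = 0 := by
  haveI : NeZero p := ⟨hp.ne_zero⟩
  have hb0 : T.b 0 = 1 := by rw [T.hb]; simp
  rw [Algebra.algebraMap_eq_smul_one, map_smul, ← hb0, top, Module.Basis.coord_apply, T.b.repr_self,
    Finsupp.single_apply, if_neg, smul_zero]
  intro h
  have := congrArg Fin.val (congrFun h (Sum.inl ⟨0, hr⟩))
  simp at this
  have := hp.two_le
  omega

theorem top_ne (hp : p.Prime) : ∃ f, T.top hp.pos f = 1 :=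
  ⟨T.b _, by rw [top, Module.Basis.coord_apply, T.b.repr_self, Finsupp.single_eq_same]⟩

theorem finrankA {p r : ℕ} {k A : Type*} [Field k] [CommRing A] [Algebra k A] (T : TD p r k A) : Module.finrank k A = p ^ (2 * r) := by
  rw [Module.finrank_eq_card_basis T.b]
  simp [two_mul]

theorem ker_dh (hp : p.Prime) [CharP k p] : LinearMap.ker T.dh = k ∙ (1 : A) := by
  ext f
  rw [LinearMap.mem_ker, T.dh_eq_zero_iff hp, Submodule.mem_span_singleton]
  constructor
  · intro h; exact ⟨T.ev f, by rw [← Algebra.algebraMap_eq_smul_one, ← h]⟩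
  · rintro ⟨c, rfl⟩
    simp [Algebra.algebraMap_eq_smul_one]

/-- dimension of images under dh of submodules containing 1 -/
theorem finrank_map_dh (hp : p.Prime) [CharP k p] (S : Submodule k A) (h1 : (1 : A) ∈ S) :
    Module.finrank k (S.map T.dh) + 1 = Module.finrank k S := by
  haveI := T.fin
  haveI := T.ntriv
  have h := (T.dh.domRestrict S).finrank_range_add_finrank_ker
  rw [LinearMap.range_domRestrict] at h
  rw [← h]
  congr 1
  have e : (LinearMap.ker (T.dh.domRestrict S)) = k ∙ (⟨1, h1⟩ : S) := by
    ext ⟨x, hx⟩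
    rw [LinearMap.mem_ker, LinearMap.domRestrict_apply, ← LinearMap.mem_ker, T.ker_dh hp,
      Submodule.mem_span_singleton, Submodule.mem_span_singleton]
    constructor
    · rintro ⟨c, hc⟩; exact ⟨c, Subtype.ext hc⟩
    · rintro ⟨c, hc⟩; exact ⟨c, congrArg Subtype.val hc⟩
  rw [e, finrank_span_singleton]
  intro h0
  exact one_ne_zero (congrArg Subtype.val h0)

theorem finrank_H (hp : p.Prime) [CharP k p] (hr : 1 ≤ r) :
    Module.finrank k ((LinearMap.ker (T.top hp.pos)).map T.dh) + 1
     = Module.finrank k (LinearMap.range T.dh) := by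
  haveI := T.fin
  have h1 := T.finrank_map_dh hp (LinearMap.ker (T.top hp.pos)) (by
    have := T.top_alg hp hr 1
    rwa [map_one] at this)
  have h2 := T.finrank_map_dh hp ⊤ trivial
  rw [Submodule.map_top, finrank_top] at h2
  have h3 := (T.top hp.pos).finrank_range_add_finrank_ker
  have h4 : LinearMap.range (T.top hp.pos) = ⊤ := by
    rw [LinearMap.range_eq_top]
    intro c
    obtain ⟨f, hf⟩ := T.top_ne hp
    exact ⟨c • f, by rw [map_smul, hf]; simp⟩
  rw [h4, finrank_top, Module.finrank_self] at h3
  omega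

end TD
end HamAux

set_option synthInstance.maxHeartbeats 1000000
set_option maxHeartbeats 1600000
set_option linter.all false
namespace HamAux
open scoped Polynomial

theorem poly_of_span {k M : Type*} (p : ℕ) (hp : p.Prime) [Field k] [CharP k p] [AddCommGroup M] [Module k M]
    (D z : Module.End k M)
    (h : z ∈ Submodule.span k {z : Module.End k M | ∃ m : ℕ, 1 ≤ m ∧ z = D ^ (p ^ m)}) :
    ∃ Q : k[X], Polynomial.derivative Q = 0 ∧ Polynomial.X ^ 2 ∣ Q ∧ z = Polynomial.aeval D Q := by
  induction h using Submodule.span_induction with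
  | mem x hx =>
    obtain ⟨m, hm, rfl⟩ := hx
    refine ⟨Polynomial.X ^ (p ^ m), ?_, pow_dvd_pow _ ?_, by simp⟩
    · rw [Polynomial.derivative_X_pow]
      have : ((p ^ m : ℕ) : k) = 0 := by
        rw [CharP.cast_eq_zero_iff k p]; exact dvd_pow_self _ (by omega)
      rw [this]; simp
    · calc 2 ≤ p := hp.two_le
        _ ≤ p ^ m := Nat.le_self_pow (by omega) p
  | zero => exact ⟨0, by simp, by simp, by simp⟩
  | add x y _ _ hx hy =>
    obtain ⟨Q, h1, h2, h3⟩ := hx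
    obtain ⟨Q', h1', h2', h3'⟩ := hy
    exact ⟨Q + Q', by simp [h1, h1'], dvd_add h2 h2', by rw [map_add, h3, h3']⟩
  | smul c x _ hx =>
    obtain ⟨Q, h1, h2, h3⟩ := hx
    exact ⟨c • Q, by simp [h1], dvd_smul_of_dvd c h2, by rw [map_smul, h3]⟩

theorem ss_of_poly {k M : Type*} [Field k] [AddCommGroup M] [Module k M]
    (D : Module.End k M) (Q : k[X]) (hQ : Polynomial.derivative Q = 0) (h : D = Polynomial.aeval D Q) :
    D.IsSemisimple := by
  refine Module.End.isSemisimple_of_squarefree_aeval_eq_zero (p := Polynomial.X - Q) ?_ ?_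
  · apply Polynomial.Separable.squarefree
    rw [Polynomial.separable_def, Polynomial.derivative_sub, hQ, Polynomial.derivative_X, sub_zero]
    exact isCoprime_one_right
  · rw [map_sub, ← h, Polynomial.aeval_X, sub_self]

theorem sq_zero_of_poly {k M : Type*} [Field k] [AddCommGroup M] [Module k M]
    (D : Module.End k M) (Q : k[X]) (hQ : Polynomial.X ^ 2 ∣ Q) (h : D = Polynomial.aeval D Q)
    (g : M) (hg : D (D g) = 0) : D g = 0 := by
  obtain ⟨R, rfl⟩ := hQ
  rw [h, mul_comm, map_mul, Module.End.mul_apply]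
  simp [sq, hg]

theorem aeval_intertw {k M N : Type*} [Field k] [AddCommGroup M] [Module k M] [AddCommGroup N] [Module k N]
    (l : M →ₗ[k] N) (F : Module.End k M) (G : Module.End k N) (h : ∀ m, l (F m) = G (l m)) (Q : k[X]) (m : M) :
    l (Polynomial.aeval F Q m) = Polynomial.aeval G Q (l m) := by
  have hn : ∀ (n : ℕ) m, l ((F ^ n) m) = (G ^ n) (l m) := by
    intro n
    induction n with
    | zero => simp
    | succ n ih => intro m; rw [pow_succ, pow_succ, Module.End.mul_apply, Module.End.mul_apply, ih, h]
  induction Q using Polynomial.induction_on' with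
  | add P Q hP hQ => simp [hP, hQ]
  | monomial n a =>
    simp only [Polynomial.aeval_monomial, Module.End.mul_apply, Module.algebraMap_end_apply, map_smul, hn]

theorem finrank_map_ker {k M N : Type*} [Field k] [AddCommGroup M] [Module k M] [AddCommGroup N] [Module k N]
    [FiniteDimensional k M]
    (l : M →ₗ[k] N) (S : Submodule k M) :
    Module.finrank k (S.map l) + Module.finrank k (S ⊓ LinearMap.ker l : Submodule k M) = Module.finrank k S := by
  have h := (l.domRestrict S).finrank_range_add_finrank_ker
  rw [LinearMap.range_domRestrict, LinearMap.ker_domRestrict, ← Submodule.finrank_map_subtype_eq,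
    Submodule.map_comap_subtype] at h
  exact h

/-- standard symplectic form -/
noncomputable def om (r : ℕ) (k : Type*) [Field k] : LinearMap.BilinForm k (Fin r ⊕ Fin r → k) :=
  LinearMap.mk₂ k (fun u v => ∑ i, (u (Sum.inl i) * v (Sum.inr i) - u (Sum.inr i) * v (Sum.inl i)))
    (fun u u' v => by rw [← Finset.sum_add_distrib]; exact Finset.sum_congr rfl fun i _ => by simp; ring)
    (fun c u v => by rw [Finset.smul_sum]; exact Finset.sum_congr rfl fun i _ => by simp; ring)
    (fun u v v' => by rw [← Finset.sum_add_distrib]; exact Finset.sum_congr rfl fun i _ => by simp; ring)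
    (fun c u v => by rw [Finset.smul_sum]; exact Finset.sum_congr rfl fun i _ => by simp; ring)

theorem om_apply (r : ℕ) (k : Type*) [Field k] (u v) :
    om r k u v = ∑ i, (u (Sum.inl i) * v (Sum.inr i) - u (Sum.inr i) * v (Sum.inl i)) := rfl

theorem om_alt (r : ℕ) (k : Type*) [Field k] : (om r k).IsAlt := by
  intro u
  rw [om_apply]; exact Finset.sum_eq_zero fun i _ => by ring

theorem om_nd (r : ℕ) (k : Type*) [Field k] : (om r k).Nondegenerate := by
  have h : LinearMap.SeparatingLeft (om r k) := by
    intro u hu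
    funext j
    rcases j with j | j
    · have := hu (Pi.single (Sum.inr j) 1)
      rw [om_apply] at this
      simpa [Pi.single_apply] using this
    · have := hu (Pi.single (Sum.inl j) 1)
      rw [om_apply] at this
      simpa [Pi.single_apply] using this
  refine ⟨h, fun u hu => h u fun v => ?_⟩
  rw [← (om_alt r k).neg_eq, hu, neg_zero]

namespace TD
variable {p r : ℕ} {k A : Type*} [Field k] [CommRing A] [Algebra k A] (T : TD p r k A)

/-- linear part -/
noncomputable def ell : A →ₗ[k] (Fin r ⊕ Fin r → k) :=
  LinearMap.pi fun j => T.ev.toLinearMap ∘ₗ (T.pd j).toLinearMap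

theorem ell_apply (f : A) (j) : T.ell f j = T.ev (T.pd j f) := rfl

theorem ev_dh (f g : A) : T.ev (T.dh f g) = om r k (T.ell f) (T.ell g) := by
  rw [om_apply, dh_apply, map_sum]
  exact Finset.sum_congr rfl fun i _ => by simp [ell_apply]

theorem ell_X (i) : T.ell (T.X i) = Pi.single i 1 := by
  funext j
  rw [ell_apply, T.pd_X, Pi.single_apply]
  split_ifs <;> simp

theorem ell_surj : Function.Surjective T.ell := by
  intro v
  refine ⟨∑ i, v i • T.X i, ?_⟩
  funext j
  rcases j with j | j <;> simp [ell_X, Pi.single_apply]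

/-- quadratic part -/
noncomputable def Qm : A →ₗ[k] Module.End k (Fin r ⊕ Fin r → k) where
  toFun f := LinearMap.pi fun j => om r k (T.ell (T.pd j f))
  map_add' f g := by ext v j; simp
  map_smul' c f := by ext v j; simp

theorem Qm_apply (f : A) (v) (j) : T.Qm f v j = om r k (T.ell (T.pd j f)) v := rfl

theorem ell_E (f g : A) (hf : T.ell f = 0) : T.ell (T.E f g) = T.Qm f (T.ell g) := by
  funext j
  rw [ell_apply, E_apply, pd_dh, map_add, ev_dh, ev_dh, hf, Qm_apply]
  simp

/-- the maximal ideal -/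
noncomputable def m : Ideal A := RingHom.ker T.ev

theorem mem_m (f : A) : f ∈ T.m ↔ T.ev f = 0 := Iff.rfl

theorem taylor (f : A) : f - algebraMap k A (T.ev f) - ∑ j, T.ell f j • T.X j ∈ T.m ^ 2 := by
  have hm : ∀ f, f - algebraMap k A (T.ev f) ∈ T.m := by intro f; rw [mem_m]; simp
  refine T.ind (P := fun f => f - algebraMap k A (T.ev f) - ∑ j, T.ell f j • T.X j ∈ T.m ^ 2) ?_ ?_ ?_ ?_ f
  · intro i
    simp [ell_X, T.ev_X, Pi.single_apply]
  · intro c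
    simp [ell_apply]
  · intro f g hf hg
    have := (T.m ^ 2).add_mem hf hg
    convert this using 1
    simp only [map_add, Pi.add_apply, add_smul, Finset.sum_add_distrib]; ring
  · intro f g hf hg
    have h1 : (f - algebraMap k A (T.ev f)) * (g - algebraMap k A (T.ev g)) ∈ T.m ^ 2 := by
      rw [sq]; exact Ideal.mul_mem_mul (hm f) (hm g)
    have := (T.m ^ 2).add_mem (Ideal.add_mem _ h1 (Ideal.mul_mem_left _ (algebraMap k A (T.ev g)) hf))
      (Ideal.mul_mem_left _ (algebraMap k A (T.ev f)) hg)
    convert this using 1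
    have e : ∀ j, T.ell (f * g) j = T.ev f * T.ell g j + T.ev g * T.ell f j := by
      intro j; simp only [ell_apply, Derivation.leibniz, smul_eq_mul, map_add, map_mul]
    simp only [e, add_smul, Finset.sum_add_distrib, mul_smul, ← Finset.smul_sum, map_mul]
    rw [Algebra.smul_def (T.ev f), Algebra.smul_def (T.ev g)]
    ring

theorem mem_m_sq (f : A) (h0 : T.ev f = 0) (h1 : T.ell f = 0) : f ∈ T.m ^ 2 := by
  have := T.taylor f
  simpa [h0, h1] using this

theorem m_nilp (hp : p.Prime) [CharP k p] : ∃ N, T.m ^ N = ⊥ := by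
  haveI := T.fin
  haveI : IsNoetherianRing A := IsNoetherianRing.of_finite k A
  have : IsNilpotent T.m := by
    rw [Ideal.FG.isNilpotent_iff_le_nilradical (IsNoetherian.noetherian _)]
    intro f hf
    refine ⟨p, ?_⟩
    rw [T.ev_pow hp, (T.mem_m f).1 hf, zero_pow hp.ne_zero, map_zero]; rfl
  exact this

theorem E_nilp (hp : p.Prime) [CharP k p] (f : A) (h : ∀ g, T.E f g ∈ T.m ^ 2) : IsNilpotent (T.E f) := by
  obtain ⟨N, hN⟩ := T.m_nilp hp
  have h1 : ∀ i, ∀ g ∈ T.m ^ i, T.E f g ∈ T.m ^ (i + 1) := by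
    intro i
    induction i with
    | zero => intro g _; exact Ideal.pow_le_pow_right (by omega) (h g)
    | succ i ih =>
      intro g hg
      rw [pow_succ] at hg
      induction hg using Submodule.mul_induction_on' with
      | mem_mul_mem x hx y hy =>
        rw [E_apply, Derivation.leibniz]
        refine Ideal.add_mem _ ?_ ?_
        · rw [smul_eq_mul, add_assoc, pow_add]; exact Ideal.mul_mem_mul hx (h y)
        · rw [smul_eq_mul, pow_succ']; exact Ideal.mul_mem_mul hy (ih x hx)
      | add x _ y _ hx hy => rw [map_add]; exact Ideal.add_mem _ hx hy
  have h2 : ∀ n g, (T.E f ^ n) g ∈ T.m ^ n := by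
    intro n
    induction n with
    | zero => intro g; simp
    | succ n ih => intro g; rw [pow_succ' (T.E f), Module.End.mul_apply]; exact h1 _ _ (ih g)
  refine ⟨N, ?_⟩
  ext g
  have := h2 N g
  rw [hN] at this
  exact this

theorem torus_le (hp : p.Prime) [CharP k p] [IsAlgClosed k] (S : Submodule k (Derivation k A A))
    (hS : S ≤ LinearMap.range T.dh) (hl : ∀ x ∈ S, ∀ y ∈ S, ⁅x, y⁆ ∈ S)
    (hs : ∀ x ∈ S, (x.toLinearMap : Module.End k A) ∈ Submodule.span k
      {z : Module.End k A | ∃ m : ℕ, 1 ≤ m ∧ z = (x.toLinearMap : Module.End k A) ^ (p ^ m)}) :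
    Module.finrank k S ≤ r := by
  haveI := T.fin
  let That : Submodule k A := S.comap T.dh
  have hpoly : ∀ f ∈ That, ∃ Q : k[X], Polynomial.derivative Q = 0 ∧ Polynomial.X ^ 2 ∣ Q ∧
      T.E f = Polynomial.aeval (T.E f) Q := fun f hf => poly_of_span p hp _ _ (hs _ hf)
  have hss : ∀ f ∈ That, (T.E f).IsSemisimple := by
    intro f hf
    obtain ⟨Q, h1, h2, h3⟩ := hpoly f hf
    exact ss_of_poly _ Q h1 h3
  have hsq : ∀ f ∈ That, ∀ g, T.E f (T.E f g) = 0 → T.E f g = 0 := by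
    intro f hf
    obtain ⟨Q, h1, h2, h3⟩ := hpoly f hf
    exact sq_zero_of_poly _ Q h2 h3
  have hcl : ∀ f ∈ That, ∀ g ∈ That, T.E f g ∈ That := by
    intro f hf g hg
    change T.dh (T.dh f g) ∈ S
    rw [← dh_lie]; exact hl _ hf _ hg
  have hcomm : ∀ f ∈ That, ∀ g ∈ That, T.E f g = 0 := by
    intro f hf
    have hinv : That ∈ (T.E f).invtSubmodule := fun g hg => hcl f hf g hg
    have h0 : (T.E f).restrict (show ∀ x ∈ That, T.E f x ∈ That from hinv) = 0 := by
      rw [((hss f hf).restrict hinv).eq_zero_iff_forall_eigenvalue]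
      intro μ hμ
      obtain ⟨⟨g, hg⟩, h1, h2⟩ := hμ.exists_hasEigenvector
      rw [Module.End.mem_eigenspace_iff] at h1
      have h3 : T.E f g = μ • g := congrArg Subtype.val h1
      by_contra hne
      have h4 : T.E g f = 0 := by
        apply hsq g hg
        rw [E_apply, E_apply, T.dh_swap g f, ← E_apply, ← E_apply, h3, map_neg, map_smul, E_apply, dh_self]
        simp
      rw [E_apply, dh_swap, ← E_apply, h3, neg_eq_zero] at h4
      exact h2 (Subtype.ext ((smul_eq_zero.1 h4).resolve_left hne))
    intro g hg
    have := congrArg (fun F : Module.End k That => ((F ⟨g, hg⟩ : That) : A)) h0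
    exact this
  let T' : Submodule k A := That ⊓ LinearMap.ker T.ev.toLinearMap
  have hT'S : T'.map T.dh = S := by
    apply le_antisymm
    · rintro _ ⟨f, hf, rfl⟩; exact hf.1
    · intro x hx
      obtain ⟨f, rfl⟩ := hS hx
      refine ⟨f - algebraMap k A (T.ev f), ⟨?_, ?_⟩, ?_⟩
      · change T.dh _ ∈ S
        rw [map_sub, T.dh_alg hp, sub_zero]; exact hx
      · change T.ev _ = 0
        simp
      · rw [map_sub, T.dh_alg hp, sub_zero]
  have hfr : Module.finrank k S = Module.finrank k T' := by
    rw [← finrank_map_ker T.dh T', hT'S]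
    have : T' ⊓ LinearMap.ker T.dh = ⊥ := by
      rw [eq_bot_iff]
      rintro f ⟨⟨_, h1⟩, h2⟩
      have h3 := (T.dh_eq_zero_iff hp f).1 h2
      rw [show T.ev f = 0 from h1, map_zero] at h3
      exact h3
    rw [this, finrank_bot, add_zero]
  let T0 : Submodule k A := T' ⊓ LinearMap.ker T.ell
  have hell : ∀ f ∈ T0, T.ell f = 0 := fun f hf => hf.2
  have hinj : ∀ f ∈ T0, T.Qm f = 0 → f = 0 := by
    intro f hf hQ
    have h1 : IsNilpotent (T.E f) := by
      apply T.E_nilp hp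
      intro g
      apply T.mem_m_sq
      · rw [E_apply, ev_dh, hell f hf]; simp
      · rw [T.ell_E _ _ (hell f hf), hQ]; rfl
    have h2 := Module.End.eq_zero_of_isNilpotent_isSemisimple h1 (hss f hf.1.1)
    have h3 := T.const_of_dh hp f (fun g => by rw [← E_apply, h2]; rfl)
    rw [show T.ev f = 0 from hf.1.2, map_zero] at h3
    exact h3
  let B := Module.finBasis k T0
  have hb := iso_bound (om r k) (om_nd r k) (om_alt r k) (Module.finrank k T0)
    (fun i => T.Qm (B i)) ?_ ?_ ?_ ?_ (T'.map T.ell) ?_ ?_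
  · rw [hfr, ← finrank_map_ker T.ell T']
    simp only [Module.finrank_pi, Fintype.card_sum, Fintype.card_fin] at hb
    have : Module.finrank k T0 = Module.finrank k (T' ⊓ LinearMap.ker T.ell : Submodule k A) := rfl
    omega
  · have := B.linearIndependent.map' (T.Qm.domRestrict T0) (by
      rw [LinearMap.ker_eq_bot']
      rintro ⟨f, hf⟩ h
      exact Subtype.ext (hinj f hf h))
    exact this
  · intro i j
    refine LinearMap.ext fun v => ?_
    obtain ⟨h, rfl⟩ := T.ell_surj v
    rw [Module.End.mul_apply, Module.End.mul_apply, ← T.ell_E _ _ (hell _ (B i).2), ← T.ell_E _ _ (hell _ (B j).2),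
      ← T.ell_E _ _ (hell _ (B i).2), ← T.ell_E _ _ (hell _ (B j).2)]
    have h1 := T.E_lie (B i : A) (B j : A)
    rw [← E_apply, hcomm _ (B i).2.1.1 _ (B j).2.1.1, map_zero, sub_eq_zero] at h1
    have := congrArg (fun F : Module.End k A => F h) h1
    exact congrArg T.ell this
  · intro i
    obtain ⟨Q, h1, h2, h3⟩ := hpoly _ (B i).2.1.1
    refine ss_of_poly _ Q h1 ?_
    refine LinearMap.ext fun v => ?_
    obtain ⟨h, rfl⟩ := T.ell_surj v
    rw [← aeval_intertw T.ell (T.E (B i)) (T.Qm (B i)) (fun m => T.ell_E _ _ (hell _ (B i).2)), ← h3,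
      T.ell_E _ _ (hell _ (B i).2)]
  · intro i u v
    obtain ⟨a, rfl⟩ := T.ell_surj u
    obtain ⟨b, rfl⟩ := T.ell_surj v
    rw [← T.ell_E _ _ (hell _ (B i).2), ← T.ell_E _ _ (hell _ (B i).2), ← ev_dh, ← ev_dh]
    have h1 := congrArg (fun F : Module.End k A => T.ev (F b)) (T.E_lie (B i : A) a)
    simp only [LinearMap.sub_apply, Module.End.mul_apply, map_sub] at h1
    rw [E_apply T (B i : A) (T.E a b), ev_dh, hell _ (B i).2] at h1
    simp only [map_zero, LinearMap.zero_apply, zero_sub] at h1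
    exact h1.symm
  · rintro _ ⟨f, hf, rfl⟩ _ ⟨g, hg, rfl⟩
    rw [← ev_dh, ← E_apply, hcomm _ hf.1 _ hg.1, map_zero]
  · rintro i _ ⟨g, hg, rfl⟩
    rw [← T.ell_E _ _ (hell _ (B i).2), hcomm _ (B i).2.1.1 _ hg.1, map_zero]

end TD
end HamAux

set_option synthInstance.maxHeartbeats 1000000
set_option maxHeartbeats 1600000
set_option linter.all false
namespace HamAux
open scoped Polynomial
namespace TD
variable {p r : ℕ} {k A : Type*} [Field k] [CommRing A] [Algebra k A] (T : TD p r k A)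

/-- diagonal Hamiltonians -/
noncomputable def diag : (Fin r → k) →ₗ[k] A where
  toFun c := ∑ i, c i • (T.X (Sum.inl i) * T.X (Sum.inr i))
  map_add' c d := by simp [add_smul, Finset.sum_add_distrib]
  map_smul' c d := by simp [Finset.smul_sum, mul_smul]

theorem diag_apply (c : Fin r → k) : T.diag c = ∑ i, c i • (T.X (Sum.inl i) * T.X (Sum.inr i)) := rfl

/-- weights -/
noncomputable def wt (c : Fin r → k) (a : Fin r ⊕ Fin r → Fin p) : k :=
  ∑ i, c i * (((a (Sum.inr i) : ℕ) : k) - ((a (Sum.inl i) : ℕ) : k))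

theorem diag_repr (c : Fin r → k) (f : A) (a) :
    T.b.repr (T.E (T.diag c) f) a = wt c a * T.b.repr f a := by
  have h : T.E (T.diag c) f = ∑ i, c i • (T.X (Sum.inr i) * T.pd (Sum.inr i) f - T.X (Sum.inl i) * T.pd (Sum.inl i) f) := by
    rw [diag_apply, map_sum, LinearMap.sum_apply]
    refine Finset.sum_congr rfl fun i _ => ?_
    rw [map_smul, LinearMap.smul_apply, E_mul, E_apply, E_apply, dh_X_inl, dh_X_inr, Derivation.neg_apply]
    congr 1; ring
  rw [h, map_sum, Finsupp.finsetSum_apply, wt, Finset.sum_mul]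
  refine Finset.sum_congr rfl fun i _ => ?_
  rw [map_smul, map_sub, Finsupp.smul_apply, Finsupp.sub_apply, T.euler, T.euler, smul_eq_mul]
  ring

theorem diag_repr_pow (c : Fin r → k) (n : ℕ) (f : A) (a) :
    T.b.repr ((T.E (T.diag c) ^ n) f) a = wt c a ^ n * T.b.repr f a := by
  induction n generalizing f with
  | zero => simp
  | succ n ih => rw [pow_succ, Module.End.mul_apply, ih, diag_repr, pow_succ]; ring

theorem wt_pow (hp : p.Prime) [CharP k p] (c : Fin r → k) (n : ℕ) (a : Fin r ⊕ Fin r → Fin p) :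
    wt c a ^ (p ^ n) = wt (fun i => c i ^ (p ^ n)) a := by
  haveI : Fact p.Prime := ⟨hp⟩
  haveI : ExpChar k p := ExpChar.prime hp
  have hn : ∀ m : ℕ, (m : k) ^ (p ^ n) = m := by
    intro m; rw [← iterateFrobenius_def, map_natCast]
  rw [wt, ← iterateFrobenius_def, map_sum, wt]
  refine Finset.sum_congr rfl fun i _ => ?_
  rw [map_mul, map_sub]
  simp only [iterateFrobenius_def, hn]

theorem diag_pow (hp : p.Prime) [CharP k p] (c : Fin r → k) (n : ℕ) :
    T.E (T.diag c) ^ (p ^ n) = T.E (T.diag (fun i => c i ^ (p ^ n))) := by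
  ext f
  apply T.b.repr.injective
  ext a
  rw [diag_repr_pow, diag_repr, wt_pow hp]

theorem diag_comm (c d : Fin r → k) : T.E (T.diag c) * T.E (T.diag d) = T.E (T.diag d) * T.E (T.diag c) := by
  ext f
  apply T.b.repr.injective
  ext a
  simp only [Module.End.mul_apply, diag_repr]
  ring

theorem diag_inj (c : Fin r → k) (h : T.dh (T.diag c) = 0) : c = 0 := by
  haveI := T.ntriv
  funext i
  have h1 := T.dh_inr (T.diag c) i
  rw [h] at h1
  have h2 : T.pd (Sum.inl i) (T.diag c) = c i • T.X (Sum.inr i) := by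
    rw [diag_apply, map_sum]
    simp [T.pd_X]
  rw [h2] at h1
  have h3 : T.X (Sum.inr i) ≠ 0 := by
    intro h0
    have := T.pd_X (Sum.inr i) (Sum.inr i)
    rw [h0, map_zero, if_pos rfl] at this
    exact zero_ne_one this
  exact (smul_eq_zero.1 h1.symm).resolve_right h3

theorem torus_ex (hp : p.Prime) [CharP k p] [IsAlgClosed k] : ∃ S : Submodule k (Derivation k A A),
    S ≤ LinearMap.range T.dh ∧ (∀ x ∈ S, ∀ y ∈ S, ⁅x, y⁆ ∈ S) ∧
    (∀ x ∈ S, ∃ y ∈ S, (y.toLinearMap : Module.End k A) = (x.toLinearMap : Module.End k A) ^ p) ∧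
    (∀ x ∈ S, (x.toLinearMap : Module.End k A) ∈ Submodule.span k
      {z : Module.End k A | ∃ m : ℕ, 1 ≤ m ∧ z = (x.toLinearMap : Module.End k A) ^ (p ^ m)}) ∧
    Module.finrank k S = r := by
  refine ⟨LinearMap.range (T.dh ∘ₗ T.diag), ?_, ?_, ?_, ?_, ?_⟩
  · rintro _ ⟨c, rfl⟩; exact ⟨_, rfl⟩
  · rintro _ ⟨c, rfl⟩ _ ⟨d, rfl⟩
    have h : ⁅T.dh (T.diag c), T.dh (T.diag d)⁆ = 0 := by
      refine Derivation.ext fun f => ?_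
      rw [Derivation.commutator_apply]
      have := congrArg (fun F : Module.End k A => F f) (T.diag_comm c d)
      simp only [Module.End.mul_apply, E_apply] at this
      rw [this, sub_self]; rfl
    simp only [LinearMap.comp_apply]
    rw [h]; exact Submodule.zero_mem _
  · rintro _ ⟨c, rfl⟩
    refine ⟨_, ⟨fun i => c i ^ (p ^ 1), rfl⟩, ?_⟩
    have := T.diag_pow hp c 1
    rw [pow_one] at this
    simp only [pow_one]
    exact this.symm
  · rintro _ ⟨c, rfl⟩
    change T.E (T.diag c) ∈ Submodule.span k {z : Module.End k A | ∃ m : ℕ, 1 ≤ m ∧ z = T.E (T.diag c) ^ (p ^ m)}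
    have h := Submodule.mem_map_of_mem (f := T.E ∘ₗ T.diag) (frob_span p hp c)
    rw [Submodule.map_span] at h
    refine Submodule.span_mono ?_ h
    rintro _ ⟨_, ⟨m, rfl⟩, rfl⟩
    exact ⟨m + 1, by omega, (T.diag_pow hp c (m + 1)).symm⟩
  · rw [LinearMap.finrank_range_of_inj]
    · simp
    · rw [← LinearMap.ker_eq_bot, LinearMap.ker_eq_bot']
      exact T.diag_inj

end TD
end HamAux

set_option synthInstance.maxHeartbeats 1000000
set_option maxHeartbeats 1600000
set_option linter.all false
namespace HamAux
open scoped Polynomial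

theorem pow_line_poly {k M : Type*} [Field k] [AddCommGroup M] [Module k M] (a b : Module.End k M) (v : M)
    (n : ℕ) (φ : M →ₗ[k] k) : ∃ q : k[X], ∀ t, φ (((a + t • b) ^ n) v) = q.eval t := by
  induction n generalizing φ with
  | zero => exact ⟨Polynomial.C (φ v), by simp⟩
  | succ n ih =>
    obtain ⟨q1, h1⟩ := ih (φ ∘ₗ a)
    obtain ⟨q2, h2⟩ := ih (φ ∘ₗ b)
    refine ⟨q1 + Polynomial.X * q2, fun t => ?_⟩
    rw [pow_succ', Module.End.mul_apply, Polynomial.eval_add, Polynomial.eval_mul, Polynomial.eval_X, ← h1, ← h2]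
    simp

theorem der_prod {k A ι : Type*} [Field k] [CommRing A] [Algebra k A] (D : Derivation k A A) (h : ι → A)
    (hD : ∀ i, D (h i) = 0) (s : Finset ι) (a : ι → ℕ) : D (∏ i ∈ s, h i ^ a i) = 0 := by
  classical
  induction s using Finset.induction_on with
  | empty => simp
  | insert i s hi ih => rw [Finset.prod_insert hi, Derivation.leibniz, ih, Derivation.leibniz_pow, hD]; simp

theorem exists_c (p r : ℕ) (hp : p.Prime) (k : Type*) [Field k] [IsAlgClosed k] [CharP k p] :
    ∃ c : k, (∀ a : Fin r ⊕ Fin r → Fin p, TD.wt (fun j : Fin r => c ^ (j : ℕ)) a = 0 →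
        ∀ j, a (Sum.inr j) = a (Sum.inl j)) ∧
      Function.Injective (fun i : Fin r => c ^ (p ^ (i : ℕ))) := by
  classical
  haveI : Fact p.Prime := ⟨hp⟩
  haveI : ExpChar k p := ExpChar.prime hp
  haveI : Infinite k := IsAlgClosed.instInfinite
  let P : (Fin r ⊕ Fin r → Fin p) → k[X] := fun a =>
    ∑ j : Fin r, Polynomial.C (((a (Sum.inr j) : ℕ) : k) - ((a (Sum.inl j) : ℕ) : k)) * Polynomial.X ^ (j : ℕ)
  let Q : ℕ → k[X] := fun n => Polynomial.X ^ (p ^ (n + 1)) - Polynomial.X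
  let bad : Finset k := (Finset.univ.biUnion fun a => (P a).roots.toFinset) ∪
    ((Finset.range r).biUnion fun n => (Q n).roots.toFinset)
  obtain ⟨c, hc⟩ := Infinite.exists_notMem_finset bad
  simp only [bad, Finset.mem_union, not_or, Finset.mem_biUnion, not_exists, Finset.mem_univ, true_and,
    Multiset.mem_toFinset, Finset.mem_range, not_and] at hc
  refine ⟨c, ?_, ?_⟩
  · intro a ha
    have h1 := hc.1 a
    rw [Polynomial.mem_roots'] at h1
    have h2 : (P a).IsRoot c := by
      rw [Polynomial.IsRoot.def, Polynomial.eval_finset_sum, ← ha, TD.wt]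
      refine Finset.sum_congr rfl fun j _ => ?_
      simp; ring
    have h3 : P a = 0 := by by_contra h; exact h1 ⟨h, h2⟩
    intro j
    have h4 := congrArg (fun q : k[X] => q.coeff (j : ℕ)) h3
    simp only [P, Polynomial.finset_sum_coeff, Polynomial.coeff_C_mul, Polynomial.coeff_X_pow, Polynomial.coeff_zero] at h4
    rw [Finset.sum_eq_single j (fun i _ hi => by
      rw [if_neg (fun h => hi (Fin.ext h.symm)), mul_zero]) (by simp), if_pos rfl, mul_one, sub_eq_zero] at h4
    rw [CharP.cast_eq_iff_mod_eq k p, Nat.mod_eq_of_lt (a _).2, Nat.mod_eq_of_lt (a _).2] at h4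
    exact Fin.ext h4
  · have key : ∀ i j : ℕ, i < j → j < r → c ^ (p ^ i) ≠ c ^ (p ^ j) := by
      intro i j hij hj he
      obtain ⟨n, rfl⟩ : ∃ n, j = n + 1 + i := ⟨j - i - 1, by omega⟩
      rw [pow_add p (n+1) i, pow_mul] at he
      have h1 : c = c ^ (p ^ (n + 1)) := by
        apply (iterateFrobenius k p i).injective
        simpa only [iterateFrobenius_def] using he
      have h2 := hc.2 n (by omega)
      rw [Polynomial.mem_roots'] at h2
      apply h2
      refine ⟨?_, ?_⟩
      · exact FiniteField.X_pow_card_pow_sub_X_ne_zero k (by omega) hp.one_lt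
      · simp only [Q, Polynomial.IsRoot.def, Polynomial.eval_sub, Polynomial.eval_pow, Polynomial.eval_X]
        rw [← h1, sub_self]
    intro i j he
    rcases lt_trichotomy (i : ℕ) (j : ℕ) with h | h | h
    · exact absurd he (key _ _ h j.2)
    · exact Fin.ext h
    · exact absurd he.symm (key _ _ h i.2)

namespace TD
variable {p r : ℕ} {k A : Type*} [Field k] [CommRing A] [Algebra k A] (T : TD p r k A)

theorem nil_diag_le (hp : p.Prime) (c : Fin r → k)
    (hc : ∀ a : Fin r ⊕ Fin r → Fin p, wt c a = 0 → ∀ j, a (Sum.inr j) = a (Sum.inl j)) :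
    Module.finrank k ((T.E (T.diag c)).maxGenEigenspace 0) ≤ p ^ r := by
  haveI := T.fin
  let F : A →ₗ[k] ((Fin r → Fin p) → k) := LinearMap.pi fun e => T.b.coord (Sum.elim e e)
  have hF : ∀ f ∈ (T.E (T.diag c)).maxGenEigenspace 0, F f = 0 → f = 0 := by
    intro f hf h0
    rw [Module.End.mem_maxGenEigenspace] at hf
    obtain ⟨n, hn⟩ := hf
    rw [zero_smul, sub_zero] at hn
    apply T.b.repr.injective
    ext a
    rw [map_zero, Finsupp.zero_apply]
    by_cases hw : wt c a = 0
    · have h1 := hc a hw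
      have h2 : a = Sum.elim (fun j => a (Sum.inl j)) (fun j => a (Sum.inl j)) := by
        funext j; rcases j with j | j
        · rfl
        · exact h1 j
      rw [h2]
      exact congrFun h0 (fun j => a (Sum.inl j))
    · have h1 := T.diag_repr_pow c n f a
      rw [hn, map_zero, Finsupp.zero_apply, eq_comm, mul_eq_zero] at h1
      exact h1.resolve_left (pow_ne_zero _ hw)
  have := LinearMap.finrank_le_finrank_of_injective (f := F.domRestrict ((T.E (T.diag c)).maxGenEigenspace 0)) (by
    rw [← LinearMap.ker_eq_bot, LinearMap.ker_eq_bot']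
    rintro ⟨f, hf⟩ h
    exact Subtype.ext (hF f hf h))
  simpa using this

theorem surj_of (hp : p.Prime) [CharP k p] (R : Subalgebra k A)
    (hR : ∀ j, ∃ y ∈ R, y ∈ T.m ∧ T.X j - y ∈ T.m ^ 2) : R = ⊤ := by
  have h1 : ∀ z ∈ T.m, ∃ y ∈ R, y ∈ T.m ∧ z - y ∈ T.m ^ 2 := by
    intro z hz
    choose y hy1 hy2 hy3 using hR
    refine ⟨∑ j, T.ell z j • y j, ?_, ?_, ?_⟩
    · exact R.sum_mem fun j _ => R.smul_mem (hy1 j) _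
    · exact Ideal.sum_mem _ fun j _ => by
        rw [Algebra.smul_def]; exact Ideal.mul_mem_left _ _ (hy2 j)
    · have h := T.taylor z
      rw [(T.mem_m z).1 hz, map_zero, sub_zero] at h
      have h' : ∑ j, T.ell z j • (T.X j - y j) ∈ T.m ^ 2 := Ideal.sum_mem _ fun j _ => by
        rw [Algebra.smul_def]; exact Ideal.mul_mem_left _ _ (hy3 j)
      have := Ideal.add_mem _ h h'
      convert this using 1
      simp only [smul_sub, Finset.sum_sub_distrib]; ring
  have h2 : ∀ n, ∀ x ∈ T.m ^ n, ∃ y ∈ R, y ∈ T.m ^ n ∧ x - y ∈ T.m ^ (n + 1) := by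
    intro n
    induction n with
    | zero =>
      intro x _
      refine ⟨algebraMap k A (T.ev x), R.algebraMap_mem _, by simp, ?_⟩
      rw [zero_add, pow_one, mem_m]; simp
    | succ n ih =>
      intro x hx
      rw [pow_succ] at hx
      induction hx using Submodule.mul_induction_on' with
      | mem_mul_mem x hx z hz =>
        obtain ⟨y, hy1, hy2, hy3⟩ := ih x hx
        obtain ⟨y', hy1', hy2', hy3'⟩ := h1 z hz
        refine ⟨y * y', R.mul_mem hy1 hy1', ?_, ?_⟩
        · rw [pow_succ]; exact Ideal.mul_mem_mul hy2 hy2'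
        · have e : x * z - y * y' = x * (z - y') + (x - y) * y' := by ring
          rw [e]
          refine Ideal.add_mem _ ?_ ?_
          · rw [add_assoc, pow_add]; exact Ideal.mul_mem_mul hx hy3'
          · rw [pow_succ]; exact Ideal.mul_mem_mul hy3 hy2'
      | add x _ z _ hx hz =>
        obtain ⟨y, hy1, hy2, hy3⟩ := hx
        obtain ⟨y', hy1', hy2', hy3'⟩ := hz
        refine ⟨y + y', R.add_mem hy1 hy1', Ideal.add_mem _ hy2 hy2', ?_⟩
        have := Ideal.add_mem _ hy3 hy3'
        convert this using 1; ring
  have h3 : ∀ n x, ∃ y ∈ R, x - y ∈ T.m ^ n := by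
    intro n
    induction n with
    | zero => intro x; exact ⟨0, R.zero_mem, by simp⟩
    | succ n ih =>
      intro x
      obtain ⟨y, hy, h⟩ := ih x
      obtain ⟨y', hy1, _, hy3⟩ := h2 n _ h
      exact ⟨y + y', R.add_mem hy hy1, by rw [← sub_sub]; exact hy3⟩
  obtain ⟨N, hN⟩ := T.m_nilp hp
  rw [eq_top_iff]
  intro x _
  obtain ⟨y, hy, h⟩ := h3 N x
  rw [hN] at h
  have : x = y := sub_eq_zero.1 h
  rw [this]; exact hy

theorem good_nil (hp : p.Prime) (hp3 : 3 ≤ p) [CharP k p] (g : A)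
    (hdet : (Matrix.of fun i j : Fin r => T.ev ((T.E g ^ (p ^ (i : ℕ))) (T.X (Sum.inl j)))).det ≠ 0) :
    p ^ r ≤ Module.finrank k ((T.E g).maxGenEigenspace 0) := by
  classical
  haveI := T.fin
  haveI : NeZero p := ⟨hp.ne_zero⟩
  choose g' hg' using T.pclosed_iter hp hp3 g
  let h : Fin r → A := fun i => g' i - algebraMap k A (T.ev (g' i))
  have hev : ∀ i, T.ev (h i) = 0 := by intro i; simp [h]
  have hEh : ∀ i : Fin r, T.E (h i) = T.E g ^ (p ^ (i : ℕ)) := by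
    intro i; simp only [h, map_sub, T.E_alg hp, sub_zero, hg']
  have hpow : ∀ i, h i ^ p = 0 := by
    intro i; rw [T.ev_pow hp, hev, zero_pow hp.ne_zero, map_zero]
  have hker : ∀ i, T.dh g (h i) = 0 := by
    intro i
    rw [T.dh_swap, ← E_apply, hEh]
    obtain ⟨n, hn⟩ : ∃ n, p ^ (i : ℕ) = n + 1 := ⟨p ^ (i : ℕ) - 1, by have := pow_pos hp.pos (i : ℕ); omega⟩
    rw [hn, pow_succ, Module.End.mul_apply, E_apply T g g, dh_self, map_zero, neg_zero]
  obtain ⟨φ, hφ⟩ := T.lift (Sum.elim (fun j => T.X (Sum.inl j)) h) (by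
    rintro (j | j)
    · exact T.X_pow _
    · exact hpow j)
  have hφl : ∀ j, φ (T.X (Sum.inl j)) = T.X (Sum.inl j) := fun j => hφ (Sum.inl j)
  have hφr : ∀ j, φ (T.X (Sum.inr j)) = h j := fun j => hφ (Sum.inr j)
  let N : Matrix (Fin r) (Fin r) k := Matrix.of fun i j => T.ell (h i) (Sum.inr j)
  have hN : N = - (Matrix.of fun i j : Fin r => T.ev ((T.E g ^ (p ^ (i : ℕ))) (T.X (Sum.inl j)))) := by
    ext i j
    simp only [N, Matrix.of_apply, Matrix.neg_apply, ell_apply, ← hEh, E_apply, dh_inl, map_neg, neg_neg]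
  have hNdet : IsUnit N.det := by
    rw [hN, Matrix.det_neg, isUnit_iff_ne_zero]
    exact mul_ne_zero (pow_ne_zero _ (by simp)) hdet
  have hsurj : φ.range = ⊤ := by
    apply T.surj_of hp
    rintro (j | j)
    · exact ⟨T.X (Sum.inl j), ⟨_, hφl j⟩, T.ev_X _, by simp⟩
    · let u : Fin r → A := fun i => h i - ∑ l, T.ell (h i) (Sum.inl l) • T.X (Sum.inl l)
      have hu1 : ∀ i, u i ∈ φ.range := fun i =>
        φ.range.sub_mem ⟨_, hφr i⟩ (φ.range.sum_mem fun l _ => φ.range.smul_mem ⟨_, hφl l⟩ _)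
      have hu2 : ∀ i, u i ∈ T.m := fun i => by
        rw [mem_m]; simp [u, hev, T.ev_X]
      have hu3 : ∀ i, u i - ∑ l, N i l • T.X (Sum.inr l) ∈ T.m ^ 2 := fun i => by
        have := T.taylor (h i)
        rw [hev, map_zero, sub_zero, Fintype.sum_sum_type, ← sub_sub] at this
        exact this
      refine ⟨∑ i, N⁻¹ j i • u i, φ.range.sum_mem fun i _ => φ.range.smul_mem (hu1 i) _,
        Ideal.sum_mem _ fun i _ => by rw [Algebra.smul_def]; exact Ideal.mul_mem_left _ _ (hu2 i), ?_⟩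
      have e : ∑ i, N⁻¹ j i • ∑ l, N i l • T.X (Sum.inr l) = T.X (Sum.inr j) := by
        simp only [Finset.smul_sum, smul_smul]
        rw [Finset.sum_comm]
        simp only [← Finset.sum_smul]
        have : ∀ l, ∑ i, N⁻¹ j i * N i l = (1 : Matrix (Fin r) (Fin r) k) j l := by
          intro l; rw [← Matrix.nonsing_inv_mul N hNdet, Matrix.mul_apply]
        simp [this, Matrix.one_apply]
      have h' : ∑ i, N⁻¹ j i • (u i - ∑ l, N i l • T.X (Sum.inr l)) ∈ T.m ^ 2 := Ideal.sum_mem _ fun i _ => by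
        rw [Algebra.smul_def]; exact Ideal.mul_mem_left _ _ (hu3 i)
      simp only [smul_sub, Finset.sum_sub_distrib] at h'
      rw [e] at h'
      rw [← neg_sub]; exact neg_mem h'
  have hs : Function.Surjective φ.toLinearMap := by
    intro x
    have : x ∈ φ.range := by rw [hsurj]; trivial
    exact this
  have hi := LinearMap.injective_iff_surjective.2 hs
  let w : (Fin r → Fin p) → A := fun e => φ (T.b (Sum.elim 0 e))
  have hw : LinearIndependent k w := by
    have h1 : LinearIndependent k (fun e : Fin r → Fin p => T.b (Sum.elim 0 e)) :=
      T.b.linearIndependent.comp _ (fun e e' he => by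
        funext j; exact congrFun he (Sum.inr j))
    exact h1.map' φ.toLinearMap (LinearMap.ker_eq_bot.2 hi)
  have hwk : ∀ e, w e ∈ LinearMap.ker (T.E g) := by
    intro e
    have : w e = ∏ i, h i ^ (e i : ℕ) := by
      simp only [w, T.hb, map_prod, Fintype.prod_sum_type, map_pow]
      simp [hφr]
    rw [this, LinearMap.mem_ker, E_apply]
    exact der_prod _ h hker _ _
  have hle : LinearMap.ker (T.E g) ≤ (T.E g).maxGenEigenspace 0 := by
    intro x hx
    rw [Module.End.mem_maxGenEigenspace]
    exact ⟨1, by simpa using hx⟩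
  refine le_trans ?_ (Submodule.finrank_mono hle)
  have h2 : LinearIndependent k (fun e => (⟨w e, hwk e⟩ : LinearMap.ker (T.E g))) :=
    LinearIndependent.of_comp (LinearMap.ker (T.E g)).subtype hw
  have := h2.fintype_card_le_finrank
  simpa using this

theorem nil_ge (hp : p.Prime) (hp3 : 3 ≤ p) [CharP k p] [IsAlgClosed k] (f : A) :
    p ^ r ≤ Module.finrank k ((T.E f).maxGenEigenspace 0) := by
  classical
  haveI := T.fin
  haveI : Infinite k := IsAlgClosed.instInfinite
  obtain ⟨c, -, hc⟩ := exists_c p r hp k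
  let fs : A := ∑ j : Fin r, -(c ^ (j : ℕ)) • ((1 + T.X (Sum.inl j)) * T.X (Sum.inr j))
  have h1 : ∀ j : Fin r, T.E fs (T.X (Sum.inl j)) = c ^ (j : ℕ) • (1 + T.X (Sum.inl j)) := by
    intro j
    rw [E_apply, dh_inl]
    simp only [fs, map_sum, Derivation.map_smul, Derivation.leibniz, T.pd_X, map_add]
    simp [add_comm]
  have h2 : ∀ (j : Fin r) (n : ℕ), (T.E fs ^ (n + 1)) (T.X (Sum.inl j)) = (c ^ (j : ℕ)) ^ (n + 1) • (1 + T.X (Sum.inl j)) := by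
    intro j n
    induction n with
    | zero => simpa using h1 j
    | succ n ih =>
      rw [pow_succ', Module.End.mul_apply, ih, map_smul, map_add, h1, E_apply, Derivation.map_one_eq_zero, zero_add,
        smul_smul, ← pow_succ]
  have h3 : ∀ (j : Fin r) (n : ℕ), 0 < n → T.ev ((T.E fs ^ n) (T.X (Sum.inl j))) = (c ^ n) ^ (j : ℕ) := by
    intro j n hn
    obtain ⟨n, rfl⟩ : ∃ n', n = n' + 1 := ⟨n - 1, by omega⟩
    rw [h2]; simp [T.ev_X]; ring
  choose q hq using fun i j : Fin r => pow_line_poly (T.E f) (T.E (fs - f)) (T.X (Sum.inl j)) (p ^ (i : ℕ)) T.ev.toLinearMap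
  let P : k[X] := (Matrix.of q).det
  have hP : ∀ t, P.eval t = (Matrix.of fun i j : Fin r =>
      T.ev (((T.E (f + t • (fs - f))) ^ (p ^ (i : ℕ))) (T.X (Sum.inl j)))).det := by
    intro t
    rw [← Polynomial.coe_evalRingHom, RingHom.map_det]
    congr 1
    ext i j
    simp only [RingHom.mapMatrix_apply, Matrix.map_apply, Matrix.of_apply, Polynomial.coe_evalRingHom, ← hq, map_add, map_smul]
    rfl
  refine line_nil (T.E f) (T.E (fs - f)) (p ^ r) P ?_ ?_
  · intro h0
    have := hP 1
    rw [h0, Polynomial.eval_zero, one_smul, add_sub_cancel] at this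
    have e : (Matrix.of fun i j : Fin r => T.ev ((T.E fs ^ (p ^ (i : ℕ))) (T.X (Sum.inl j)))) =
        Matrix.vandermonde (fun i : Fin r => c ^ (p ^ (i : ℕ))) := by
      ext i j
      rw [Matrix.of_apply, h3 _ _ (pow_pos hp.pos _), Matrix.vandermonde_apply]
    rw [e] at this
    exact Matrix.det_vandermonde_ne_zero_iff.2 hc this.symm
  · intro t ht
    rw [hP] at ht
    have := T.good_nil hp hp3 _ ht
    rwa [map_add, map_smul] at this

theorem finrank_engel (hp : p.Prime) [CharP k p] (K : LieSubalgebra k (Derivation k A A))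
    (hK : K.toSubmodule = LinearMap.range T.dh) (f : A) (x : K) (hx : (x : Derivation k A A) = T.dh f) :
    Module.finrank k (LieSubalgebra.engel k x) + 1 = Module.finrank k ((T.E f).maxGenEigenspace 0) := by
  haveI := T.fin
  rw [← T.finrank_map_dh hp]
  swap
  · rw [Module.End.mem_maxGenEigenspace]
    exact ⟨1, by simp [E_apply]⟩
  congr 1
  have key : ∀ (n : ℕ) (y : K) (g : A), (y : Derivation k A A) = T.dh g →
      (((LieAlgebra.ad k K x ^ n) y : K) : Derivation k A A) = T.dh ((T.E f ^ n) g) := by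
    intro n
    induction n with
    | zero => intro y g h; simpa using h
    | succ n ih =>
      intro y g h
      rw [pow_succ, pow_succ, Module.End.mul_apply, Module.End.mul_apply]
      apply ih
      rw [LieAlgebra.ad_apply, LieSubalgebra.coe_bracket, hx, h, dh_lie]; rfl
  have e : (LieSubalgebra.engel k x).toSubmodule.map K.toSubmodule.subtype =
      ((T.E f).maxGenEigenspace 0).map T.dh := by
    ext z
    constructor
    · rintro ⟨y, hy, rfl⟩
      have hy' : y ∈ LieSubalgebra.engel k x := hy
      rw [LieSubalgebra.mem_engel_iff] at hy'
      obtain ⟨n, hn⟩ := hy'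
      obtain ⟨g, hg⟩ : (y : Derivation k A A) ∈ LinearMap.range T.dh := by rw [← hK]; exact y.2
      refine ⟨g, ?_, hg⟩
      have h1 := key n y g hg.symm
      have hn' : ((LieAlgebra.ad k K x ^ n) (y : K) : K) = 0 := hn
      rw [hn'] at h1
      have h2 := (T.dh_eq_zero_iff hp _).1 h1.symm
      change g ∈ (T.E f).maxGenEigenspace 0
      rw [Module.End.mem_maxGenEigenspace]
      refine ⟨n + 1, ?_⟩
      rw [zero_smul, sub_zero, pow_succ', Module.End.mul_apply, h2, E_apply, Derivation.map_algebraMap]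
    · rintro ⟨g, hg, rfl⟩
      have hg' : g ∈ (T.E f).maxGenEigenspace 0 := hg
      rw [Module.End.mem_maxGenEigenspace] at hg'
      obtain ⟨n, hn⟩ := hg'
      rw [zero_smul, sub_zero] at hn
      have hm : T.dh g ∈ K.toSubmodule := by rw [hK]; exact ⟨g, rfl⟩
      refine ⟨⟨T.dh g, hm⟩, ?_, rfl⟩
      change _ ∈ LieSubalgebra.engel k x
      rw [LieSubalgebra.mem_engel_iff]
      refine ⟨n, Subtype.ext ?_⟩
      rw [key n ⟨T.dh g, hm⟩ g rfl, hn, map_zero]; rfl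
  rw [← e]
  exact (Submodule.finrank_map_subtype_eq K.toSubmodule (LieSubalgebra.engel k x).toSubmodule).symm

theorem rank_eq (hp : p.Prime) (hp3 : 3 ≤ p) [CharP k p] [IsAlgClosed k] (K : LieSubalgebra k (Derivation k A A))
    (hK : K.toSubmodule = LinearMap.range T.dh) :
    sInf {d : ℕ | ∃ H : LieSubalgebra k K, H.IsCartanSubalgebra ∧ Module.finrank k H = d} = p ^ r - 1 := by
  haveI := T.fin
  haveI : Infinite k := IsAlgClosed.instInfinite
  haveI : Module.Finite k K := by
    have : Module.Finite k K.toSubmodule := by rw [hK]; infer_instance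
    exact this
  apply lieRank_eq
  · intro x
    obtain ⟨f, hf⟩ : (x : Derivation k A A) ∈ LinearMap.range T.dh := by rw [← hK]; exact x.2
    have h1 := T.finrank_engel hp K hK f x hf.symm
    have h2 := T.nil_ge hp hp3 f
    omega
  · obtain ⟨c, hc, -⟩ := exists_c p r hp k
    let f := T.diag (fun j : Fin r => c ^ (j : ℕ))
    have hm : T.dh f ∈ K.toSubmodule := by rw [hK]; exact ⟨f, rfl⟩
    refine ⟨⟨T.dh f, hm⟩, ?_⟩
    have h1 := T.finrank_engel hp K hK f ⟨T.dh f, hm⟩ rfl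
    have h2 := T.nil_diag_le hp _ hc
    have h3 : Module.finrank k ((T.E f).maxGenEigenspace 0) ≤ p ^ r := h2
    omega

end TD
end HamAux

set_option synthInstance.maxHeartbeats 1000000
set_option maxHeartbeats 1600000
set_option linter.all false
namespace HamAux
section
variable (p : ℕ) (k : Type*) [Field k] (n : ℕ)

/-- monomials of the truncated polynomial ring -/
noncomputable def tmon (a : Fin n → Fin p) : TruncPoly p k n := ∏ i, truncX p k n i ^ (a i : ℕ)

theorem truncX_pow (i) : truncX p k n i ^ p = 0 := by
  rw [truncX, ← map_pow, Ideal.Quotient.eq_zero_iff_mem]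
  exact Ideal.subset_span ⟨i, rfl⟩

theorem mk_monomial (d : Fin n →₀ ℕ) (c : k) : Ideal.Quotient.mk (truncIdeal p k n) (MvPolynomial.monomial d c) =
    c • ∏ i, truncX p k n i ^ (d i) := by
  have h : MvPolynomial.monomial d c = c • ∏ i, (MvPolynomial.X i : MvPolynomial (Fin n) k) ^ (d i) := by
    rw [MvPolynomial.monomial_eq, MvPolynomial.smul_eq_C_mul, Finsupp.prod_fintype _ _ (by simp)]
  rw [h]
  have := map_smul (Ideal.Quotient.mkₐ k (truncIdeal p k n)) c (∏ i, (MvPolynomial.X i : MvPolynomial (Fin n) k) ^ (d i))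
  rw [Ideal.Quotient.mkₐ_eq_mk] at this
  rw [this, map_prod]
  simp only [map_pow]
  rfl

theorem tmon_span : ⊤ ≤ Submodule.span k (Set.range (tmon p k n)) := by
  rintro x -
  obtain ⟨f, rfl⟩ := Ideal.Quotient.mk_surjective x
  induction f using MvPolynomial.induction_on' with
  | monomial d c =>
    rw [mk_monomial]
    apply Submodule.smul_mem
    by_cases h : ∀ i, d i < p
    · exact Submodule.subset_span ⟨fun i => ⟨d i, h i⟩, rfl⟩
    · push Not at h
      obtain ⟨i, hi⟩ := h
      have h0 : truncX p k n i ^ d i = 0 := pow_eq_zero_of_le hi (truncX_pow p k n i)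
      rw [Finset.prod_eq_zero (Finset.mem_univ i) h0]
      exact Submodule.zero_mem _
  | add f g hf hg => rw [map_add]; exact Submodule.add_mem _ hf hg

theorem mem_trunc (f : MvPolynomial (Fin n) k) (hf : f ∈ truncIdeal p k n) (d) (hd : ∀ i, d i < p) :
    f.coeff d = 0 := by
  have h : truncIdeal p k n = Ideal.span ((fun s => MvPolynomial.monomial s (1 : k)) '' (Set.range fun i : Fin n => Finsupp.single i p)) := by
    have hs : {f : MvPolynomial (Fin n) k | ∃ i : Fin n, f = MvPolynomial.X i ^ p} =
        (fun s => MvPolynomial.monomial s (1 : k)) '' (Set.range fun i : Fin n => Finsupp.single i p) := by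
      ext g
      constructor
      · rintro ⟨i, rfl⟩; exact ⟨_, ⟨i, rfl⟩, by rw [MvPolynomial.X_pow_eq_monomial]⟩
      · rintro ⟨_, ⟨i, rfl⟩, rfl⟩; exact ⟨i, by rw [MvPolynomial.X_pow_eq_monomial]⟩
    rw [← hs]
  rw [h, MvPolynomial.mem_ideal_span_monomial_image] at hf
  by_contra hne
  obtain ⟨_, ⟨i, rfl⟩, hle⟩ := hf d (MvPolynomial.mem_support_iff.2 hne)
  have := hle i
  simp at this
  have := hd i
  omega

theorem tmon_li : LinearIndependent k (tmon p k n) := by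
  classical
  rw [Fintype.linearIndependent_iff]
  intro c hc a
  let s : (Fin n → Fin p) → (Fin n →₀ ℕ) := fun a => Finsupp.equivFunOnFinite.symm (fun i => (a i : ℕ))
  have h1 : Ideal.Quotient.mk (truncIdeal p k n) (∑ a, MvPolynomial.monomial (s a) (c a)) = 0 := by
    rw [map_sum, ← hc]
    refine Finset.sum_congr rfl fun a _ => ?_
    rw [mk_monomial]; rfl
  rw [Ideal.Quotient.eq_zero_iff_mem] at h1
  have h2 := mem_trunc p k n _ h1 (s a) (fun i => (a i).2)
  rw [MvPolynomial.coeff_sum, Finset.sum_eq_single a] at h2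
  · rwa [MvPolynomial.coeff_monomial, if_pos rfl] at h2
  · intro b _ hb
    rw [MvPolynomial.coeff_monomial, if_neg]
    intro h
    apply hb
    funext i
    exact Fin.ext (DFunLike.congr_fun h i)
  · simp

/-- monomial basis -/
noncomputable def tbasis : Module.Basis (Fin n → Fin p) k (TruncPoly p k n) :=
  Module.Basis.mk (tmon_li p k n) (tmon_span p k n)

end

/-- index map -/
def idx (r : ℕ) : Fin r ⊕ Fin r → Fin (2 * r) :=
  Sum.elim (fun i => ⟨i.1, by have := i.isLt; omega⟩) (fun i => ⟨i.1 + r, by have := i.isLt; omega⟩)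

theorem idx_bij (r : ℕ) : Function.Bijective (idx r) := by
  rw [Fintype.bijective_iff_injective_and_card]
  constructor
  · rintro (⟨i, hi⟩ | ⟨i, hi⟩) (⟨j, hj⟩ | ⟨j, hj⟩) h <;> simp [idx] at h ⊢ <;> omega
  · simp; omega

/-- index equivalence -/
noncomputable def idxE (r : ℕ) : Fin r ⊕ Fin r ≃ Fin (2 * r) := Equiv.ofBijective _ (idx_bij r)

/-- The truncated polynomial ring as an instance of the abstract package. -/
noncomputable def theTD (p : ℕ) (hp : p.Prime) (k : Type*) [Field k] [CharP k p] (r : ℕ) :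
    TD p r k (TruncPoly p k (2 * r)) where
  X := fun j => truncX p k (2 * r) (idx r j)
  pd := fun j => truncPD p k (2 * r) (idx r j)
  pd_X := by
    classical
    intro i j
    change Ideal.Quotient.mk (truncIdeal p k (2 * r)) (MvPolynomial.pderiv (idx r i) (MvPolynomial.X (idx r j))) = _
    rw [MvPolynomial.pderiv_X]
    by_cases h : i = j
    · subst h; simp
    · rw [if_neg h, Pi.single_eq_of_ne, map_zero]
      intro h'; exact h ((idx_bij r).1 h'.symm)
  X_pow := fun i => truncX_pow p k _ _
  b := (tbasis p k (2 * r)).reindex ((idxE r).arrowCongr (Equiv.refl (Fin p))).symm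
  hb := by
    intro a
    rw [Module.Basis.reindex_apply, tbasis, Module.Basis.mk_apply, tmon]
    symm
    apply Fintype.prod_equiv (idxE r)
    intro i
    simp [idxE]
  ev := Ideal.Quotient.liftₐ (truncIdeal p k (2 * r)) (MvPolynomial.aeval (fun _ => (0 : k))) (by
    intro a ha
    have : truncIdeal p k (2 * r) ≤ RingHom.ker (MvPolynomial.aeval (fun _ : Fin (2 * r) => (0 : k)) : MvPolynomial (Fin (2 * r)) k →ₐ[k] k) := by
      rw [Ideal.span_le]
      rintro _ ⟨i, rfl⟩
      simp [hp.ne_zero]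
    exact this ha)
  ev_X := by
    intro i
    change MvPolynomial.aeval (fun _ => (0 : k)) (MvPolynomial.X (idx r i)) = 0
    simp
  lift := by
    intro h hh
    refine ⟨Ideal.Quotient.liftₐ (truncIdeal p k (2 * r)) (MvPolynomial.aeval (fun j => h ((idxE r).symm j))) ?_, ?_⟩
    · intro a ha
      have : truncIdeal p k (2 * r) ≤ RingHom.ker (MvPolynomial.aeval (fun j => h ((idxE r).symm j)) : MvPolynomial (Fin (2 * r)) k →ₐ[k] TruncPoly p k (2 * r)) := by
        rw [Ideal.span_le]
        rintro _ ⟨i, rfl⟩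
        simp [hh]
      exact this ha
    · intro i
      change MvPolynomial.aeval (fun j => h ((idxE r).symm j)) (MvPolynomial.X (idx r i)) = h i
      rw [MvPolynomial.aeval_X]
      congr 1
      exact (idxE r).symm_apply_apply i

theorem DH_eq (p : ℕ) (hp : p.Prime) (k : Type*) [Field k] [CharP k p] (r : ℕ) (f) :
    DH p k r f = (theTD p hp k r).dh f := rfl

theorem ambient_eq (p : ℕ) (hp : p.Prime) (k : Type*) [Field k] [CharP k p] (r : ℕ) :
    (hamiltonianAmbient p k r).toSubmodule = LinearMap.range (theTD p hp k r).dh := by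
  let T := theTD p hp k r
  let K : LieSubalgebra k (WittAlg p k (2 * r)) :=
    { LinearMap.range T.dh with
      lie_mem' := by
        rintro _ _ ⟨f, rfl⟩ ⟨g, rfl⟩
        exact ⟨_, (T.dh_lie f g).symm⟩ }
  apply le_antisymm
  · have : hamiltonianAmbient p k r ≤ K := by
      rw [hamiltonianAmbient, LieSubalgebra.lieSpan_le]
      rintro _ ⟨f, rfl⟩
      exact ⟨f, rfl⟩
    exact this
  · rintro _ ⟨f, rfl⟩
    exact LieSubalgebra.subset_lieSpan ⟨f, rfl⟩

theorem alg_eq (p : ℕ) (hp : p.Prime) (k : Type*) [Field k] [CharP k p] (r : ℕ) :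
    (hamiltonianAlg p k r).toSubmodule =
      (LinearMap.ker ((theTD p hp k r).top hp.pos)).map (theTD p hp k r).dh := by
  let T := theTD p hp k r
  have hA : ∀ x, x ∈ hamiltonianAmbient p k r ↔ ∃ f, T.dh f = x := by
    intro x
    have := congrArg (fun S : Submodule k (WittAlg p k (2 * r)) => x ∈ S) (ambient_eq p hp k r)
    exact this ▸ Iff.rfl
  let K : LieSubalgebra k (WittAlg p k (2 * r)) :=
    { (LinearMap.ker (T.top hp.pos)).map T.dh with
      lie_mem' := by
        rintro _ _ ⟨f, _, rfl⟩ ⟨g, _, rfl⟩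
        exact ⟨T.dh f g, T.top_dh hp.two_le f g, (T.dh_lie f g).symm⟩ }
  apply le_antisymm
  · have : hamiltonianAlg p k r ≤ K := by
      rw [hamiltonianAlg, derivedSub, LieSubalgebra.lieSpan_le]
      rintro _ ⟨x, hx, y, hy, rfl⟩
      obtain ⟨f, rfl⟩ := (hA x).1 hx
      obtain ⟨g, rfl⟩ := (hA y).1 hy
      exact ⟨T.dh f g, T.top_dh hp.two_le f g, (T.dh_lie f g).symm⟩
    exact this
  · rintro _ ⟨f, hf, rfl⟩
    have := T.mem_of_top_zero hp ((hamiltonianAlg p k r).toSubmodule.comap T.dh) (by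
      intro f g
      change T.dh (T.dh f g) ∈ hamiltonianAlg p k r
      rw [← T.dh_lie]
      exact LieSubalgebra.subset_lieSpan ⟨_, (hA _).2 ⟨f, rfl⟩, _, (hA _).2 ⟨g, rfl⟩, rfl⟩) f hf
    exact this

end HamAux

theorem hamiltonianAmbient_mu_ideal_rank (p : ℕ) (hp : p.Prime) (hp3 : 3 ≤ p)
    (k : Type*) [Field k] [IsAlgClosed k] [CharP k p]
    (r : ℕ) (hr : 1 ≤ r) :
    muIn p k (2 * r) (hamiltonianAmbient p k r) = r ∧
    hamiltonianAlg p k r ≤ hamiltonianAmbient p k r ∧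
    (∀ x ∈ hamiltonianAmbient p k r, ∀ y ∈ hamiltonianAlg p k r,
      ⁅x, y⁆ ∈ hamiltonianAlg p k r) ∧
    (∀ y ∈ hamiltonianAlg p k r, ∃ z ∈ hamiltonianAlg p k r,
      derToEnd p k (2 * r) z = (derToEnd p k (2 * r) y) ^ p) ∧
    Module.finrank k (hamiltonianAlg p k r) + 1
      = Module.finrank k (hamiltonianAmbient p k r) ∧
    lieRankOf k (hamiltonianAmbient p k r) = p ^ r - 1 := by
  let T := HamAux.theTD p hp k r
  have hA := HamAux.ambient_eq p hp k r
  have hB := HamAux.alg_eq p hp k r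
  have hAm : ∀ x, x ∈ hamiltonianAmbient p k r ↔ ∃ f, T.dh f = x := by
    intro x
    rw [← LieSubalgebra.mem_toSubmodule, hA]; exact Iff.rfl
  have hBm : ∀ x, x ∈ hamiltonianAlg p k r ↔ ∃ f, T.top hp.pos f = 0 ∧ T.dh f = x := by
    intro x
    rw [← LieSubalgebra.mem_toSubmodule, hB]; exact Iff.rfl
  refine ⟨?_, ?_, ?_, ?_, ?_, ?_⟩
  · obtain ⟨S, h1, h2, h3, h4, h5⟩ := T.torus_ex hp
    have hub : ∀ d ∈ {d : ℕ | ∃ S : Submodule k (WittAlg p k (2 * r)),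
        IsTorusIn p k (2 * r) (hamiltonianAmbient p k r) S ∧ Module.finrank k S = d}, d ≤ r := by
      rintro d ⟨S, ⟨h1, h2, h3, h4⟩, rfl⟩
      exact T.torus_le hp S (fun x hx => (hAm x).1 (h1 x hx)) h2 h4
    apply le_antisymm
    · exact csSup_le ⟨r, S, ⟨fun x hx => (hAm x).2 (h1 hx), h2, h3, h4⟩, h5⟩ hub
    · exact le_csSup ⟨r, hub⟩ ⟨S, ⟨fun x hx => (hAm x).2 (h1 hx), h2, h3, h4⟩, h5⟩
  · intro x hx
    obtain ⟨f, _, rfl⟩ := (hBm x).1 hx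
    exact (hAm _).2 ⟨f, rfl⟩
  · intro x hx y hy
    obtain ⟨f, rfl⟩ := (hAm x).1 hx
    obtain ⟨g, _, rfl⟩ := (hBm y).1 hy
    rw [T.dh_lie]
    exact (hBm _).2 ⟨_, T.top_dh hp.two_le f g, rfl⟩
  · intro y hy
    obtain ⟨f, _, rfl⟩ := (hBm y).1 hy
    obtain ⟨g, hg, e⟩ := T.pclosed hp hp3 f
    exact ⟨T.dh g, (hBm _).2 ⟨g, hg, rfl⟩, e.symm⟩
  · have h := T.finrank_H hp hr
    have e1 : Module.finrank k (hamiltonianAlg p k r) = Module.finrank k (hamiltonianAlg p k r).toSubmodule := rfl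
    have e2 : Module.finrank k (hamiltonianAmbient p k r) = Module.finrank k (hamiltonianAmbient p k r).toSubmodule := rfl
    rw [e1, e2, hA, hB]
    exact h
  · exact T.rank_eq hp hp3 _ hA
end
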